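/- Let Ω ⊂ ℝ² be a compact convex region of unit area with nonempty interior, c > 0 a constant, and r_n = √((log n + c)/(π·n)). Then the probability that the random geometric graph G(χ_n, r_n) has no isolated vertex (every vertex has degree ≥ 1) and the probability that G(χ_n, r_n) is connected both converge to exp(−e^{−c}) as n → ∞. -/

import Mathlib

open MeasureTheory Metric Real Filter Topology
open scoped ENNReal

namespace RandomGeometricGraph

/-- The Euclidean plane. -/
abbrev Plane := EuclideanSpace ℝ (Fin 2)

/-- The coordinates of a point of the plane, as a measurable equivalence. -/
noncomputable def coords : Plane ≃ᵐ ℝ × ℝ :=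
  (MeasurableEquiv.toLp 2 (Fin 2 → ℝ)).symm.trans MeasurableEquiv.finTwoArrow

lemma coords_apply (x : Plane) : coords x = (x 0, x 1) := rfl

lemma measurePreserving_coords : MeasurePreserving coords volume volume :=
  (EuclideanSpace.volume_preserving_symm_measurableEquiv_toLp (Fin 2)).trans
    (volume_preserving_finTwoArrow ℝ)

lemma norm_sq_eq (x : Plane) : ‖x‖ ^ 2 = x 0 ^ 2 + x 1 ^ 2 := by
  simp [EuclideanSpace.norm_sq_eq, Fin.sum_univ_two]

lemma volume_real_closedBall (x : Plane) {r : ℝ} (hr : 0 ≤ r) :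
    volume.real (closedBall x r) = π * r ^ 2 := by
  simp [Measure.real, EuclideanSpace.volume_closedBall_fin_two, ENNReal.toReal_ofReal hr,
    ENNReal.toReal_ofReal pi_pos.le, mul_comm]

lemma exists_linearIsometryEquiv_map_eq {v w : Plane} (h : ‖v‖ = ‖w‖) :
    ∃ T : Plane ≃ₗᵢ[ℝ] Plane, T v = w :=
  ⟨_, Submodule.reflection_sub h⟩

/-- A convex set contains the homothetic images of its inner balls. -/
lemma closedBall_homothety_subset {Ω : Set Plane} (hconv : Convex ℝ Ω) {o : Plane} {ρ : ℝ}
    (hball : closedBall o ρ ⊆ Ω) {x : Plane} (hx : x ∈ Ω) {τ : ℝ} (hτ : 0 ≤ τ) (hτ1 : τ ≤ 1) :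
    closedBall (x + τ • (o - x)) (τ * ρ) ⊆ Ω := by
  intro z hz
  rcases hτ.eq_or_lt with rfl | hpos
  · simp at hz
    rwa [hz]
  have hw : o + τ⁻¹ • (z - (x + τ • (o - x))) ∈ Ω := by
    apply hball
    rw [mem_closedBall, dist_eq_norm, add_sub_cancel_left, norm_smul, norm_inv,
      Real.norm_of_nonneg hτ]
    rw [mem_closedBall, dist_eq_norm] at hz
    rwa [inv_mul_le_iff₀ hpos]
  have := hconv hx hw (sub_nonneg.2 hτ1) hτ (by ring)
  convert this using 1
  rw [smul_add, smul_smul, mul_inv_cancel₀ hpos.ne', sub_smul, one_smul, smul_sub]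
  module

/-- A convex body occupies a definite proportion of every small ball centred in it. -/
lemma area_closedBall_inter_ge {Ω : Set Plane} (hconv : Convex ℝ Ω) {o : Plane} {ρ R : ℝ}
    (hρ : 0 < ρ) (hρR : ρ ≤ R) (hball : closedBall o ρ ⊆ Ω) (hR : Ω ⊆ closedBall o R)
    {x : Plane} (hx : x ∈ Ω) {ℓ : ℝ} (hℓ : 0 ≤ ℓ) (hℓR : ℓ ≤ 2 * R) :
    π * (ρ / (2 * R)) ^ 2 * ℓ ^ 2 ≤ volume.real (Ω ∩ closedBall x ℓ) := by
  have hRpos : 0 < R := hρ.trans_le hρR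
  have hτ : 0 ≤ ℓ / (2 * R) := by positivity
  have hsub : closedBall (x + (ℓ / (2 * R)) • (o - x)) (ℓ / (2 * R) * ρ) ⊆ Ω ∩ closedBall x ℓ := by
    refine Set.subset_inter (closedBall_homothety_subset hconv hball hx hτ
      ((div_le_one (by positivity)).2 hℓR)) (closedBall_subset_closedBall' ?_)
    rw [dist_eq_norm, add_sub_cancel_left, norm_smul, Real.norm_of_nonneg hτ]
    have h1 : ‖o - x‖ ≤ R := by
      have := hR hx
      rwa [mem_closedBall, dist_comm, dist_eq_norm] at this
    calc ℓ / (2 * R) * ρ + ℓ / (2 * R) * ‖o - x‖ ≤ ℓ / (2 * R) * R + ℓ / (2 * R) * R := by gcongr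
      _ = ℓ := by field_simp; ring
  have := measureReal_mono (μ := volume) hsub
    (measure_ne_top_of_subset Set.inter_subset_right (measure_closedBall_lt_top).ne)
  rw [volume_real_closedBall _ (by positivity)] at this
  refine le_trans (le_of_eq ?_) this
  ring

/-- The part of a convex body within distance `a` of its complement has area of order `a`. -/
lemma area_layer_le {Ω : Set Plane} (hconv : Convex ℝ Ω) (hmeas : MeasurableSet Ω)
    {o : Plane} {ρ : ℝ} (hρ : 0 < ρ) (hball : closedBall o ρ ⊆ Ω)
    (hvol : volume Ω = 1) {a : ℝ} (ha : 0 ≤ a) (haρ : a ≤ ρ) :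
    volume {x ∈ Ω | ¬ closedBall x a ⊆ Ω} ≤ ENNReal.ofReal (2 * a / ρ) := by
  have hτ : 0 ≤ a / ρ := by positivity
  have hτ1 : a / ρ ≤ 1 := (div_le_one hρ).2 haρ
  set S := AffineMap.homothety o (1 - a / ρ) '' Ω with hS
  have hSapp : ∀ z, AffineMap.homothety o (1 - a / ρ) z = z + (a / ρ) • (o - z) := by
    intro z
    simp only [AffineMap.homothety_apply, vsub_eq_sub, vadd_eq_add]
    module
  have hSsub : ∀ x ∈ S, closedBall x a ⊆ Ω := by
    rintro _ ⟨z, hz, rfl⟩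
    have := closedBall_homothety_subset hconv hball hz hτ hτ1
    rwa [div_mul_cancel₀ _ hρ.ne', ← hSapp] at this
  have hSΩ : S ⊆ Ω := fun x hx ↦ hSsub x hx (mem_closedBall_self ha)
  have hSvol : volume S = ENNReal.ofReal ((1 - a / ρ) ^ 2) := by
    rw [hS, Measure.addHaar_image_homothety, hvol, mul_one, finrank_euclideanSpace_fin,
      abs_of_nonneg (sq_nonneg _)]
  have hsub : {x ∈ Ω | ¬ closedBall x a ⊆ Ω} ⊆ Ω \ S := fun x hx ↦ ⟨hx.1, fun h ↦ hx.2 (hSsub x h)⟩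
  have hadd : volume Ω ≤ volume (Ω ∩ S) + volume (Ω \ S) := measure_le_inter_add_sdiff _ _ _
  refine (measure_mono hsub).trans ?_
  have hnull : NullMeasurableSet S volume := by
    rcases hτ1.eq_or_lt with h1 | h1
    · have : volume S = 0 := by rw [hSvol, h1]; simp
      exact NullMeasurableSet.of_null this
    · have : S = (fun z ↦ (1 - a / ρ)⁻¹ • (z - o) + o) ⁻¹' Ω := by
        ext z
        have hne : (1 - a / ρ) ≠ 0 := (sub_pos.2 h1).ne'
        constructor
        · rintro ⟨y, hy, rfl⟩
          simp only [Set.mem_preimage, AffineMap.homothety_apply, vsub_eq_sub, vadd_eq_add,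
            add_sub_cancel_right, smul_smul, inv_mul_cancel₀ hne, one_smul, sub_add_cancel]
          exact hy
        · intro hz
          refine ⟨_, hz, ?_⟩
          simp [AffineMap.homothety_apply, smul_smul, mul_inv_cancel₀ hne]
      rw [this]
      exact (hmeas.preimage (by fun_prop)).nullMeasurableSet
  rw [measure_sdiff hSΩ hnull (by rw [hSvol]; exact ENNReal.ofReal_ne_top), hvol, hSvol,
    ← ENNReal.ofReal_one, ← ENNReal.ofReal_sub _ (sq_nonneg _)]
  apply ENNReal.ofReal_le_ofReal
  have : 2 * a / ρ = 2 * (a / ρ) := by ring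
  rw [this]
  nlinarith [sq_nonneg (a / ρ)]

/-- The region which contains no vertex when `x` and `y` are two vertices at maximal distance in a
component of the geometric graph of radius `r`. -/
def emptyZone (r : ℝ) (x y : Plane) : Set Plane :=
  {z | (dist z x ≤ r ∧ dist x y < dist z y) ∨ (dist z y ≤ r ∧ dist x y < dist z x)}

lemma volume_inter_ne_top {Ω : Set Plane} (hvol : volume Ω = 1) (Z : Set Plane) :
    volume (Ω ∩ Z) ≠ ∞ :=
  measure_ne_top_of_subset Set.inter_subset_left (by simp [hvol])

lemma measurableSet_emptyZone (r : ℝ) (x y : Plane) : MeasurableSet (emptyZone r x y) := by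
  have h : ∀ w : Plane, Measurable fun z : Plane ↦ dist z w := fun w ↦ by fun_prop
  exact ((measurableSet_le (h x) measurable_const).inter
    (measurableSet_lt measurable_const (h y))).union
    ((measurableSet_le (h y) measurable_const).inter (measurableSet_lt measurable_const (h x)))

lemma emptyZone_comm (r : ℝ) (x y : Plane) : emptyZone r x y = emptyZone r y x := by
  ext z
  simp only [emptyZone, Set.mem_ofPred_eq, dist_comm x y]
  exact or_comm

/-- The empty zone of two points of a convex body meets it in a definite area. -/
lemma area_emptyZone_inter_ge {Ω : Set Plane} (hconv : Convex ℝ Ω) {o : Plane} {ρ R : ℝ}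
    (hρ : 0 < ρ) (hρR : ρ ≤ R) (hball : closedBall o ρ ⊆ Ω) (hR : Ω ⊆ closedBall o R)
    (hvol : volume Ω = 1)
    {x y : Plane} (hx : x ∈ Ω) (hy : y ∈ Ω) {r : ℝ} (hr : 0 < r) (hrR : r ≤ R)
    (hxy : dist x y ≤ ρ / 4) :
    π * (ρ / (8 * R)) ^ 2 * r ^ 2 ≤ volume.real (Ω ∩ emptyZone r x y) := by
  obtain ⟨ω, hω1, hω⟩ : ∃ ω : Plane, ‖ω‖ = 1 ∧ x - y = dist x y • ω := by
    by_cases h : x = y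
    · exact ⟨EuclideanSpace.single 0 1, by simp, by simp [h]⟩
    · refine ⟨(dist x y)⁻¹ • (x - y), ?_, ?_⟩
      · rw [norm_smul, dist_eq_norm, norm_inv, norm_norm, inv_mul_cancel₀]
        exact norm_ne_zero_iff.2 (sub_ne_zero.2 h)
      · rw [smul_smul, mul_inv_cancel₀ (dist_ne_zero.2 h), one_smul]
  wlog hsign : 0 ≤ inner ℝ ω ((o - x) + (o - y)) generalizing x y ω with H
  · rw [emptyZone_comm]
    refine H (x := y) (y := x) hy hx (by rwa [dist_comm]) (-ω) (by simpa using hω1) ?_ ?_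
    · rw [dist_comm, smul_neg, ← hω, neg_sub]
    · rw [inner_neg_left, add_comm]; linarith
  have hRpos : 0 < R := hρ.trans_le hρR
  set s := dist x y with hs
  have hs0 : 0 ≤ s := dist_nonneg
  set τ := r / (2 * R) with hτdef
  have hτ : 0 < τ := by positivity
  have hτ1 : τ ≤ 1 := (div_le_one (by positivity)).2 (by linarith)
  have hball' : closedBall (o + (ρ / 2) • ω) (ρ / 4) ⊆ Ω := by
    refine (closedBall_subset_closedBall' ?_).trans hball
    rw [dist_eq_norm, add_sub_cancel_left, norm_smul, hω1, Real.norm_of_nonneg (by positivity)]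
    linarith
  have hsubΩ := closedBall_homothety_subset hconv hball' hx hτ.le hτ1
  have hsub : closedBall (x + τ • (o + (ρ / 2) • ω - x)) (τ * (ρ / 4)) ⊆
      Ω ∩ emptyZone r x y := by
    refine Set.subset_inter hsubΩ fun z hz ↦ Or.inl ?_
    rw [mem_closedBall, dist_eq_norm] at hz
    set q := z - (x + τ • (o + (ρ / 2) • ω - x)) with hq
    have hzx : z - x = q + τ • (o - x) + (τ * (ρ / 2)) • ω := by
      rw [hq, smul_sub τ (o + _) x, smul_add, smul_smul, smul_sub]; abel
    have hox : ‖o - x‖ ≤ R := by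
      have := hR hx
      rwa [mem_closedBall, dist_comm, dist_eq_norm] at this
    constructor
    · rw [dist_eq_norm, hzx]
      calc ‖q + τ • (o - x) + (τ * (ρ / 2)) • ω‖ ≤ ‖q‖ + ‖τ • (o - x)‖ + ‖(τ * (ρ / 2)) • ω‖ :=
            norm_add₃_le
        _ ≤ τ * (ρ / 4) + τ * R + τ * (ρ / 2) := by
            rw [norm_smul, norm_smul, hω1, Real.norm_of_nonneg hτ.le,
              Real.norm_of_nonneg (by positivity), mul_one]
            gcongr
        _ ≤ τ * (2 * R) := by nlinarith
        _ = r := by rw [hτdef]; field_simp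
    · have hinner : 0 < inner ℝ ω (z - x) := by
        have h1 : inner ℝ ω (o - x) ≥ - s / 2 := by
          have h2 : o - y = (o - x) + s • ω := by rw [← hω]; abel
          rw [h2, inner_add_right, inner_add_right, inner_smul_right, real_inner_self_eq_norm_sq,
            hω1] at hsign
          nlinarith
        have h3 : -(τ * (ρ / 4)) ≤ inner ℝ ω q := by
          have := abs_le.1 (abs_real_inner_le_norm ω q)
          rw [hω1, one_mul] at this
          linarith
        rw [hzx, inner_add_right, inner_add_right, inner_smul_right, inner_smul_right,
          real_inner_self_eq_norm_sq, hω1]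
        nlinarith
      have hne : 0 < ‖z - x‖ := by
        rw [norm_pos_iff]; rintro h; simp [h] at hinner
      have : s ^ 2 < dist z y ^ 2 := by
        have h4 : z - y = (z - x) + s • ω := by rw [← hω]; abel
        rw [dist_eq_norm, h4, norm_add_sq_real, norm_smul, hω1, inner_smul_right,
          real_inner_comm, Real.norm_of_nonneg hs0]
        nlinarith [mul_nonneg hs0 hinner.le]
      exact lt_of_pow_lt_pow_left₀ 2 dist_nonneg this
  have := measureReal_mono (μ := volume) hsub (volume_inter_ne_top hvol _)
  rw [volume_real_closedBall _ (by positivity)] at this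
  refine le_trans (le_of_eq ?_) this
  rw [hτdef]
  field_simp
  norm_num

/-- If of any two points of `S ∪ S'` symmetric about `m` at least one is in `Ω`, then `Ω`
contains at least half of the area of `S ∪ S'`, where `S'` is the reflection of `S`. -/
lemma area_inter_ge_of_antipodal {Ω S Z G : Set Plane} (hΩ : MeasurableSet Ω)
    (hvol : volume Ω = 1) (hS : MeasurableSet S) {m : Plane}
    (hSZ : S ⊆ Z) (hSZ' : ∀ z ∈ S, m + m - z ∈ Z) (hdisj : ∀ z ∈ S, m + m - z ∉ S)
    (hgood : ∀ z ∈ S, z ∈ Ω ∨ m + m - z ∈ Ω) (hGS : G ⊆ S)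
    (hGΩ : ∀ z ∈ G, z ∈ Ω ∧ m + m - z ∈ Ω) :
    volume.real S + volume.real G ≤ volume.real (Ω ∩ Z) := by
  have hpres : MeasurePreserving (fun z : Plane ↦ m + m - z) volume volume :=
    Measure.measurePreserving_sub_left volume (m + m)
  have hinv : ∀ z : Plane, m + m - (m + m - z) = z := fun z ↦ by abel
  set S' := (fun z : Plane ↦ m + m - z) ⁻¹' S with hS'
  have hS'm : MeasurableSet S' := hpres.measurable hS
  have h1 : volume (S' ∩ Ω) = volume (S ∩ (fun z : Plane ↦ m + m - z) ⁻¹' Ω) := by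
    rw [← hpres.measure_preimage (hS'm.inter hΩ).nullMeasurableSet]
    congr 1
    ext z
    simp [hS']
  have h2 : volume S + volume G ≤ volume (S ∩ Ω) + volume (S' ∩ Ω) := by
    rw [h1, ← measure_union_add_inter _ (hS.inter (hpres.measurable hΩ))]
    gcongr
    · intro z hz
      rcases hgood z hz with h | h
      exacts [Or.inl ⟨hz, h⟩, Or.inr ⟨hz, h⟩]
    · exact fun z hz ↦ ⟨⟨hGS hz, (hGΩ z hz).1⟩, hGS hz, (hGΩ z hz).2⟩
  have h3 : volume (S ∩ Ω) + volume (S' ∩ Ω) ≤ volume (Ω ∩ Z) := by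
    rw [← measure_union _ (hS'm.inter hΩ)]
    · apply measure_mono
      rintro z (hz | hz)
      · exact ⟨hz.2, hSZ hz.1⟩
      · refine ⟨hz.2, ?_⟩
        have := hSZ' _ hz.1
        rwa [hinv] at this
    · rw [Set.disjoint_left]
      exact fun z hz hz' ↦ hdisj z hz.1 hz'.1
  have h4 := h2.trans h3
  have hfin := volume_inter_ne_top hvol Z
  have hSfin : volume S ≠ ∞ := (le_self_add.trans h4).trans_lt hfin.lt_top |>.ne
  have hGfin : volume G ≠ ∞ := (le_add_self.trans h4).trans_lt hfin.lt_top |>.ne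
  rw [Measure.real, Measure.real, ← ENNReal.toReal_add hSfin hGfin]
  exact ENNReal.toReal_mono hfin h4

/-- Without a convex set, the area of the symmetric set is counted fully. -/
lemma area_ge_two_mul_of_antipodal {S Z : Set Plane} (hfin : volume Z ≠ ∞) (hS : MeasurableSet S)
    {m : Plane}
    (hSZ : S ⊆ Z) (hSZ' : ∀ z ∈ S, m + m - z ∈ Z) (hdisj : ∀ z ∈ S, m + m - z ∉ S) :
    2 * volume.real S ≤ volume.real Z := by
  have hpres : MeasurePreserving (fun z : Plane ↦ m + m - z) volume volume :=
    Measure.measurePreserving_sub_left volume (m + m)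
  have h3 : volume S + volume ((fun z : Plane ↦ m + m - z) ⁻¹' S) ≤ volume Z := by
    rw [← measure_union _ (hpres.measurable hS)]
    · apply measure_mono
      rintro z (hz | hz)
      · exact hSZ hz
      · simpa using hSZ' _ hz
    · rw [Set.disjoint_left]
      exact fun z hz hz' ↦ hdisj z hz hz'
  rw [hpres.measure_preimage hS.nullMeasurableSet, ← two_mul] at h3
  have := ENNReal.toReal_mono hfin h3
  simpa [Measure.real] using this

/-- The points of a bounded region to the left of the vertical axis. -/
def halfDisc (r : ℝ) : Set Plane := {p | p 0 < 0 ∧ ‖p‖ ≤ r}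

lemma measurable_coord (i : Fin 2) : Measurable fun p : Plane ↦ p i := by fun_prop

lemma measurableSet_halfDisc (r : ℝ) : MeasurableSet (halfDisc r) :=
  (measurableSet_lt (measurable_coord 0) measurable_const).inter
    (measurableSet_le measurable_norm measurable_const)

lemma volume_vertical_axis : volume {p : Plane | p 0 = 0} = 0 := by
  have h : {p : Plane | p 0 = 0} = coords ⁻¹' ({0} ×ˢ Set.univ) := by
    ext p; simp [coords_apply]
  rw [h, measurePreserving_coords.measure_preimage
    ((measurableSet_singleton _).prod MeasurableSet.univ).nullMeasurableSet]
  rw [Measure.volume_eq_prod, Measure.prod_prod]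
  simp

lemma halfDisc_subset (r : ℝ) : halfDisc r ⊆ closedBall 0 r := fun p hp ↦ by
  simpa using hp.2

lemma area_halfDisc {r : ℝ} (hr : 0 ≤ r) : volume.real (halfDisc r) = π * r ^ 2 / 2 := by
  have hneg : volume.real {p : Plane | 0 < p 0 ∧ ‖p‖ ≤ r} = volume.real (halfDisc r) := by
    rw [Measure.real, Measure.real,
      ← (Measure.measurePreserving_neg (volume : Measure Plane)).measure_preimage
        (measurableSet_halfDisc r).nullMeasurableSet]
    congr 2
    ext p
    simp [halfDisc]
  have hball : closedBall (0 : Plane) r =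
      (halfDisc r ∪ {p : Plane | 0 < p 0 ∧ ‖p‖ ≤ r}) ∪ {p : Plane | p 0 = 0 ∧ ‖p‖ ≤ r} := by
    ext p
    simp only [mem_closedBall_zero_iff, halfDisc, Set.mem_union, Set.mem_ofPred_eq]
    rcases lt_trichotomy (p 0) 0 with h | h | h
    · simp [h, h.not_gt, h.ne]
    · simp [h]
    · simp [h, h.not_gt, h.ne']
  have hnull : volume {p : Plane | p 0 = 0 ∧ ‖p‖ ≤ r} = 0 :=
    measure_mono_null (fun p hp ↦ hp.1) volume_vertical_axis
  have h1 := volume_real_closedBall (0 : Plane) hr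
  have hm : MeasurableSet {p : Plane | 0 < p 0 ∧ ‖p‖ ≤ r} :=
    (measurableSet_lt measurable_const (measurable_coord 0)).inter
      (measurableSet_le measurable_norm measurable_const)
  have hfin : volume (halfDisc r) ≠ ∞ := measure_ne_top_of_subset (halfDisc_subset r)
    measure_closedBall_lt_top.ne
  have hfin' : volume {p : Plane | 0 < p 0 ∧ ‖p‖ ≤ r} ≠ ∞ :=
    measure_ne_top_of_subset (fun p hp ↦ by simpa using hp.2)
      (measure_closedBall_lt_top (x := (0 : Plane)) (r := r)).ne
  have hdisj : Disjoint (halfDisc r) {p : Plane | 0 < p 0 ∧ ‖p‖ ≤ r} := by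
    rw [Set.disjoint_left]
    exact fun p hp hp' ↦ lt_asymm hp.1 hp'.1
  rw [hball, Measure.real, measure_congr (union_ae_eq_left_of_ae_eq_empty
    (ae_eq_empty.2 hnull)), ← Measure.real, measureReal_union hdisj hm hfin hfin', hneg] at h1
  linarith

lemma area_box (a b c d : ℝ) (hab : a ≤ b) (hcd : c ≤ d) :
    volume.real {p : Plane | p 0 ∈ Set.Ioo a b ∧ p 1 ∈ Set.Ioo c d} = (b - a) * (d - c) := by
  have h : {p : Plane | p 0 ∈ Set.Ioo a b ∧ p 1 ∈ Set.Ioo c d} =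
      coords ⁻¹' (Set.Ioo a b ×ˢ Set.Ioo c d) := by
    ext p; simp [coords_apply]
  rw [h, Measure.real, measurePreserving_coords.measure_preimage
    (measurableSet_Ioo.prod measurableSet_Ioo).nullMeasurableSet,
    Measure.volume_eq_prod, Measure.prod_prod]
  simp [sub_nonneg.2 hab, sub_nonneg.2 hcd]

lemma measurableSet_box (a b c d : ℝ) :
    MeasurableSet {p : Plane | p 0 ∈ Set.Ioo a b ∧ p 1 ∈ Set.Ioo c d} :=
  (measurable_coord 0 measurableSet_Ioo).inter (measurable_coord 1 measurableSet_Ioo)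

/-- A piece of the empty zone of two points which, with its reflection in their midpoint, has area
exceeding that of the disc. -/
lemma exists_half_emptyZone {K r : ℝ} (hK : 1 ≤ K) (hr : 0 < r) {x y : Plane}
    (hxy : dist x y ≤ K * r) :
    ∃ S : Set Plane, MeasurableSet S ∧
      volume.real S = π * r ^ 2 / 2 + r * dist x y / (32 * K ^ 2) ∧
      S ⊆ emptyZone r x y ∩ closedBall x r ∧ (∀ z ∈ S, x + y - z ∈ emptyZone r x y) ∧
      ∀ z ∈ S, x + y - z ∉ S := by
  set s := dist x y with hs
  have hs0 : 0 ≤ s := dist_nonneg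
  have hK0 : 0 < K := by linarith
  obtain ⟨T, hT⟩ : ∃ T : Plane ≃ₗᵢ[ℝ] Plane, T (s • EuclideanSpace.single 0 1) = y - x := by
    apply exists_linearIsometryEquiv_map_eq
    rw [norm_smul, Real.norm_of_nonneg hs0, hs, dist_comm, dist_eq_norm]
    simp
  set e : Plane := s • EuclideanSpace.single 0 1 with he
  have he0 : e 0 = s := by simp [he]
  have he1 : e 1 = 0 := by simp [he]
  set f : Plane → Plane := fun z ↦ T.symm (z - x) with hf
  have hpres : MeasurePreserving f volume volume :=
    (T.symm.measurePreserving).comp (measurePreserving_sub_right volume x)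
  have hfx : ∀ z, dist z x = ‖f z‖ := fun z ↦ by
    change dist z x = ‖T.symm (z - x)‖
    rw [T.symm.norm_map, dist_eq_norm]
  have hfy : ∀ z, dist z y = ‖f z - e‖ := fun z ↦ by
    have : f z - e = T.symm (z - y) := by
      rw [← T.symm_apply_apply e, hT, hf, ← map_sub]; congr 1; abel
    rw [this, T.symm.norm_map, dist_eq_norm]
  have hfr : ∀ z, f (x + y - z) = e - f z := fun z ↦ by
    change T.symm (x + y - z - x) = e - T.symm (z - x)
    rw [← T.symm_apply_apply e, hT, ← map_sub]; congr 1; abel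
  set δ := s / (8 * K ^ 2) with hδ
  have hδ0 : 0 ≤ δ := by positivity
  have hδs : δ ≤ s / 8 := by
    rw [hδ]
    apply div_le_div_of_nonneg_left hs0 (by norm_num)
    nlinarith
  have hδr : δ ≤ r / 8 := by
    rw [hδ, div_le_iff₀ (by positivity)]
    nlinarith [mul_le_mul_of_nonneg_right hK (mul_pos hK0 hr).le]
  have hδr2 : δ * (2 * s) ≤ r ^ 2 / 4 := by
    rw [hδ, div_mul_eq_mul_div, div_le_iff₀ (by positivity)]
    nlinarith [mul_self_le_mul_self hs0 hxy]
  set D : Set Plane := halfDisc r ∪ {p | p 0 ∈ Set.Ioo 0 δ ∧ p 1 ∈ Set.Ioo (r / 2) (3 * r / 4)}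
    with hD
  have hDm : MeasurableSet D := (measurableSet_halfDisc r).union (measurableSet_box _ _ _ _)
  have hDr : ∀ p ∈ D, ‖p‖ ≤ r := by
    rintro p (hp | ⟨⟨h1, h2⟩, h3, h4⟩)
    · exact hp.2
    · apply (sq_le_sq₀ (norm_nonneg _) hr.le).1
      rw [norm_sq_eq]
      nlinarith
  have hDs : ∀ p ∈ D, s < ‖p - e‖ := by
    intro p hp
    apply lt_of_pow_lt_pow_left₀ 2 (norm_nonneg _)
    rw [norm_sq_eq, PiLp.sub_apply, PiLp.sub_apply, he0, he1]
    rcases hp with hp | ⟨⟨h1, h2⟩, h3, h4⟩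
    · have := hp.1
      nlinarith [sq_nonneg (p 1), mul_nonneg hs0 (neg_pos.2 this).le, sq_pos_of_neg this]
    · have h5 : p 0 * (2 * s) ≤ δ * (2 * s) := by gcongr
      nlinarith
  have hD0 : ∀ p ∈ D, p 0 < 0 ∨ (0 < p 0 ∧ p 0 < s / 2) := by
    rintro p (hp | ⟨⟨h1, h2⟩, h3, h4⟩)
    · exact Or.inl hp.1
    · exact Or.inr ⟨h1, by linarith⟩
  have hfinD : volume {p : Plane | p 0 ∈ Set.Ioo 0 δ ∧ p 1 ∈ Set.Ioo (r / 2) (3 * r / 4)} ≠ ∞ := by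
    have hfin : volume (closedBall (0 : Plane) r) ≠ ∞ := measure_closedBall_lt_top.ne
    refine measure_ne_top_of_subset (fun p hp ↦ ?_) hfin
    simpa using hDr p (Or.inr hp)
  have hdisjD : Disjoint (halfDisc r)
      {p : Plane | p 0 ∈ Set.Ioo 0 δ ∧ p 1 ∈ Set.Ioo (r / 2) (3 * r / 4)} := by
    rw [Set.disjoint_left]
    exact fun p hp hp' ↦ lt_asymm hp.1 hp'.1.1
  refine ⟨f ⁻¹' D, hpres.measurable hDm, ?_, ?_, ?_, ?_⟩
  · rw [Measure.real, hpres.measure_preimage hDm.nullMeasurableSet, ← Measure.real, hD,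
      measureReal_union hdisjD (measurableSet_box _ _ _ _)
        (measure_ne_top_of_subset (halfDisc_subset r) measure_closedBall_lt_top.ne) hfinD,
      area_halfDisc hr.le, area_box _ _ _ _ hδ0 (by linarith), hδ]
    field_simp
    ring
  · intro z hz
    refine ⟨Or.inl ⟨?_, ?_⟩, ?_⟩
    · rw [hfx z]; exact hDr _ hz
    · rw [hfy z]; exact hDs _ hz
    · rw [mem_closedBall, hfx z]; exact hDr _ hz
  · intro z hz
    refine Or.inr ⟨?_, ?_⟩
    · rw [hfy (x + y - z), hfr, sub_sub_cancel_left, norm_neg]; exact hDr _ hz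
    · rw [hfx (x + y - z), hfr, norm_sub_rev]; exact hDs _ hz
  · intro z hz hz'
    rw [Set.mem_preimage, hfr] at hz'
    have h1 := hD0 _ hz
    have h2 := hD0 _ hz'
    rw [PiLp.sub_apply, he0] at h2
    rcases h1 with h1 | h1 <;> rcases h2 with h2 | h2 <;> linarith

/-- The points of `Ω` having some pair of antipodal directions in which `Ω` is short. -/
def pinched (Ω : Set Plane) (a : ℝ) : Set Plane :=
  {m ∈ Ω | ∃ v : Plane, ‖v‖ ≤ a ∧ m + v ∉ Ω ∧ m - v ∉ Ω}

lemma midpoint_sub_norm_le {x y z : Plane} {r : ℝ} (hz : z ∈ closedBall x r) :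
    ‖z - (2⁻¹ : ℝ) • (x + y)‖ ≤ r + dist x y := by
  have h : z - (2⁻¹ : ℝ) • (x + y) = (z - x) + (2⁻¹ : ℝ) • (x - y) := by module
  rw [h]
  refine (norm_add_le _ _).trans ?_
  rw [norm_smul, ← dist_eq_norm, ← dist_eq_norm]
  have : (0 : ℝ) ≤ dist x y := dist_nonneg
  have h2 : ‖(2⁻¹ : ℝ)‖ = 2⁻¹ := by norm_num
  rw [h2]
  have := mem_closedBall.1 hz
  linarith

/-- Lower bound for the area of the empty zone of two points with unpinched midpoint. -/
lemma area_emptyZone_inter_ge_of_notMem_pinched {Ω : Set Plane} (hΩ : MeasurableSet Ω)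
    (hvol : volume Ω = 1) {K r : ℝ} (hK : 1 ≤ K) (hr : 0 < r)
    {x y : Plane} (hxy : dist x y ≤ K * r) (hm : (2⁻¹ : ℝ) • (x + y) ∈ Ω)
    (hgood : (2⁻¹ : ℝ) • (x + y) ∉ pinched Ω (2 * K * r)) :
    π * r ^ 2 / 2 + r * dist x y / (32 * K ^ 2) ≤ volume.real (Ω ∩ emptyZone r x y) := by
  obtain ⟨S, hSm, hSv, hSZ, hSZ', hdisj⟩ := exists_half_emptyZone hK hr hxy
  set m := (2⁻¹ : ℝ) • (x + y) with hmdef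
  have hmm : m + m = x + y := by rw [hmdef]; module
  have := area_inter_ge_of_antipodal (Z := emptyZone r x y) (m := m) (G := ∅) hΩ hvol hSm
    (fun z hz ↦ (hSZ hz).1) (by rwa [hmm]) (by rwa [hmm]) (fun z hz ↦ ?_)
    (Set.empty_subset _) (by simp)
  · rw [← hSv]; simpa using this
  · by_contra! hcon
    refine hgood ⟨hm, z - m, ?_, ?_, ?_⟩
    · refine (midpoint_sub_norm_le (hSZ hz).2).trans ?_
      nlinarith
    · simpa using hcon.1
    · convert hcon.2 using 2; abel

/-- Lower bound for the area of an empty zone inside `Ω`. -/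
lemma area_emptyZone_inter_ge_of_closedBall_subset {Ω : Set Plane}
    (hvol : volume Ω = 1) {K r : ℝ} (hK : 1 ≤ K) (hr : 0 < r)
    {x y : Plane} (hxy : dist x y ≤ K * r)
    (hdeep : closedBall ((2⁻¹ : ℝ) • (x + y)) (2 * K * r) ⊆ Ω) :
    π * r ^ 2 + r * dist x y / (16 * K ^ 2) ≤ volume.real (Ω ∩ emptyZone r x y) := by
  obtain ⟨S, hSm, hSv, hSZ, hSZ', hdisj⟩ := exists_half_emptyZone hK hr hxy
  set m := (2⁻¹ : ℝ) • (x + y) with hmdef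
  have hmm : m + m = x + y := by rw [hmdef]; module
  have hnorm : ∀ z ∈ S, ‖z - m‖ ≤ 2 * K * r := fun z hz ↦
    (midpoint_sub_norm_le (hSZ hz).2).trans (by nlinarith)
  have := area_ge_two_mul_of_antipodal (Z := Ω ∩ emptyZone r x y) (m := m)
    (volume_inter_ne_top hvol _) hSm
    (fun z hz ↦ ⟨hdeep (by simpa [dist_eq_norm] using hnorm z hz), (hSZ hz).1⟩)
    (fun z hz ↦ ⟨hdeep ?_, by rw [hmm]; exact hSZ' z hz⟩) (by rwa [hmm])
  · refine le_trans (le_of_eq ?_) this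
    rw [hSv]; ring
  · have h : m + m - z - m = -(z - m) := by abel
    rw [mem_closedBall, dist_eq_norm, h, norm_neg]
    exact hnorm z hz

/-- A convex body of unit area between two discs centred at `o`, with its gauge `g` based at `o`. -/
structure IsBody (Ω : Set Plane) (o : Plane) (ρ R : ℝ) (g : Plane → ℝ) : Prop where
  convex : Convex ℝ Ω
  isCompact : IsCompact Ω
  volume_eq : volume Ω = 1
  pos : 0 < ρ
  le : ρ ≤ R
  closedBall_subset : closedBall o ρ ⊆ Ω
  subset_closedBall : Ω ⊆ closedBall o R
  mem_iff : ∀ x, x ∈ Ω ↔ g x ≤ 1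
  nonneg : ∀ x, 0 ≤ g x
  abs_sub_le : ∀ x y, |g x - g y| ≤ dist x y / ρ
  convexOn : ConvexOn ℝ Set.univ g
  homothety : ∀ t x, 0 ≤ t → g (o + t • (x - o)) = t * g x

lemma exists_isBody {Ω : Set Plane} (hconv : Convex ℝ Ω) (hcomp : IsCompact Ω)
    (hint : (interior Ω).Nonempty) (hvol : volume Ω = 1) :
    ∃ o ρ R g, IsBody Ω o ρ R g := by
  obtain ⟨o, ho⟩ := hint
  obtain ⟨ε, hε, hεΩ⟩ := Metric.isOpen_iff.1 isOpen_interior o ho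
  have hball : closedBall o (ε / 2) ⊆ Ω :=
    ((closedBall_subset_ball (by linarith)).trans hεΩ).trans interior_subset
  obtain ⟨R, hR⟩ := hcomp.isBounded.subset_closedBall o
  have hρ : 0 < ε / 2 := by positivity
  set S : Set Plane := (fun y ↦ o + y) ⁻¹' Ω with hS
  have hSconv : Convex ℝ S := hconv.translate_preimage_right o
  have hSball : closedBall (0 : Plane) (ε / 2) ⊆ S := fun y hy ↦ hball (by
    simpa [dist_eq_norm] using hy)
  have hSnhds : S ∈ 𝓝 (0 : Plane) := mem_of_superset (closedBall_mem_nhds 0 hρ) hSball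
  have hSclosed : IsClosed S := hcomp.isClosed.preimage (by fun_prop)
  have habs : Absorbent ℝ S := absorbent_nhds_zero hSnhds
  have hle : ∀ u : Plane, gauge S u ≤ ‖u‖ / (ε / 2) := fun u ↦ by
    refine (gauge_mono ?_ (ball_subset_closedBall.trans hSball) u).trans_eq (gauge_ball hρ.le u)
    exact absorbent_ball_zero hρ
  have hadd := gauge_add_le hSconv habs
  refine ⟨o, ε / 2, max R (ε / 2), fun x ↦ gauge S (x - o), hconv, hcomp, hvol, hρ,
    le_max_right _ _, hball, hR.trans (closedBall_subset_closedBall (le_max_left _ _)),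
    fun x ↦ ?_, fun x ↦ gauge_nonneg _, fun x y ↦ ?_, ⟨convex_univ, ?_⟩, fun t x ht ↦ ?_⟩
  · rw [gauge_le_one_iff_mem_closure hSconv hSnhds, hSclosed.closure_eq, hS]
    simp
  · have h1 := hadd (x - y) (y - o)
    have h2 := hadd (y - x) (x - o)
    have h3 := hle (x - y)
    have h4 := hle (y - x)
    rw [sub_add_sub_cancel] at h1 h2
    rw [← dist_eq_norm] at h3 h4
    rw [dist_comm y x] at h4
    rw [abs_le]
    constructor <;> linarith
  · intro x _ y _ a b ha hb hab
    have h : a • x + b • y - o = a • (x - o) + b • (y - o) := by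
      have : o = (a + b) • o := by rw [hab, one_smul]
      nth_rewrite 1 [this]
      module
    simp only [h]
    refine (hadd _ _).trans_eq ?_
    rw [gauge_smul_of_nonneg ha, gauge_smul_of_nonneg hb]
  · simp only [add_sub_cancel_left]
    rw [gauge_smul_of_nonneg ht, smul_eq_mul]

/-- The second difference of `g` at `x` in the direction `w`. -/
def secondDiff (g : Plane → ℝ) (w x : Plane) : ℝ := g (x + w) + g (x - w) - 2 * g x

/-- The sum of the second differences along the axes. -/
noncomputable def axisDiff (g : Plane → ℝ) (a : ℝ) (x : Plane) : ℝ :=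
  secondDiff g (EuclideanSpace.single 0 a) x + secondDiff g (EuclideanSpace.single 1 a) x

/-- The points of `Ω` near which the boundary is strongly curved at scale `a`. -/
def curved (Ω : Set Plane) (g : Plane → ℝ) (a : ℝ) : Set Plane :=
  {x ∈ Ω | 1 - g x < axisDiff g (2 * a) x}

section SecondDiff

variable {g : Plane → ℝ}

lemma secondDiff_neg (w x : Plane) : secondDiff g (-w) x = secondDiff g w x := by
  simp only [secondDiff, sub_neg_eq_add, ← sub_eq_add_neg]; ring

lemma secondDiff_nonneg (hg : ConvexOn ℝ Set.univ g) (w x : Plane) : 0 ≤ secondDiff g w x := by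
  have := hg.2 (Set.mem_univ (x + w)) (Set.mem_univ (x - w)) 
    (by norm_num : (0 : ℝ) ≤ 2⁻¹) (by norm_num : (0 : ℝ) ≤ 2⁻¹) (by norm_num)
  rw [show (2⁻¹ : ℝ) • (x + w) + (2⁻¹ : ℝ) • (x - w) = x by module, smul_eq_mul, smul_eq_mul]
    at this
  rw [secondDiff]
  linarith

lemma secondDiff_smul_le (hg : ConvexOn ℝ Set.univ g) (w x : Plane) {t : ℝ} (ht : 0 ≤ t)
    (ht1 : t ≤ 1) : secondDiff g (t • w) x ≤ t * secondDiff g w x := by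
  have h1 := hg.2 (Set.mem_univ x) (Set.mem_univ (x + w)) (sub_nonneg.2 ht1) ht (by ring)
  have h2 := hg.2 (Set.mem_univ x) (Set.mem_univ (x - w)) (sub_nonneg.2 ht1) ht (by ring)
  rw [show (1 - t) • x + t • (x + w) = x + t • w by module, smul_eq_mul, smul_eq_mul] at h1
  rw [show (1 - t) • x + t • (x - w) = x - t • w by module, smul_eq_mul, smul_eq_mul] at h2
  rw [secondDiff, secondDiff]
  linarith

lemma secondDiff_smul_le_of_abs_le (hg : ConvexOn ℝ Set.univ g) (w x : Plane) {t : ℝ}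
    (ht1 : |t| ≤ 1) : secondDiff g (t • w) x ≤ secondDiff g w x := by
  have h0 := secondDiff_nonneg hg w x
  rcases le_total 0 t with ht | ht
  · rw [abs_of_nonneg ht] at ht1
    exact (secondDiff_smul_le hg w x ht ht1).trans (by nlinarith)
  · rw [abs_of_nonpos ht] at ht1
    rw [← secondDiff_neg, ← neg_smul]
    exact (secondDiff_smul_le hg w x (neg_nonneg.2 ht) ht1).trans (by nlinarith)

lemma secondDiff_le_axisDiff (hg : ConvexOn ℝ Set.univ g) {v : Plane} {a : ℝ} (hv : ‖v‖ ≤ a)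
    (x : Plane) : secondDiff g v x ≤ axisDiff g (2 * a) x / 2 := by
  rcases (norm_nonneg v).trans hv |>.eq_or_lt with h0 | ha
  · have : v = 0 := by rw [← norm_le_zero_iff, h0]; exact hv
    subst this
    have h1 := secondDiff_nonneg hg (EuclideanSpace.single 0 (2 * a)) x
    have h2 := secondDiff_nonneg hg (EuclideanSpace.single 1 (2 * a)) x
    have : secondDiff g 0 x = 0 := by simp [secondDiff]; ring
    rw [this, axisDiff]
    positivity
  have hcoord : ∀ i, |v i / a| ≤ 1 := fun i ↦ by
    rw [abs_div, abs_of_pos ha, div_le_one ha]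
    exact (PiLp.norm_apply_le v i).trans hv
  have h1 := secondDiff_smul_le_of_abs_le hg (EuclideanSpace.single 0 (2 * a)) x (hcoord 0)
  have h2 := secondDiff_smul_le_of_abs_le hg (EuclideanSpace.single 1 (2 * a)) x (hcoord 1)
  set p := (v 0 / a) • (EuclideanSpace.single 0 (2 * a) : Plane) with hp
  set q := (v 1 / a) • (EuclideanSpace.single 1 (2 * a) : Plane) with hq
  have hpq : p + q = (2 : ℝ) • v := by
    ext i
    fin_cases i <;> simp [hp, hq] <;> field_simp
  have e1 : x + v = (2⁻¹ : ℝ) • (x + p) + (2⁻¹ : ℝ) • (x + q) := by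
    rw [show v = (2⁻¹ : ℝ) • (p + q) by rw [hpq]; module]; module
  have e2 : x - v = (2⁻¹ : ℝ) • (x - p) + (2⁻¹ : ℝ) • (x - q) := by
    rw [show v = (2⁻¹ : ℝ) • (p + q) by rw [hpq]; module]; module
  have h3 := hg.2 (Set.mem_univ (x + p)) (Set.mem_univ (x + q)) 
    (by norm_num : (0 : ℝ) ≤ 2⁻¹) (by norm_num : (0 : ℝ) ≤ 2⁻¹) (by norm_num)
  have h4 := hg.2 (Set.mem_univ (x - p)) (Set.mem_univ (x - q)) 
    (by norm_num : (0 : ℝ) ≤ 2⁻¹) (by norm_num : (0 : ℝ) ≤ 2⁻¹) (by norm_num)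
  rw [← e1, smul_eq_mul, smul_eq_mul] at h3
  rw [← e2, smul_eq_mul, smul_eq_mul] at h4
  rw [axisDiff]
  simp only [secondDiff] at *
  linarith

end SecondDiff

namespace IsBody

variable {Ω : Set Plane} {o : Plane} {ρ R : ℝ} {g : Plane → ℝ} (H : IsBody Ω o ρ R g)
include H

lemma measurableSet : MeasurableSet Ω := H.isCompact.isClosed.measurableSet

lemma continuous : Continuous g := by
  have : LipschitzWith (Real.toNNReal (1 / ρ)) g := LipschitzWith.of_dist_le_mul fun x y ↦ by
    rw [Real.coe_toNNReal _ (by have := H.pos; positivity), Real.dist_eq]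
    exact (H.abs_sub_le x y).trans_eq (by ring)
  exact this.continuous

lemma center_eq_zero : g o = 0 := by
  simpa using H.homothety 0 o le_rfl

lemma secondDiff_homothety {t : ℝ} (ht : 0 ≤ t) (w x : Plane) :
    secondDiff g (t • w) (o + t • (x - o)) = t * secondDiff g w x := by
  rw [secondDiff, secondDiff, H.homothety t x ht,
    show o + t • (x - o) + t • w = o + t • (x + w - o) by module,
    show o + t • (x - o) - t • w = o + t • (x - w - o) by module, H.homothety _ _ ht,
    H.homothety _ _ ht]
  ring

lemma continuous_secondDiff (w : Plane) : Continuous (secondDiff g w) := by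
  have := H.continuous
  unfold secondDiff
  fun_prop

lemma continuous_axisDiff (a : ℝ) : Continuous (axisDiff g a) :=
  (H.continuous_secondDiff _).add (H.continuous_secondDiff _)

lemma axisDiff_nonneg (a : ℝ) (x : Plane) : 0 ≤ axisDiff g a x :=
  add_nonneg (secondDiff_nonneg H.convexOn _ _) (secondDiff_nonneg H.convexOn _ _)

lemma integrableOn_of_continuous {f : Plane → ℝ} (hf : Continuous f) : IntegrableOn f Ω :=
  hf.continuousOn.integrableOn_compact H.isCompact

lemma area_layer_le {a : ℝ} (ha : 0 ≤ a) (haρ : a ≤ ρ) :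
    volume {x ∈ Ω | ¬ closedBall x a ⊆ Ω} ≤ ENNReal.ofReal (2 * a / ρ) :=
  RandomGeometricGraph.area_layer_le H.convex H.measurableSet H.pos H.closedBall_subset
    H.volume_eq ha haρ

lemma volume_sdiff_translate_le {w : Plane} (hw : ‖w‖ ≤ ρ) :
    volume.real (Ω \ (fun m ↦ m + w) ⁻¹' Ω) ≤ 2 * ‖w‖ / ρ := by
  have hρ := H.pos
  refine ENNReal.toReal_le_of_le_ofReal (by positivity) ((measure_mono ?_).trans
    (H.area_layer_le (norm_nonneg w) hw))
  exact fun m hm ↦ ⟨hm.1, fun h ↦ hm.2 (h (by simp))⟩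

lemma setIntegral_secondDiff_le {w : Plane} (hw : ‖w‖ ≤ ρ) :
    ∫ x in Ω, secondDiff g w x ≤ 4 * ‖w‖ ^ 2 / ρ ^ 2 := by
  have hρ := H.pos
  have hg := H.continuous
  set F : Plane → ℝ := fun m ↦ g (m + w) - g m with hF
  have hFc : Continuous F := by fun_prop
  have hFb : ∀ m, ‖F m‖ ≤ ‖w‖ / ρ := fun m ↦ by
    have := H.abs_sub_le (m + w) m
    rwa [dist_self_add_left] at this
  set Ω' := (fun m ↦ m + w) ⁻¹' Ω with hΩ'
  have hΩ'm : MeasurableSet Ω' := H.measurableSet.preimage (by fun_prop)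
  have hpres : MeasurePreserving (fun m : Plane ↦ m + w) volume volume :=
    measurePreserving_add_right volume w
  have hvol' : volume Ω' = 1 := by
    rw [hΩ', hpres.measure_preimage H.measurableSet.nullMeasurableSet, H.volume_eq]
  have hint : IntegrableOn F Ω := H.integrableOn_of_continuous hFc
  have hFi : IntegrableOn F Ω' := by
    refine IntegrableOn.of_bound (by simp [hvol']) hFc.aestronglyMeasurable (‖w‖ / ρ)
      (Eventually.of_forall hFb)
  have h1 : ∫ x in Ω, secondDiff g w x = (∫ x in Ω, F x) - ∫ x in Ω', F x := by
    have : ∫ x in Ω', F x = ∫ x in Ω, (g x - g (x - w)) := by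
      rw [← hpres.setIntegral_preimage_emb (MeasurableEquiv.addRight w).measurableEmbedding
        (fun x ↦ g x - g (x - w))]
      simp [hF, hΩ']
    rw [this, ← integral_sub hint (H.integrableOn_of_continuous (by fun_prop))]
    refine integral_congr_ae (Eventually.of_forall fun x ↦ ?_)
    simp only [secondDiff, hF]
    ring
  have h2 := integral_inter_add_sdiff hΩ'm hint
  have h3 := integral_inter_add_sdiff H.measurableSet hFi
  rw [Set.inter_comm] at h3
  have h4 : ∫ x in Ω \ Ω', F x ≤ ‖w‖ / ρ * (2 * ‖w‖ / ρ) := by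
    refine (le_abs_self _).trans ((norm_setIntegral_le_of_norm_le_const
      ((measure_mono Set.sdiff_subset).trans_lt (by simp [H.volume_eq])) fun x _ ↦ hFb x).trans ?_)
    gcongr
    exact H.volume_sdiff_translate_le hw
  have h5 : -∫ x in Ω' \ Ω, F x ≤ ‖w‖ / ρ * (2 * ‖w‖ / ρ) := by
    refine (neg_le_abs _).trans ((norm_setIntegral_le_of_norm_le_const
      ((measure_mono Set.sdiff_subset).trans_lt (by simp [hvol'])) fun x _ ↦ hFb x).trans ?_)
    gcongr
    have : Ω' \ Ω = (fun m ↦ m + w) ⁻¹' (Ω \ (fun m ↦ m + -w) ⁻¹' Ω) := by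
      ext m; simp [hΩ']
    rw [this, Measure.real, hpres.measure_preimage
      (H.measurableSet.diff (H.measurableSet.preimage (by fun_prop))).nullMeasurableSet]
    simpa [Measure.real] using H.volume_sdiff_translate_le (w := -w) (by simpa using hw)
  rw [h1]
  calc _ ≤ ‖w‖ / ρ * (2 * ‖w‖ / ρ) + ‖w‖ / ρ * (2 * ‖w‖ / ρ) := by linarith
    _ = _ := by field_simp; ring

lemma setIntegral_axisDiff_le {a : ℝ} (ha : 0 ≤ a) (haρ : a ≤ ρ) :
    ∫ x in Ω, axisDiff g a x ≤ 8 * a ^ 2 / ρ ^ 2 := by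
  have hn : ∀ i, ‖(EuclideanSpace.single i a : Plane)‖ = a := fun i ↦ by simp [abs_of_nonneg ha]
  have h1 := H.setIntegral_secondDiff_le (w := EuclideanSpace.single 0 a) (by rwa [hn])
  have h2 := H.setIntegral_secondDiff_le (w := EuclideanSpace.single 1 a) (by rwa [hn])
  rw [hn] at h1 h2
  unfold axisDiff
  rw [integral_add (H.integrableOn_of_continuous (H.continuous_secondDiff _))
    (H.integrableOn_of_continuous (H.continuous_secondDiff _))]
  calc _ ≤ 4 * a ^ 2 / ρ ^ 2 + 4 * a ^ 2 / ρ ^ 2 := add_le_add h1 h2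
    _ = _ := by ring

lemma measurableSet_curved (a : ℝ) : MeasurableSet (curved Ω g a) :=
  H.measurableSet.inter (measurableSet_lt (by have := H.continuous; fun_prop)
    (H.continuous_axisDiff _).measurable)

lemma axisDiff_homothety_le {t : ℝ} (ht : 1 ≤ t) (a : ℝ) (x : Plane) :
    axisDiff g a (o + t • (x - o)) ≤ t * axisDiff g a x := by
  have ht0 : 0 < t := by linarith
  have key : ∀ i, secondDiff g (EuclideanSpace.single i a) (o + t • (x - o)) ≤
      t * secondDiff g (EuclideanSpace.single i a) x := fun i ↦ by
    have h : (EuclideanSpace.single i a : Plane) = t • (t⁻¹ • EuclideanSpace.single i a) := by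
      rw [smul_smul, mul_inv_cancel₀ ht0.ne', one_smul]
    rw [h, H.secondDiff_homothety ht0.le, ← h]
    gcongr
    apply secondDiff_smul_le_of_abs_le H.convexOn
    rw [abs_of_pos (by positivity)]
    exact inv_le_one_of_one_le₀ ht
  rw [axisDiff, axisDiff, mul_add]
  exact add_le_add (key 0) (key 1)

/-- The strongly curved points have area of order `a ^ 2`. -/
lemma volume_curved_le {a : ℝ} (ha : 0 ≤ a) (haρ : 2 * a ≤ ρ) :
    volume (curved Ω g a) ≤ ENNReal.ofReal (256 * a ^ 2 / ρ ^ 2) := by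
  have hg := H.continuous
  have hρ := H.pos
  set B := curved Ω g a with hB
  have hBm : MeasurableSet B := H.measurableSet_curved a
  set I : Set ℝ := Set.Icc (1 / 2) 1 with hI
  set E : Set (ℝ × Plane) := {p | p.1 ∈ I ∧ o + p.1⁻¹ • (p.2 - o) ∈ B} with hE
  have hEm : MeasurableSet E := by
    refine (measurable_fst measurableSet_Icc).inter (hBm.preimage ?_)
    fun_prop
  have h1 : ∀ t ∈ I, volume B / 4 ≤ volume (Prod.mk t ⁻¹' E) := by
    intro t ht
    have ht0 : 0 < t := by linarith [ht.1]
    have : AffineMap.homothety o t '' B ⊆ Prod.mk t ⁻¹' E := by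
      rintro _ ⟨z, hz, rfl⟩
      refine ⟨ht, ?_⟩
      simp only [AffineMap.homothety_apply, vsub_eq_sub, vadd_eq_add, add_sub_cancel_right,
        smul_smul, inv_mul_cancel₀ ht0.ne', one_smul, add_sub_cancel]
      exact hz
    refine le_trans ?_ (measure_mono this)
    rw [Measure.addHaar_image_homothety, finrank_euclideanSpace_fin, abs_of_nonneg (sq_nonneg _),
      ENNReal.div_eq_inv_mul]
    gcongr
    rw [show (4 : ℝ≥0∞)⁻¹ = ENNReal.ofReal (1 / 4) by
      rw [one_div, ENNReal.ofReal_inv_of_pos (by norm_num)]; norm_num]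
    apply ENNReal.ofReal_le_ofReal
    nlinarith [ht.1]
  have h2 : volume B / 8 ≤ ((volume : Measure ℝ).prod (volume : Measure Plane)) E := by
    rw [Measure.prod_apply hEm]
    calc volume B / 8 = ∫⁻ t in I, volume B / 4 := by
          rw [setLIntegral_const, hI, Real.volume_Icc, ENNReal.div_eq_inv_mul,
            ENNReal.div_eq_inv_mul, mul_right_comm]
          congr 1
          rw [show (1 : ℝ) - 1 / 2 = 2⁻¹ by norm_num, ENNReal.ofReal_inv_of_pos (by norm_num),
            ← ENNReal.mul_inv (by simp) (by simp)]
          norm_num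
      _ ≤ ∫⁻ t in I, volume (Prod.mk t ⁻¹' E) := setLIntegral_mono' measurableSet_Icc h1
      _ ≤ _ := setLIntegral_le_lintegral _ _
  have h3 : ∀ x, volume ((fun t : ℝ ↦ (t, x)) ⁻¹' E) ≤
      Ω.indicator (fun x ↦ ENNReal.ofReal (axisDiff g (2 * a) x)) x := by
    intro x
    have key : ∀ t, (t, x) ∈ E → x ∈ Ω ∧ t ∈ Set.Icc (g x) (g x + axisDiff g (2 * a) x) := by
      rintro t ⟨ht, hx, hlt⟩
      have ht0 : 0 < t := by linarith [ht.1]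
      dsimp only at ht hx hlt
      have e : g (o + t⁻¹ • (x - o)) = t⁻¹ * g x := H.homothety _ _ (by positivity)
      have h5 := H.axisDiff_homothety_le (one_le_inv_iff₀.2 ⟨ht0, ht.2⟩) (2 * a) x
      rw [H.mem_iff, e, inv_mul_le_one₀ ht0] at hx
      rw [e] at hlt
      refine ⟨(H.mem_iff x).2 (hx.trans ht.2), hx, ?_⟩
      have h6 : 1 - t⁻¹ * g x ≤ t⁻¹ * axisDiff g (2 * a) x := hlt.le.trans h5
      have h7 := mul_le_mul_of_nonneg_left h6 ht0.le
      rw [mul_sub, mul_inv_cancel_left₀ ht0.ne', mul_inv_cancel_left₀ ht0.ne'] at h7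
      linarith
    by_cases hx : x ∈ Ω
    · rw [Set.indicator_of_mem hx]
      refine (measure_mono fun t ht ↦ (key t ht).2).trans ?_
      rw [Real.volume_Icc, add_sub_cancel_left]
    · have : (fun t : ℝ ↦ (t, x)) ⁻¹' E = ∅ := by
        ext t
        simp only [Set.mem_preimage, Set.mem_empty_iff_false, iff_false]
        exact fun h ↦ hx (key t h).1
      rw [this, measure_empty]
      exact zero_le
  have h4 : ((volume : Measure ℝ).prod (volume : Measure Plane)) E ≤
      ENNReal.ofReal (8 * (2 * a) ^ 2 / ρ ^ 2) := by
    rw [Measure.prod_apply_symm hEm]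
    refine (lintegral_mono h3).trans ?_
    rw [lintegral_indicator H.measurableSet, ← ofReal_integral_eq_lintegral_ofReal
      (H.integrableOn_of_continuous (H.continuous_axisDiff _))
      (Eventually.of_forall (H.axisDiff_nonneg _))]
    exact ENNReal.ofReal_le_ofReal (H.setIntegral_axisDiff_le (by positivity) haρ)
  have h5 := h2.trans h4
  rw [ENNReal.div_le_iff (by norm_num) (by norm_num)] at h5
  refine h5.trans_eq ?_
  rw [show (8 : ℝ≥0∞) = ENNReal.ofReal 8 by norm_num, ← ENNReal.ofReal_mul (by positivity)]
  congr 1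
  ring

lemma pinched_subset_curved (a : ℝ) : pinched Ω a ⊆ curved Ω g a := by
  rintro m ⟨hm, v, hv, h1, h2⟩
  refine ⟨hm, ?_⟩
  rw [H.mem_iff] at h1 h2
  have := secondDiff_le_axisDiff H.convexOn hv m
  have h0 := H.axisDiff_nonneg (2 * a) m
  rw [H.mem_iff] at hm
  rw [secondDiff] at this
  linarith

end IsBody

/-- A Laplace transform bound from a polynomial bound on the distribution function. -/
lemma lintegral_exp_neg_mul_le {α : Type*} [MeasurableSpace α] {μ : Measure α} [SFinite μ]
    {f : α → ℝ} (hf : Measurable f) (hf0 : ∀ x, 0 ≤ f x) {C : ℝ} (hC : 0 ≤ C) (p : ℕ)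
    (h : ∀ t, 0 < t → μ {x | f x < t} ≤ ENNReal.ofReal (C * t ^ p)) {κ : ℝ} (hκ : 0 < κ) :
    ∫⁻ x, ENNReal.ofReal (exp (-(κ * f x))) ∂μ ≤ ENNReal.ofReal (C * p.factorial / κ ^ p) := by
  set ψ : ℝ → ℝ≥0∞ := fun s ↦ ENNReal.ofReal (κ * exp (-κ * s)) with hψ
  have hψm : Measurable ψ := by fun_prop
  have h1 : ∀ x, ENNReal.ofReal (exp (-(κ * f x))) =
      ∫⁻ s in Set.Ioi 0, (Set.Ioi (f x)).indicator ψ s := fun x ↦ by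
    rw [lintegral_indicator measurableSet_Ioi, Measure.restrict_restrict measurableSet_Ioi,
      Set.inter_eq_left.2 (Set.Ioi_subset_Ioi (hf0 x)), hψ,
      ← ofReal_integral_eq_lintegral_ofReal]
    · rw [integral_const_mul, integral_exp_mul_Ioi (neg_lt_zero.2 hκ)]
      congr 1
      field_simp
    · exact (exp_neg_integrableOn_Ioi _ hκ).const_mul _
    · exact Eventually.of_forall fun s ↦ by positivity
  have hmeas : MeasurableSet {q : α × ℝ | f q.1 < q.2} :=
    measurableSet_lt (hf.comp measurable_fst) measurable_snd
  simp_rw [h1]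
  rw [lintegral_lintegral_swap]
  swap
  · refine (Measurable.aemeasurable ?_)
    exact (hψm.comp measurable_snd).indicator hmeas
  have h2 : ∀ s ∈ Set.Ioi (0 : ℝ), ∫⁻ x, (Set.Ioi (f x)).indicator ψ s ∂μ ≤
      ENNReal.ofReal (C * κ * (s ^ (((p : ℝ) + 1) - 1) * exp (-(κ * s)))) := fun s hs ↦ by
    have : ∀ x, (Set.Ioi (f x)).indicator ψ s = {x | f x < s}.indicator (fun _ ↦ ψ s) x :=
      fun x ↦ rfl
    simp_rw [this]
    rw [lintegral_indicator_const (measurableSet_lt hf measurable_const)]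
    refine (mul_le_mul_right (h s hs) _).trans_eq ?_
    rw [hψ, ← ENNReal.ofReal_mul (by positivity)]
    congr 1
    rw [add_sub_cancel_right, Real.rpow_natCast, neg_mul]
    ring
  refine (setLIntegral_mono' measurableSet_Ioi h2).trans ?_
  have hval := Real.integral_rpow_mul_exp_neg_mul_Ioi (a := (p : ℝ) + 1) (r := κ) (by positivity) hκ
  have hint : IntegrableOn (fun s : ℝ ↦ s ^ (((p : ℝ) + 1) - 1) * exp (-(κ * s))) (Set.Ioi 0) := by
    by_contra hcon
    rw [integral_undef hcon] at hval
    have : 0 < Gamma ((p : ℝ) + 1) := Gamma_pos_of_pos (by positivity)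
    have : 0 < (1 / κ) ^ ((p : ℝ) + 1) * Gamma ((p : ℝ) + 1) := by positivity
    linarith
  rw [← ofReal_integral_eq_lintegral_ofReal (hint.const_mul _), integral_const_mul, hval,
    Real.Gamma_nat_eq_factorial]
  · apply ENNReal.ofReal_le_ofReal
    apply le_of_eq
    rw [← Nat.cast_succ, Real.rpow_natCast, Nat.succ_eq_add_one, one_div, inv_pow]
    field_simp
    ring
  · refine (ae_restrict_iff' measurableSet_Ioi).2 (Eventually.of_forall fun s hs ↦ ?_)
    have : (0 : ℝ) < s := hs
    positivity

namespace IsBody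

variable {Ω : Set Plane} {o : Plane} {ρ R : ℝ} {g : Plane → ℝ} (H : IsBody Ω o ρ R g)
include H

lemma volume_gauge_layer_le {t : ℝ} (ht : 0 < t) :
    volume {x ∈ Ω | 1 - g x < t} ≤ ENNReal.ofReal (2 * t) := by
  have hg := H.continuous
  rcases le_total 1 t with h1 | h1
  · calc volume {x ∈ Ω | 1 - g x < t} ≤ volume Ω := measure_mono fun x hx ↦ hx.1
      _ = ENNReal.ofReal 1 := by rw [H.volume_eq]; simp
      _ ≤ _ := ENNReal.ofReal_le_ofReal (by linarith)
  have hm : MeasurableSet {x | g x ≤ 1 - t} := measurableSet_le hg.measurable measurable_const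
  have hsub : AffineMap.homothety o (1 - t) '' Ω ⊆ {x | g x ≤ 1 - t} := by
    rintro _ ⟨z, hz, rfl⟩
    have h2 := H.homothety (1 - t) z (by linarith)
    have h3 := (H.mem_iff z).1 hz
    simp only [AffineMap.homothety_apply, vsub_eq_sub, vadd_eq_add, Set.mem_ofPred_eq]
    rw [add_comm, h2]
    nlinarith
  have hlow : ENNReal.ofReal ((1 - t) ^ 2) ≤ volume {x | g x ≤ 1 - t} := by
    refine le_trans (le_of_eq ?_) (measure_mono hsub)
    rw [Measure.addHaar_image_homothety, H.volume_eq, mul_one, finrank_euclideanSpace_fin,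
      abs_of_nonneg (sq_nonneg _)]
  have hΩsub : {x | g x ≤ 1 - t} ⊆ Ω := fun x hx ↦ (H.mem_iff x).2 (by
    have : g x ≤ 1 - t := hx
    linarith)
  have heq : {x ∈ Ω | 1 - g x < t} = Ω \ {x | g x ≤ 1 - t} := by
    ext x
    simp only [Set.mem_ofPred_eq, Set.mem_sdiff, not_le]
    constructor <;> rintro ⟨h2, h3⟩ <;> exact ⟨h2, by linarith⟩
  rw [heq, measure_sdiff hΩsub hm.nullMeasurableSet
    (measure_ne_top_of_subset hΩsub (by simp [H.volume_eq])), H.volume_eq]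
  calc 1 - volume {x | g x ≤ 1 - t} ≤ 1 - ENNReal.ofReal ((1 - t) ^ 2) := tsub_le_tsub_left hlow _
    _ = ENNReal.ofReal (1 - (1 - t) ^ 2) := by
      rw [ENNReal.ofReal_sub _ (sq_nonneg _), ENNReal.ofReal_one]
    _ ≤ _ := ENNReal.ofReal_le_ofReal (by nlinarith)

lemma lintegral_exp_gauge_le {κ : ℝ} (hκ : 0 < κ) :
    ∫⁻ x in Ω, ENNReal.ofReal (exp (-(κ * (1 - g x)))) ≤ ENNReal.ofReal (2 / κ) := by
  have hg := H.continuous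
  have h1 : ∫⁻ x in Ω, ENNReal.ofReal (exp (-(κ * (1 - g x)))) =
      ∫⁻ x in Ω, ENNReal.ofReal (exp (-(κ * max (1 - g x) 0))) := by
    refine setLIntegral_congr_fun H.measurableSet fun x hx ↦ ?_
    have := (H.mem_iff x).1 hx
    simp only [max_eq_left (sub_nonneg.2 this)]
  rw [h1]
  refine (lintegral_exp_neg_mul_le (f := fun x ↦ max (1 - g x) 0) (C := 2) (by fun_prop)
    (fun x ↦ le_max_right _ _) (by norm_num) 1 (fun t ht ↦ ?_) hκ).trans_eq ?_
  · rw [Measure.restrict_apply (measurableSet_lt (by fun_prop) measurable_const), pow_one]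
    refine (measure_mono fun x hx ↦ ?_).trans (H.volume_gauge_layer_le ht)
    exact ⟨hx.2, (le_max_left _ _).trans_lt hx.1⟩
  · simp

/-- Away from the strongly curved points, a disc centred in `Ω` meets `Ω` in more than half of its
area. -/
lemma area_closedBall_inter_ge_of_notMem_curved {x : Plane} (hx : x ∈ Ω) {r : ℝ} (hr : 0 < r)
    (hgood : x ∉ curved Ω g r) :
    π * r ^ 2 / 2 + r * min r (ρ * (1 - g x)) / 2 ≤ volume.real (Ω ∩ closedBall x r) := by
  have hρ := H.pos
  have hg := H.continuous
  set u := 1 - g x with hu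
  have hu0 : 0 ≤ u := sub_nonneg.2 ((H.mem_iff x).1 hx)
  have hS : axisDiff g (2 * r) x ≤ u := by
    by_contra! hcon
    exact hgood ⟨hx, hcon⟩
  have hD : ∀ v : Plane, ‖v‖ ≤ r → secondDiff g v x ≤ u / 2 := fun v hv ↦
    (secondDiff_le_axisDiff H.convexOn hv x).trans (by linarith)
  obtain ⟨v₀, hv₀, hv₀eq⟩ : ∃ v : Plane, ‖v‖ = r ∧ g (x + v) = g (x - v) := by
    set c : ℝ → Plane := fun θ ↦ EuclideanSpace.single 0 (r * cos θ) +
      EuclideanSpace.single 1 (r * sin θ) with hc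
    have hc0 : ∀ θ, ‖c θ‖ = r := fun θ ↦ by
      rw [← sq_eq_sq₀ (norm_nonneg _) hr.le, norm_sq_eq]
      simp only [hc, PiLp.add_apply, PiLp.single_apply]
      norm_num
      nlinarith [sin_sq_add_cos_sq θ]
    have hcc : Continuous c := by
      have h0 : ∀ i : Fin 2, Continuous fun t : ℝ ↦ (EuclideanSpace.single i t : Plane) := fun i ↦ by
        have : (fun t : ℝ ↦ (EuclideanSpace.single i t : Plane)) =
            fun t ↦ t • EuclideanSpace.single i 1 := by
          ext t j; simp
        rw [this]; fun_prop
      exact ((h0 0).comp (by fun_prop)).add ((h0 1).comp (by fun_prop))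
    have hpi : c π = -c 0 := by
      ext i; fin_cases i <;> simp [hc]
    have hcont : Continuous fun θ ↦ g (x + c θ) - g (x - c θ) := by fun_prop
    have hanti : g (x + c π) - g (x - c π) = -(g (x + c 0) - g (x - c 0)) := by
      rw [hpi]; simp only [sub_neg_eq_add, ← sub_eq_add_neg]; ring
    obtain ⟨θ, hθ⟩ : ∃ θ, g (x + c θ) - g (x - c θ) = 0 := by
      rcases le_total 0 (g (x + c 0) - g (x - c 0)) with h | h
      · exact mem_range_of_exists_le_of_exists_ge hcont ⟨π, by linarith⟩ ⟨0, h⟩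
      · exact mem_range_of_exists_le_of_exists_ge hcont ⟨0, h⟩ ⟨π, by linarith⟩
    exact ⟨c θ, hc0 θ, by linarith⟩
  have hv₀g : g (x + v₀) ≤ g x + u / 4 := by
    have := hD v₀ hv₀.le
    rw [secondDiff] at this
    linarith
  obtain ⟨T, hT⟩ : ∃ T : Plane ≃ₗᵢ[ℝ] Plane, T (r • EuclideanSpace.single 0 1) = v₀ := by
    apply exists_linearIsometryEquiv_map_eq
    rw [norm_smul, Real.norm_of_nonneg hr.le, hv₀]
    simp
  set f : Plane → Plane := fun z ↦ T.symm (z - x) with hf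
  have hpres : MeasurePreserving f volume volume :=
    (T.symm.measurePreserving).comp (measurePreserving_sub_right volume x)
  have hfx : ∀ z, dist z x = ‖f z‖ := fun z ↦ by
    change dist z x = ‖T.symm (z - x)‖
    rw [T.symm.norm_map, dist_eq_norm]
  have hTf : ∀ z, z - x = T (f z) := fun z ↦ (T.apply_symm_apply (z - x)).symm
  have hfr : ∀ z, f (x + x - z) = -f z := fun z ↦ by
    change T.symm (x + x - z - x) = -T.symm (z - x)
    rw [← map_neg]; congr 1; abel
  set δ := min r (ρ * u) / 2 with hδ
  have hδ0 : 0 ≤ δ := by positivity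
  have hδr : δ ≤ r / 2 := by rw [hδ]; gcongr; exact min_le_left _ _
  have hδu : δ ≤ ρ * u / 2 := by rw [hδ]; gcongr; exact min_le_right _ _
  set B : Set Plane := {p | p 0 ∈ Set.Ioo (-(r / 2)) 0 ∧ p 1 ∈ Set.Ioo (-δ) δ} with hB
  have hBm : MeasurableSet B := measurableSet_box _ _ _ _
  have hBhalf : B ⊆ halfDisc r := by
    rintro p ⟨⟨h1, h2⟩, h3, h4⟩
    refine ⟨h2, ?_⟩
    apply (sq_le_sq₀ (norm_nonneg _) hr.le).1
    rw [norm_sq_eq]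
    nlinarith
  have hBΩ : ∀ p : Plane, |p 0| ≤ r → |p 1| ≤ δ → x + T p ∈ Ω := by
    intro p h1 h2
    have hdecomp : T p = (p 0 / r) • v₀ + (p 1) • T (EuclideanSpace.single 1 1) := by
      rw [← hT, ← map_smul, ← map_smul, ← map_add]
      congr 1
      ext i; fin_cases i <;> simp [hr.ne']
    have h3 : g (x + (p 0 / r) • v₀) ≤ g x + u / 4 := by
      have hcvx : ∀ s : ℝ, 0 ≤ s → s ≤ 1 → ∀ w : Plane, g (x + w) ≤ g x + u / 4 →
          g (x + s • w) ≤ g x + u / 4 := fun s hs hs1 w hw ↦ by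
        have := H.convexOn.2 (Set.mem_univ x) (Set.mem_univ (x + w)) (sub_nonneg.2 hs1) hs (by ring)
        rw [show (1 - s) • x + s • (x + w) = x + s • w by module, smul_eq_mul, smul_eq_mul] at this
        nlinarith
      rcases le_total 0 (p 0) with h0 | h0
      · rw [abs_of_nonneg h0] at h1
        exact hcvx _ (by positivity) ((div_le_one hr).2 h1) _ hv₀g
      · rw [abs_of_nonpos h0] at h1
        rw [show (p 0 / r) • v₀ = (-p 0 / r) • (-v₀) by module]
        exact hcvx _ (div_nonneg (by linarith) hr.le) ((div_le_one hr).2 h1) _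
          (by rw [← sub_eq_add_neg, ← hv₀eq]; exact hv₀g)
    have h4 := H.abs_sub_le (x + T p) (x + (p 0 / r) • v₀)
    rw [hdecomp, dist_eq_norm, ← add_assoc, add_sub_cancel_left, norm_smul, T.norm_map] at h4
    have h5 : ‖p 1‖ * ‖(EuclideanSpace.single 1 1 : Plane)‖ / ρ ≤ u / 2 := by
      rw [div_le_iff₀ hρ]
      simp only [PiLp.norm_single, norm_one, mul_one, Real.norm_eq_abs]
      linarith
    rw [H.mem_iff, hdecomp, ← add_assoc]
    have := (le_abs_self _).trans (h4.trans h5)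
    linarith
  have := area_inter_ge_of_antipodal (Z := closedBall x r) (m := x) (S := f ⁻¹' halfDisc r)
    (G := f ⁻¹' B) H.measurableSet H.volume_eq (hpres.measurable (measurableSet_halfDisc r))
    (fun z hz ↦ ?_) (fun z hz ↦ ?_) (fun z hz hz' ↦ ?_) (fun z hz ↦ ?_)
    (Set.preimage_mono hBhalf) (fun z hz ↦ ?_)
  · refine le_trans (le_of_eq ?_) this
    rw [Measure.real, hpres.measure_preimage (measurableSet_halfDisc r).nullMeasurableSet,
      ← Measure.real, measureReal_def volume (f ⁻¹' B),
      hpres.measure_preimage hBm.nullMeasurableSet, ← Measure.real, area_halfDisc hr.le, hB, area_box _ _ _ _ (by linarith) (by linarith), hδ]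
    ring
  · rw [mem_closedBall, hfx]; exact hz.2
  · rw [mem_closedBall, hfx, hfr, norm_neg]; exact hz.2
  · rw [Set.mem_preimage, hfr] at hz'
    have h1 := hz.1
    have h2 := hz'.1
    rw [PiLp.neg_apply] at h2
    linarith
  · by_contra! hcon
    have h1 := hD (z - x) (by rw [← dist_eq_norm, hfx]; exact hz.2)
    rw [secondDiff, show x + (z - x) = z by abel, show x - (z - x) = x + x - z by abel] at h1
    rw [H.mem_iff, H.mem_iff] at hcon
    linarith
  · obtain ⟨⟨h1, h2⟩, h3, h4⟩ := hz
    have ha : |f z 0| ≤ r := by rw [abs_le]; constructor <;> linarith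
    have hb : |f z 1| ≤ δ := by rw [abs_le]; constructor <;> linarith
    constructor
    · have := hBΩ (f z) ha hb
      rwa [← hTf, add_sub_cancel] at this
    · have := hBΩ (-f z) (by rwa [PiLp.neg_apply, abs_neg]) (by rwa [PiLp.neg_apply, abs_neg])
      rwa [map_neg, ← hTf, show x + -(z - x) = x + x - z by abel] at this

lemma area_closedBall_inter_ge {x : Plane} (hx : x ∈ Ω) {r : ℝ} (hr : 0 ≤ r) (hrR : r ≤ R) :
    π * (ρ / (2 * R)) ^ 2 * r ^ 2 ≤ volume.real (Ω ∩ closedBall x r) :=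
  RandomGeometricGraph.area_closedBall_inter_ge H.convex H.pos H.le H.closedBall_subset
    H.subset_closedBall hx hr (by linarith [H.pos, H.le])

/-- The isolated vertices near the boundary are negligible. -/
lemma lintegral_layer_le {r ν : ℝ} (hr : 0 < r) (hrρ : 2 * r ≤ ρ) (hν : 0 < ν) :
    ∫⁻ x in {x ∈ Ω | ¬ closedBall x r ⊆ Ω},
        ENNReal.ofReal (exp (-(ν * volume.real (Ω ∩ closedBall x r)))) ≤
      ENNReal.ofReal (256 * r ^ 2 / ρ ^ 2 * exp (-(ν * (π * (ρ / (2 * R)) ^ 2 * r ^ 2))) +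
        exp (-(ν * (π * r ^ 2 / 2))) *
          (2 * r / ρ * exp (-(ν * (r ^ 2 / 2))) + 2 / (ν * r * ρ / 2))) := by
  have hρ := H.pos
  have hg := H.continuous
  set E := {x ∈ Ω | ¬ closedBall x r ⊆ Ω} with hE
  set c₁ := exp (-(ν * (π * (ρ / (2 * R)) ^ 2 * r ^ 2))) with hc₁
  set c₂ := exp (-(ν * (π * r ^ 2 / 2))) with hc₂
  set c₃ := exp (-(ν * (r ^ 2 / 2))) with hc₃
  set φ : Plane → ℝ := fun x ↦ exp (-(ν * r * ρ / 2 * (1 - g x))) with hφ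
  have hpt : ∀ x ∈ Ω, ENNReal.ofReal (exp (-(ν * volume.real (Ω ∩ closedBall x r)))) ≤
      (curved Ω g r).indicator (fun _ ↦ ENNReal.ofReal c₁) x +
        (ENNReal.ofReal (c₂ * c₃) + ENNReal.ofReal c₂ * ENNReal.ofReal (φ x)) := by
    intro x hx
    by_cases hxc : x ∈ curved Ω g r
    · rw [Set.indicator_of_mem hxc]
      refine le_add_right (ENNReal.ofReal_le_ofReal ?_)
      rw [hc₁, exp_le_exp]
      have := H.area_closedBall_inter_ge hx hr.le (by linarith [H.le])
      nlinarith
    · refine le_add_left ?_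
      rw [← ENNReal.ofReal_mul (by positivity), ← ENNReal.ofReal_add (by positivity) (by positivity)]
      apply ENNReal.ofReal_le_ofReal
      have h1 := H.area_closedBall_inter_ge_of_notMem_curved hx hr hxc
      rw [hc₂, hc₃, hφ, ← exp_add, ← exp_add]
      rcases min_choice r (ρ * (1 - g x)) with h | h
      · refine le_add_of_le_of_nonneg (exp_le_exp.2 ?_) (exp_pos _).le
        rw [h] at h1
        nlinarith
      · refine le_add_of_nonneg_of_le (exp_pos _).le (exp_le_exp.2 ?_)
        rw [h] at h1
        nlinarith
  have hEΩ : E ⊆ Ω := fun x hx ↦ hx.1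
  calc _ ≤ ∫⁻ x in E, ((curved Ω g r).indicator (fun _ ↦ ENNReal.ofReal c₁) x +
        (ENNReal.ofReal (c₂ * c₃) + ENNReal.ofReal c₂ * ENNReal.ofReal (φ x))) := by
        refine lintegral_mono_ae ?_
        have : ∀ᵐ x ∂volume.restrict Ω, x ∈ Ω := ae_restrict_mem H.measurableSet
        filter_upwards [ae_restrict_of_ae_restrict_of_subset hEΩ this] with x hx using hpt x hx
    _ = (∫⁻ x in E, (curved Ω g r).indicator (fun _ ↦ ENNReal.ofReal c₁) x) +
        (ENNReal.ofReal (c₂ * c₃) * volume E +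
          ENNReal.ofReal c₂ * ∫⁻ x in E, ENNReal.ofReal (φ x)) := by
        rw [lintegral_add_left (measurable_const.indicator (H.measurableSet_curved r)),
          lintegral_add_left measurable_const, lintegral_const_mul _ (by fun_prop),
          setLIntegral_const]
    _ ≤ ENNReal.ofReal c₁ * ENNReal.ofReal (256 * r ^ 2 / ρ ^ 2) +
        (ENNReal.ofReal (c₂ * c₃) * ENNReal.ofReal (2 * r / ρ) +
          ENNReal.ofReal c₂ * ENNReal.ofReal (2 / (ν * r * ρ / 2))) := by
        gcongr
        · refine (setLIntegral_le_lintegral _ _).trans ?_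
          rw [lintegral_indicator_const (H.measurableSet_curved r)]
          gcongr
          exact H.volume_curved_le hr.le hrρ
        · exact H.area_layer_le hr.le (by linarith)
        · exact (lintegral_mono_set hEΩ).trans (H.lintegral_exp_gauge_le (by positivity))
    _ = _ := by
        rw [← ENNReal.ofReal_mul (by positivity), ← ENNReal.ofReal_mul (by positivity),
          ← ENNReal.ofReal_mul (by positivity), ← ENNReal.ofReal_add (by positivity) (by positivity),
          ← ENNReal.ofReal_add (by positivity) (by positivity)]
        congr 1
        ring

end IsBody

section Sampling

variable {α : Type*} [MeasurableSpace α] {μ : Measure α} [IsProbabilityMeasure μ]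

/-- The law of the event that some coordinates lie in `T` and all others in a section of `A`. -/
lemma measure_pi_sum_eq {ι κ : Type*} [Fintype ι] [Fintype κ] {k : ℕ} (e : Fin k ⊕ κ ≃ ι)
    {T : Set (Fin k → α)} (hT : MeasurableSet T) {A : Set ((Fin k → α) × α)}
    (hA : MeasurableSet A) :
    (Measure.pi fun _ : ι ↦ μ) {X | (fun i ↦ X (e (Sum.inl i))) ∈ T ∧
        ∀ j, ((fun i ↦ X (e (Sum.inl i))), X (e (Sum.inr j))) ∈ A} =
      ∫⁻ x in T, μ {z | (x, z) ∈ A} ^ Fintype.card κ ∂(Measure.pi fun _ : Fin k ↦ μ) := by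
  set E : Set ((Fin k → α) × (κ → α)) := {q | q.1 ∈ T ∧ ∀ j, (q.1, q.2 j) ∈ A} with hE
  have hEm : MeasurableSet E := by
    have : E = Prod.fst ⁻¹' T ∩ ⋂ j, (fun q : (Fin k → α) × (κ → α) ↦ (q.1, q.2 j)) ⁻¹' A := by
      ext q; simp [hE]
    rw [this]
    refine (measurable_fst hT).inter (MeasurableSet.iInter fun j ↦ ?_)
    exact (measurable_fst.prodMk ((measurable_pi_apply j).comp measurable_snd)) hA
  have h1 := (measurePreserving_piCongrLeft (fun _ : ι ↦ μ) e).symm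
  have h2 := measurePreserving_sumPiEquivProdPi (fun _ : Fin k ⊕ κ ↦ μ)
  have h3 := h2.comp h1
  have hset : {X : ι → α | (fun i ↦ X (e (Sum.inl i))) ∈ T ∧
      ∀ j, ((fun i ↦ X (e (Sum.inl i))), X (e (Sum.inr j))) ∈ A} =
      (MeasurableEquiv.sumPiEquivProdPi (fun _ : Fin k ⊕ κ ↦ α) ∘
        (MeasurableEquiv.piCongrLeft (fun _ : ι ↦ α) e).symm) ⁻¹' E := rfl
  rw [hset, h3.measure_preimage hEm.nullMeasurableSet, Measure.prod_apply hEm,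
    ← lintegral_indicator hT]
  refine lintegral_congr fun x ↦ ?_
  by_cases hx : x ∈ T
  · have : Prod.mk x ⁻¹' E = Set.univ.pi fun _ : κ ↦ {z | (x, z) ∈ A} := by
      ext q; simp [hE, hx]
    rw [Set.indicator_of_mem hx, this, Measure.pi_pi]
    simp
  · have : Prod.mk x ⁻¹' E = ∅ := by
      ext q; simp [hE, hx]
    rw [Set.indicator_of_notMem hx, this, measure_empty]

lemma measure_pi_embedding_eq {n k : ℕ} (e : Fin k ↪ Fin n)
    {T : Set (Fin k → α)} (hT : MeasurableSet T) {A : Set ((Fin k → α) × α)}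
    (hA : MeasurableSet A) :
    (Measure.pi fun _ : Fin n ↦ μ) {X | (fun i ↦ X (e i)) ∈ T ∧
        ∀ j, j ∉ Set.range e → ((fun i ↦ X (e i)), X j) ∈ A} =
      ∫⁻ x in T, μ {z | (x, z) ∈ A} ^ (n - k) ∂(Measure.pi fun _ : Fin k ↦ μ) := by
  classical
  have hcard : Fintype.card ((Set.range e)ᶜ : Set (Fin n)) = n - k := by
    rw [Fintype.card_compl_set, Fintype.card_fin, Set.card_range_of_injective e.injective,
      Fintype.card_fin]
  let E : Fin k ⊕ ((Set.range e)ᶜ : Set (Fin n)) ≃ Fin n :=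
    ((Equiv.ofInjective e e.injective).sumCongr (Equiv.refl _)).trans (Equiv.Set.sumCompl _)
  rw [← hcard, ← measure_pi_sum_eq E hT hA]
  congr 1
  ext X
  simp [E]

/-- The union bound for the existence of a point with a given local configuration. -/
lemma measure_exists_point_le (n : ℕ) {T : Set α} (hT : MeasurableSet T) {A : Set (α × α)}
    (hA : MeasurableSet A) :
    (Measure.pi fun _ : Fin n ↦ μ) {X | ∃ i, X i ∈ T ∧ ∀ j, j ≠ i → (X i, X j) ∈ A} ≤
      n * ∫⁻ x in T, μ {z | (x, z) ∈ A} ^ (n - 1) ∂μ := by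
  have hsub : {X : Fin n → α | ∃ i, X i ∈ T ∧ ∀ j, j ≠ i → (X i, X j) ∈ A} =
      ⋃ i, {X : Fin n → α | X i ∈ T ∧ ∀ j, j ≠ i → (X i, X j) ∈ A} := by
    ext X; simp
  rw [hsub]
  refine (measure_iUnion_fintype_le _ _).trans ?_
  have key : ∀ i : Fin n, (Measure.pi fun _ : Fin n ↦ μ)
      {X | X i ∈ T ∧ ∀ j, j ≠ i → (X i, X j) ∈ A} =
      ∫⁻ x in T, μ {z | (x, z) ∈ A} ^ (n - 1) ∂μ := fun i ↦ by
    have h := measure_pi_embedding_eq (μ := μ)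
      (⟨fun _ ↦ i, fun _ _ _ ↦ Subsingleton.elim _ _⟩ : Fin 1 ↪ Fin n)
      (T := (fun x : Fin 1 → α ↦ x 0) ⁻¹' T) (measurable_pi_apply 0 hT)
      (A := (fun q : (Fin 1 → α) × α ↦ (q.1 0, q.2)) ⁻¹' A) (hA.preimage (by fun_prop))
    have h2 := (measurePreserving_funUnique μ (Fin 1)).setLIntegral_comp_preimage hT
      (f := fun x ↦ μ {z | (x, z) ∈ A} ^ (n - 1))
      ((measurable_measure_prodMk_left hA).pow_const _)
    rw [← h2]
    refine Eq.trans ?_ h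
    congr 1
    ext X
    simp
    change _ ↔ X i ∈ T ∧ ∀ j, ¬ i = j → (X i, X j) ∈ A
    simp [eq_comm]
  simp [key]

/-- The union bound for the existence of a pair of points with a given local configuration. -/
lemma measure_exists_pair_le (n : ℕ) {T : Set (α × α)} (hT : MeasurableSet T)
    {A : Set ((α × α) × α)} (hA : MeasurableSet A) :
    (Measure.pi fun _ : Fin n ↦ μ) {X | ∃ i j, i ≠ j ∧ (X i, X j) ∈ T ∧
        ∀ l, l ≠ i → l ≠ j → ((X i, X j), X l) ∈ A} ≤
      n ^ 2 * ∫⁻ q in T, μ {z | (q, z) ∈ A} ^ (n - 2) ∂(μ.prod μ) := by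
  have hsub : {X : Fin n → α | ∃ i j, i ≠ j ∧ (X i, X j) ∈ T ∧
        ∀ l, l ≠ i → l ≠ j → ((X i, X j), X l) ∈ A} =
      ⋃ q : Fin n × Fin n, {X : Fin n → α | q.1 ≠ q.2 ∧ (X q.1, X q.2) ∈ T ∧
        ∀ l, l ≠ q.1 → l ≠ q.2 → ((X q.1, X q.2), X l) ∈ A} := by
    ext X; simp
  rw [hsub]
  refine (measure_iUnion_fintype_le _ _).trans ?_
  have key : ∀ q : Fin n × Fin n, (Measure.pi fun _ : Fin n ↦ μ)
      {X | q.1 ≠ q.2 ∧ (X q.1, X q.2) ∈ T ∧ ∀ l, l ≠ q.1 → l ≠ q.2 → ((X q.1, X q.2), X l) ∈ A} ≤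
      ∫⁻ q in T, μ {z | (q, z) ∈ A} ^ (n - 2) ∂(μ.prod μ) := fun q ↦ by
    by_cases hq : q.1 = q.2
    · simp [hq]
    have hinj : Function.Injective ![q.1, q.2] := by
      intro a b hab
      fin_cases a <;> fin_cases b <;> simp_all
    have h := measure_pi_embedding_eq (μ := μ) (⟨![q.1, q.2], hinj⟩ : Fin 2 ↪ Fin n)
      (T := (fun x : Fin 2 → α ↦ (x 0, x 1)) ⁻¹' T) (hT.preimage (by fun_prop))
      (A := (fun q : (Fin 2 → α) × α ↦ ((q.1 0, q.1 1), q.2)) ⁻¹' A) (hA.preimage (by fun_prop))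
    have h2 := (measurePreserving_finTwoArrow μ).setLIntegral_comp_preimage hT
      (f := fun x ↦ μ {z | (x, z) ∈ A} ^ (n - 2))
      ((measurable_measure_prodMk_left hA).pow_const _)
    rw [← h2]
    refine le_of_eq (Eq.trans ?_ h)
    congr 1
    ext X
    simp [hq]
    exact fun _ ↦ ⟨fun h l h1 h2 ↦ h l h2 h1, fun h l h1 h2 ↦ h l h2 h1⟩
  refine (Finset.sum_le_sum fun q _ ↦ key q).trans_eq ?_
  simp [sq]

lemma measure_compl_pow_le {S : Set α} (hS : MeasurableSet S) {a : ℝ} (ha : a ≤ μ.real S) (m : ℕ) :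
    μ Sᶜ ^ m ≤ ENNReal.ofReal (exp (-(m * a))) := by
  have h1 : μ Sᶜ ≤ ENNReal.ofReal (exp (-a)) := by
    rw [← ofReal_measureReal, probReal_compl_eq_one_sub hS]
    apply ENNReal.ofReal_le_ofReal
    have := add_one_le_exp (-a)
    linarith
  calc μ Sᶜ ^ m ≤ ENNReal.ofReal (exp (-a)) ^ m := by gcongr
    _ = _ := by rw [← ENNReal.ofReal_pow (exp_pos _).le, ← exp_nat_mul]; congr 2; ring

end Sampling

lemma lintegral_midpoint_mul_sub {F G : Plane → ℝ≥0∞} (hF : Measurable F) (hG : Measurable G) :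
    ∫⁻ q : Plane × Plane, F ((2⁻¹ : ℝ) • (q.1 + q.2)) * G (q.2 - q.1) =
      (∫⁻ m, F m) * ∫⁻ w, G w := by
  rw [Measure.volume_eq_prod, lintegral_prod _ (by fun_prop)]
  have h1 : ∀ x : Plane, ∫⁻ y, F ((2⁻¹ : ℝ) • (x + y)) * G (y - x) =
      ∫⁻ w, F (x + (2⁻¹ : ℝ) • w) * G w := fun x ↦ by
    rw [← lintegral_add_left_eq_self _ x]
    refine lintegral_congr fun w ↦ ?_
    congr 2
    · module
    · simp
  simp only [h1]
  rw [lintegral_lintegral_swap (by fun_prop)]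
  have h2 : ∀ w : Plane, ∫⁻ x, F (x + (2⁻¹ : ℝ) • w) * G w = (∫⁻ m, F m) * G w := fun w ↦ by
    rw [lintegral_mul_const _ (by fun_prop), lintegral_add_right_eq_self (fun x ↦ F x)]
  simp only [h2]
  rw [lintegral_const_mul _ hG]

lemma lintegral_exp_norm_le {κ : ℝ} (hκ : 0 < κ) :
    ∫⁻ w : Plane, ENNReal.ofReal (exp (-(κ * ‖w‖))) ≤ ENNReal.ofReal (2 * π / κ ^ 2) := by
  refine (lintegral_exp_neg_mul_le measurable_norm (fun _ ↦ norm_nonneg _) pi_pos.le 2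
    (fun t ht ↦ ?_) hκ).trans_eq ?_
  · rw [← volume_real_closedBall (0 : Plane) ht.le, ofReal_measureReal measure_closedBall_lt_top.ne]
    exact measure_mono fun x hx ↦ by simpa using (le_of_lt hx : ‖x‖ ≤ t)
  · congr 1
    norm_num [Nat.factorial]
    ring

namespace IsBody

variable {Ω : Set Plane} {o : Plane} {ρ R : ℝ} {g : Plane → ℝ} (H : IsBody Ω o ρ R g)

include H

lemma area_emptyZone_inter_ge {x y : Plane} (hx : x ∈ Ω) (hy : y ∈ Ω) {r : ℝ} (hr : 0 < r)
    (hrR : r ≤ R) (hxy : dist x y ≤ ρ / 4) :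
    π * (ρ / (8 * R)) ^ 2 * r ^ 2 ≤ volume.real (Ω ∩ emptyZone r x y) :=
  RandomGeometricGraph.area_emptyZone_inter_ge H.convex H.pos H.le H.closedBall_subset
    H.subset_closedBall H.volume_eq hx hy hr hrR hxy

/-- The expected number of close pairs with no other sample point in their empty zone. -/
lemma lintegral_pairs_le {K r ν : ℝ} (hK : 1 ≤ K) (hr : 0 < r) (hrρ : 4 * K * r ≤ ρ)
    (hν : 0 < ν) :
    ∫⁻ q in {q : Plane × Plane | q.1 ∈ Ω ∧ q.2 ∈ Ω ∧ dist q.1 q.2 ≤ K * r},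
        ENNReal.ofReal (exp (-(ν * volume.real (Ω ∩ emptyZone r q.1 q.2)))) ≤
      ENNReal.ofReal (exp (-(ν * (π * r ^ 2))) * (2 * π / (ν * r / (32 * K ^ 2)) ^ 2) +
        4 * K * r / ρ * (exp (-(ν * (π * r ^ 2 / 2))) * (2 * π / (ν * r / (32 * K ^ 2)) ^ 2)) +
        256 * (2 * K * r) ^ 2 / ρ ^ 2 *
          (exp (-(ν * (π * (ρ / (8 * R)) ^ 2 * r ^ 2))) * (π * (K * r) ^ 2))) := by
  have hρ := H.pos
  have hR := H.le
  set κ := ν * r / (32 * K ^ 2) with hκ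
  have hκ0 : 0 < κ := by positivity
  set a := 2 * K * r with ha
  have ha0 : 0 ≤ a := by positivity
  set B := toMeasurable volume {x ∈ Ω | ¬ closedBall x a ⊆ Ω} with hB
  have hBm : MeasurableSet B := measurableSet_toMeasurable _ _
  have hKr : K * r ≤ ρ / 4 := by linarith
  have hrK : r ≤ K * r := by nlinarith
  let E : Plane → ℝ≥0∞ := fun w ↦ ENNReal.ofReal (exp (-(κ * ‖w‖)))
  have hE : Measurable E := by fun_prop
  let c1 := ENNReal.ofReal (exp (-(ν * (π * r ^ 2))))
  let c2 := ENNReal.ofReal (exp (-(ν * (π * r ^ 2 / 2))))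
  let c3 := ENNReal.ofReal (exp (-(ν * (π * (ρ / (8 * R)) ^ 2 * r ^ 2))))
  let G3 : Plane → ℝ≥0∞ := (closedBall (0 : Plane) (K * r)).indicator fun _ ↦ c3
  have hG3 : Measurable G3 := measurable_const.indicator isClosed_closedBall.measurableSet
  have hTm : MeasurableSet {q : Plane × Plane | q.1 ∈ Ω ∧ q.2 ∈ Ω ∧ dist q.1 q.2 ≤ K * r} :=
    (measurable_fst H.measurableSet).inter ((measurable_snd H.measurableSet).inter
      (measurableSet_le (measurable_fst.dist measurable_snd) measurable_const))
  have hpt : ∀ q ∈ {q : Plane × Plane | q.1 ∈ Ω ∧ q.2 ∈ Ω ∧ dist q.1 q.2 ≤ K * r},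
      ENNReal.ofReal (exp (-(ν * volume.real (Ω ∩ emptyZone r q.1 q.2)))) ≤
      Ω.indicator (fun _ ↦ (1 : ℝ≥0∞)) ((2⁻¹ : ℝ) • (q.1 + q.2)) * (c1 * E (q.2 - q.1)) +
      B.indicator (fun _ ↦ (1 : ℝ≥0∞)) ((2⁻¹ : ℝ) • (q.1 + q.2)) * (c2 * E (q.2 - q.1)) +
      (curved Ω g a).indicator (fun _ ↦ (1 : ℝ≥0∞)) ((2⁻¹ : ℝ) • (q.1 + q.2)) *
        G3 (q.2 - q.1) := by
    rintro ⟨x, y⟩ ⟨hx, hy, hxy⟩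
    simp only at hx hy hxy ⊢
    have hm : (2⁻¹ : ℝ) • (x + y) ∈ Ω := by
      have := H.convex hx hy (show (0 : ℝ) ≤ 2⁻¹ by norm_num) (show (0 : ℝ) ≤ 2⁻¹ by norm_num)
        (by norm_num)
      rwa [← smul_add] at this
    have hyx : ‖y - x‖ = dist x y := by rw [dist_comm, dist_eq_norm]
    by_cases hc : (2⁻¹ : ℝ) • (x + y) ∈ curved Ω g a
    · refine le_trans ?_ le_add_self
      rw [Set.indicator_of_mem hc, one_mul,
        show G3 (y - x) = c3 from Set.indicator_of_mem (by simpa [hyx] using hxy) _]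
      refine ENNReal.ofReal_le_ofReal (exp_le_exp.2 (neg_le_neg ?_))
      gcongr
      exact H.area_emptyZone_inter_ge hx hy hr (by linarith) (by linarith)
    refine le_trans ?_ le_self_add
    by_cases hd : closedBall ((2⁻¹ : ℝ) • (x + y)) a ⊆ Ω
    · refine le_trans ?_ le_self_add
      rw [Set.indicator_of_mem hm, one_mul, ← ENNReal.ofReal_mul (exp_pos _).le, ← exp_add]
      refine ENNReal.ofReal_le_ofReal (exp_le_exp.2 ?_)
      have h := area_emptyZone_inter_ge_of_closedBall_subset H.volume_eq hK hr hxy hd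
      have h2 : r * dist x y / (32 * K ^ 2) ≤ r * dist x y / (16 * K ^ 2) := by
        gcongr; norm_num
      have h3 := mul_le_mul_of_nonneg_left (h2.trans (by linarith :
        _ ≤ volume.real (Ω ∩ emptyZone r x y) - π * r ^ 2)) hν.le
      rw [hyx, hκ]
      have h4 : ν * r / (32 * K ^ 2) * dist x y = ν * (r * dist x y / (32 * K ^ 2)) := by ring
      rw [h4]
      linarith
    · refine le_trans ?_ le_add_self
      have hmB : (2⁻¹ : ℝ) • (x + y) ∈ B := subset_toMeasurable _ _ ⟨hm, hd⟩
      rw [Set.indicator_of_mem hmB, one_mul, ← ENNReal.ofReal_mul (exp_pos _).le, ← exp_add]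
      refine ENNReal.ofReal_le_ofReal (exp_le_exp.2 ?_)
      have h := area_emptyZone_inter_ge_of_notMem_pinched H.measurableSet H.volume_eq hK hr hxy hm
        fun hp ↦ hc (H.pinched_subset_curved a hp)
      have h3 := mul_le_mul_of_nonneg_left h hν.le
      rw [hyx, hκ]
      have h4 : ν * r / (32 * K ^ 2) * dist x y = ν * (r * dist x y / (32 * K ^ 2)) := by ring
      rw [h4]
      linarith
  have hmeas1 : Measurable (Ω.indicator fun _ ↦ (1 : ℝ≥0∞)) :=
    measurable_const.indicator H.measurableSet
  have hmeas2 : Measurable (B.indicator fun _ ↦ (1 : ℝ≥0∞)) := measurable_const.indicator hBm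
  have hmeas3 : Measurable ((curved Ω g a).indicator fun _ ↦ (1 : ℝ≥0∞)) :=
    measurable_const.indicator (H.measurableSet_curved a)
  refine (setLIntegral_mono' hTm hpt).trans ((setLIntegral_le_lintegral _ _).trans ?_)
  have hmid : Measurable fun q : Plane × Plane ↦ (2⁻¹ : ℝ) • (q.1 + q.2) := by fun_prop
  have hsub : Measurable fun q : Plane × Plane ↦ q.2 - q.1 := by fun_prop
  have hm3 : Measurable fun q : Plane × Plane ↦ (curved Ω g a).indicator (fun _ ↦ (1 : ℝ≥0∞))
      ((2⁻¹ : ℝ) • (q.1 + q.2)) * G3 (q.2 - q.1) := (hmeas3.comp hmid).mul (hG3.comp hsub)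
  have hm2 : Measurable fun q : Plane × Plane ↦ B.indicator (fun _ ↦ (1 : ℝ≥0∞))
      ((2⁻¹ : ℝ) • (q.1 + q.2)) * (c2 * E (q.2 - q.1)) :=
    (hmeas2.comp hmid).mul ((hE.comp hsub).const_mul c2)
  rw [lintegral_add_right _ hm3, lintegral_add_right _ hm2,
    lintegral_midpoint_mul_sub hmeas1 (hE.const_mul c1),
    lintegral_midpoint_mul_sub hmeas2 (hE.const_mul c2),
    lintegral_midpoint_mul_sub hmeas3 hG3, lintegral_const_mul _ hE, lintegral_const_mul _ hE,
    lintegral_indicator_const H.measurableSet, lintegral_indicator_const hBm,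
    lintegral_indicator_const (H.measurableSet_curved a),
    lintegral_indicator_const isClosed_closedBall.measurableSet, H.volume_eq, hB,
    measure_toMeasurable, one_mul, one_mul, one_mul, one_mul,
    ENNReal.ofReal_add (by positivity) (by positivity),
    ENNReal.ofReal_add (by positivity) (by positivity),
    ENNReal.ofReal_mul (by positivity), ENNReal.ofReal_mul (by positivity),
    ENNReal.ofReal_mul (by positivity), ENNReal.ofReal_mul (by positivity),
    ENNReal.ofReal_mul (by positivity), ← volume_real_closedBall (0 : Plane) (show 0 ≤ K * r by positivity),
    ofReal_measureReal measure_closedBall_lt_top.ne]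
  have hI := lintegral_exp_norm_le hκ0
  have hlay := H.area_layer_le ha0 (by linarith)
  have hcur := H.volume_curved_le ha0 (by linarith)
  gcongr
  refine hlay.trans_eq ?_
  congr 1
  rw [ha]; ring

end IsBody

section Asymptotics

variable {c : ℝ} {r : ℕ → ℝ}

lemma radius_sq (hc : 0 < c) (hr : ∀ n : ℕ, r n = √((log n + c) / (π * n))) {n : ℕ} (hn : 0 < n) :
    n * (π * r n ^ 2) = log n + c := by
  have h1 : (1 : ℝ) ≤ n := by exact_mod_cast hn
  have h2 := log_nonneg h1
  rw [hr, sq_sqrt (by positivity)]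
  field_simp

lemma radius_pos (hc : 0 < c) (hr : ∀ n : ℕ, r n = √((log n + c) / (π * n))) {n : ℕ}
    (hn : 0 < n) : 0 < r n := by
  have h1 : (1 : ℝ) ≤ n := by exact_mod_cast hn
  have h2 := log_nonneg h1
  rw [hr]
  positivity

lemma tendsto_radius (hr : ∀ n : ℕ, r n = √((log n + c) / (π * n))) :
    Tendsto r atTop (𝓝 0) := by
  have h1 : Tendsto (fun x : ℝ ↦ log x / x + c / x) atTop (𝓝 (0 + 0)) :=
    (isLittleO_log_id_atTop.tendsto_div_nhds_zero).add (tendsto_const_nhds.div_atTop tendsto_id)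
  have h2 := (((h1.comp tendsto_natCast_atTop_atTop).div_const π)).sqrt
  simp only [add_zero, zero_div, sqrt_zero] at h2
  refine h2.congr fun n ↦ ?_
  rw [hr]
  congr 1
  simp only [Function.comp]
  rw [← add_div, div_div, mul_comm]

lemma tendsto_mul_radius_sq (hc : 0 < c) (hr : ∀ n : ℕ, r n = √((log n + c) / (π * n))) :
    Tendsto (fun n : ℕ ↦ n * r n ^ 2) atTop atTop := by
  have h1 : Tendsto (fun n : ℕ ↦ (log n + c) / π) atTop atTop :=
    (tendsto_atTop_add_const_right _ c
      (tendsto_log_atTop.comp tendsto_natCast_atTop_atTop)).atTop_div_const pi_pos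
  refine h1.congr' ?_
  filter_upwards [eventually_gt_atTop 0] with n hn
  rw [← radius_sq hc hr hn]
  field_simp

lemma tendsto_mul_exp_radius (hc : 0 < c) (hr : ∀ n : ℕ, r n = √((log n + c) / (π * n))) (k : ℕ) :
    Tendsto (fun n : ℕ ↦ n * exp (-(((n - k : ℕ) : ℝ) * (π * r n ^ 2)))) atTop (𝓝 (exp (-c))) := by
  have h0 : Tendsto (fun n : ℕ ↦ exp (-c + k * (π * r n ^ 2))) atTop
      (𝓝 (exp (-c + k * (π * 0 ^ 2)))) :=
    (((((tendsto_radius hr).pow 2).const_mul π).const_mul (k : ℝ)).const_add (-c)).rexp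
  simp only [ne_eq, OfNat.ofNat_ne_zero, not_false_eq_true, zero_pow, mul_zero, add_zero] at h0
  refine h0.congr' ?_
  filter_upwards [eventually_gt_atTop 0, eventually_ge_atTop k] with n hn hk
  have h1 : (0 : ℝ) < n := by exact_mod_cast hn
  have h2 := radius_sq hc hr hn
  rw [Nat.cast_sub hk, show -(((n : ℝ) - k) * (π * r n ^ 2)) = -(log n) + (-c + k * (π * r n ^ 2)) by
    linarith, exp_add (-(log n)), exp_neg, exp_log h1]
  field_simp

lemma eventually_exp_radius_le (hc : 0 < c) (hr : ∀ n : ℕ, r n = √((log n + c) / (π * n)))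
    (k : ℕ) : ∀ᶠ n : ℕ in atTop,
      exp (-(((n - k : ℕ) : ℝ) * (π * r n ^ 2))) ≤ 1 / n ∧
      exp (-(((n - k : ℕ) : ℝ) * (π * r n ^ 2 / 2))) ≤ 1 / √n := by
  have h := (tendsto_mul_exp_radius hc hr k).eventually
    (gt_mem_nhds (exp_zero ▸ exp_lt_exp.2 (neg_lt_zero.2 hc) : exp (-c) < 1))
  filter_upwards [h, eventually_gt_atTop 0] with n h1 hn
  have hn' : (0 : ℝ) < n := by exact_mod_cast hn
  have h2 : exp (-(((n - k : ℕ) : ℝ) * (π * r n ^ 2))) ≤ 1 / n := by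
    rw [le_div_iff₀ hn', mul_comm]
    exact h1.le
  refine ⟨h2, ?_⟩
  rw [← sqrt_one, ← sqrt_div zero_le_one]
  refine le_sqrt_of_sq_le ?_
  refine le_trans (le_of_eq ?_) h2
  rw [← exp_nat_mul]
  congr 1
  push_cast
  ring

lemma eventually_half_le_sub (k : ℕ) : ∀ᶠ n : ℕ in atTop, (n : ℝ) / 2 ≤ ((n - k : ℕ) : ℝ) := by
  filter_upwards [eventually_ge_atTop (2 * k)] with n hn
  rw [Nat.cast_sub (by omega)]
  have : (2 * k : ℝ) ≤ n := by exact_mod_cast hn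
  linarith

lemma pairs_bound_le {N ρ K r ν α : ℝ} (hN : 0 < N) (hρ : 0 < ρ) (hK : 1 ≤ K) (hr : 0 < r)
    (hα : 0 < α) (hν : N / 2 ≤ ν) (h1 : exp (-(ν * (π * r ^ 2))) ≤ 1 / N)
    (h2 : exp (-(ν * (π * r ^ 2 / 2))) ≤ 1 / √N) :
    N ^ 2 * (exp (-(ν * (π * r ^ 2))) * (2 * π / (ν * r / (32 * K ^ 2)) ^ 2) +
        4 * K * r / ρ * (exp (-(ν * (π * r ^ 2 / 2))) * (2 * π / (ν * r / (32 * K ^ 2)) ^ 2)) +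
        256 * (2 * K * r) ^ 2 / ρ ^ 2 *
          (exp (-(ν * (α * r ^ 2))) * (π * (K * r) ^ 2))) ≤
      2 * π * (64 * K ^ 2) ^ 2 * (N * r ^ 2)⁻¹ +
      4 * K / ρ * (2 * π * (64 * K ^ 2) ^ 2) * (√(N * r ^ 2))⁻¹ +
      1024 * K ^ 4 * π / ρ ^ 2 * ((N * r ^ 2) ^ 2 * exp (-(α / 2) * (N * r ^ 2))) := by
  have hI : 2 * π / (ν * r / (32 * K ^ 2)) ^ 2 ≤ 2 * π * (64 * K ^ 2) ^ 2 / (N * r) ^ 2 := by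
    calc 2 * π / (ν * r / (32 * K ^ 2)) ^ 2 ≤ 2 * π / (N / 2 * r / (32 * K ^ 2)) ^ 2 := by gcongr
      _ = _ := by field_simp; norm_num
  have h3 : exp (-(ν * (α * r ^ 2))) ≤ exp (-(α / 2) * (N * r ^ 2)) := by
    apply exp_le_exp.2
    have := mul_le_mul_of_nonneg_right hν (show 0 ≤ α * r ^ 2 by positivity)
    linarith
  have hsN : √N ^ 2 = N := sq_sqrt hN.le
  have hsN0 : 0 < √N := sqrt_pos.2 hN
  have e1 : N ^ 2 * (exp (-(ν * (π * r ^ 2))) * (2 * π / (ν * r / (32 * K ^ 2)) ^ 2)) ≤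
      2 * π * (64 * K ^ 2) ^ 2 * (N * r ^ 2)⁻¹ := by
    calc _ ≤ N ^ 2 * (1 / N * (2 * π * (64 * K ^ 2) ^ 2 / (N * r) ^ 2)) := by gcongr
      _ = _ := by field_simp
  have e2 : N ^ 2 * (4 * K * r / ρ *
      (exp (-(ν * (π * r ^ 2 / 2))) * (2 * π / (ν * r / (32 * K ^ 2)) ^ 2))) ≤
      4 * K / ρ * (2 * π * (64 * K ^ 2) ^ 2) * (√(N * r ^ 2))⁻¹ := by
    rw [sqrt_mul hN.le, sqrt_sq hr.le]
    calc _ ≤ N ^ 2 * (4 * K * r / ρ * (1 / √N * (2 * π * (64 * K ^ 2) ^ 2 / (N * r) ^ 2))) := by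
          gcongr
      _ = _ := by field_simp
  have e3 : N ^ 2 * (256 * (2 * K * r) ^ 2 / ρ ^ 2 *
          (exp (-(ν * (α * r ^ 2))) * (π * (K * r) ^ 2))) ≤
      1024 * K ^ 4 * π / ρ ^ 2 * ((N * r ^ 2) ^ 2 * exp (-(α / 2) * (N * r ^ 2))) := by
    calc _ ≤ N ^ 2 * (256 * (2 * K * r) ^ 2 / ρ ^ 2 *
          (exp (-(α / 2) * (N * r ^ 2)) * (π * (K * r) ^ 2))) := by gcongr
      _ = _ := by ring
  linarith

lemma layer_bound_le {N ρ r ν α : ℝ} (hN : 0 < N) (hρ : 0 < ρ) (hr : 0 < r)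
    (hα : 0 < α) (hν : N / 2 ≤ ν) (h2 : exp (-(ν * (π * r ^ 2 / 2))) ≤ 1 / √N) :
    N * (256 * r ^ 2 / ρ ^ 2 * exp (-(ν * (α * r ^ 2))) +
        exp (-(ν * (π * r ^ 2 / 2))) *
          (2 * r / ρ * exp (-(ν * (r ^ 2 / 2))) + 2 / (ν * r * ρ / 2))) ≤
      256 / ρ ^ 2 * ((N * r ^ 2) ^ 1 * exp (-(α / 2) * (N * r ^ 2))) +
      2 / ρ * ((√(N * r ^ 2)) ^ 1 * exp (-(1 / 4) * (√(N * r ^ 2)) ^ 2)) +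
      8 / ρ * (√(N * r ^ 2))⁻¹ := by
  have h3 : ∀ β : ℝ, 0 < β → exp (-(ν * (β * r ^ 2))) ≤ exp (-(β / 2) * (N * r ^ 2)) := fun β hβ ↦ by
    apply exp_le_exp.2
    have := mul_le_mul_of_nonneg_right hν (show 0 ≤ β * r ^ 2 by positivity)
    linarith
  have h4 := h3 (1 / 2) (by norm_num)
  rw [show 1 / 2 * r ^ 2 = r ^ 2 / 2 by ring, show (1 / 2 / 2 : ℝ) = 1 / 4 by norm_num] at h4
  have hsN : √N ^ 2 = N := sq_sqrt hN.le
  have hsN0 : 0 < √N := sqrt_pos.2 hN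
  rw [sq_sqrt (by positivity), sqrt_mul hN.le, sqrt_sq hr.le]
  have e1 : N * (256 * r ^ 2 / ρ ^ 2 * exp (-(ν * (α * r ^ 2)))) ≤
      256 / ρ ^ 2 * ((N * r ^ 2) ^ 1 * exp (-(α / 2) * (N * r ^ 2))) := by
    calc _ ≤ N * (256 * r ^ 2 / ρ ^ 2 * exp (-(α / 2) * (N * r ^ 2))) := by
          gcongr; exact exp_le_exp.1 (h3 α hα)
      _ = _ := by ring
  have e2 : N * (exp (-(ν * (π * r ^ 2 / 2))) * (2 * r / ρ * exp (-(ν * (r ^ 2 / 2))))) ≤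
      2 / ρ * ((√N * r) ^ 1 * exp (-(1 / 4) * (N * r ^ 2))) := by
    calc _ ≤ N * (1 / √N * (2 * r / ρ * exp (-(1 / 4) * (N * r ^ 2)))) := by gcongr
      _ = √N ^ 2 * (1 / √N * (2 * r / ρ * exp (-(1 / 4) * (N * r ^ 2)))) := by rw [hsN]
      _ = _ := by field_simp
  have hν0 : 0 < ν := by linarith
  have e3 : N * (exp (-(ν * (π * r ^ 2 / 2))) * (2 / (ν * r * ρ / 2))) ≤ 8 / ρ * (√N * r)⁻¹ := by
    calc _ ≤ N * (1 / √N * (2 / (N / 2 * r * ρ / 2))) := by gcongr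
      _ = _ := by field_simp; norm_num
  linarith

lemma tendsto_pow_mul_exp_neg {ι : Type*} {l : Filter ι} {s : ι → ℝ} (hs : Tendsto s l atTop)
    (k : ℕ) {δ : ℝ} (hδ : 0 < δ) : Tendsto (fun i ↦ s i ^ k * exp (-δ * s i)) l (𝓝 0) := by
  have h := tendsto_rpow_mul_exp_neg_mul_atTop_nhds_zero k δ hδ
  simp only [rpow_natCast] at h
  exact h.comp hs

lemma tendsto_pairs_bound (hc : 0 < c) (hr : ∀ n : ℕ, r n = √((log n + c) / (π * n)))
    {ρ K α : ℝ} (hρ : 0 < ρ) (hK : 1 ≤ K) (hα : 0 < α) (k : ℕ) :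
    Tendsto (fun n : ℕ ↦ (n : ℝ) ^ 2 * (exp (-(((n - k : ℕ) : ℝ) * (π * r n ^ 2))) *
          (2 * π / (((n - k : ℕ) : ℝ) * r n / (32 * K ^ 2)) ^ 2) +
        4 * K * r n / ρ * (exp (-(((n - k : ℕ) : ℝ) * (π * r n ^ 2 / 2))) *
          (2 * π / (((n - k : ℕ) : ℝ) * r n / (32 * K ^ 2)) ^ 2)) +
        256 * (2 * K * r n) ^ 2 / ρ ^ 2 *
          (exp (-(((n - k : ℕ) : ℝ) * (α * r n ^ 2))) * (π * (K * r n) ^ 2)))) atTop (𝓝 0) := by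
  have hs := tendsto_mul_radius_sq hc hr
  have hlim := (((tendsto_inv_atTop_zero.comp hs).const_mul (2 * π * (64 * K ^ 2) ^ 2)).add
    ((tendsto_inv_atTop_zero.comp (tendsto_sqrt_atTop.comp hs)).const_mul
      (4 * K / ρ * (2 * π * (64 * K ^ 2) ^ 2)))).add
    ((tendsto_pow_mul_exp_neg hs 2 (half_pos hα)).const_mul (1024 * K ^ 4 * π / ρ ^ 2))
  simp only [mul_zero, add_zero] at hlim
  refine tendsto_of_tendsto_of_tendsto_of_le_of_le' tendsto_const_nhds hlim ?_ ?_
  · filter_upwards [eventually_gt_atTop 0] with n hn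
    have := radius_pos hc hr hn
    positivity
  · filter_upwards [eventually_gt_atTop 0, eventually_exp_radius_le hc hr k,
      eventually_half_le_sub k] with n hn h1 h2
    exact pairs_bound_le (by exact_mod_cast hn) hρ hK (radius_pos hc hr hn) hα h2 h1.1 h1.2

lemma tendsto_layer_bound (hc : 0 < c) (hr : ∀ n : ℕ, r n = √((log n + c) / (π * n)))
    {ρ α : ℝ} (hρ : 0 < ρ) (hα : 0 < α) (k : ℕ) :
    Tendsto (fun n : ℕ ↦ (n : ℝ) * (256 * r n ^ 2 / ρ ^ 2 *
          exp (-(((n - k : ℕ) : ℝ) * (α * r n ^ 2))) +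
        exp (-(((n - k : ℕ) : ℝ) * (π * r n ^ 2 / 2))) *
          (2 * r n / ρ * exp (-(((n - k : ℕ) : ℝ) * (r n ^ 2 / 2))) +
            2 / (((n - k : ℕ) : ℝ) * r n * ρ / 2)))) atTop (𝓝 0) := by
  have hs := tendsto_mul_radius_sq hc hr
  have hq := tendsto_sqrt_atTop.comp hs
  have h4 : Tendsto (fun n : ℕ ↦ √(n * r n ^ 2) ^ 1 * exp (-(1 / 4) * √(n * r n ^ 2) ^ 2))
      atTop (𝓝 0) := by
    refine tendsto_of_tendsto_of_tendsto_of_le_of_le' tendsto_const_nhds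
      (tendsto_pow_mul_exp_neg hq 1 (show (0 : ℝ) < 1 / 4 by norm_num))
      (Eventually.of_forall fun n ↦ by positivity) ?_
    filter_upwards [hq.eventually_ge_atTop 1] with n hn
    simp only [Function.comp] at hn ⊢
    gcongr ?_ * exp ?_
    nlinarith
  have hlim := (((tendsto_pow_mul_exp_neg hs 1 (half_pos hα)).const_mul (256 / ρ ^ 2)).add
    (h4.const_mul (2 / ρ))).add ((tendsto_inv_atTop_zero.comp hq).const_mul (8 / ρ))
  simp only [mul_zero, add_zero] at hlim
  refine tendsto_of_tendsto_of_tendsto_of_le_of_le' tendsto_const_nhds hlim ?_ ?_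
  · filter_upwards [eventually_gt_atTop 0] with n hn
    have := radius_pos hc hr hn
    positivity
  · filter_upwards [eventually_gt_atTop 0, eventually_exp_radius_le hc hr k,
      eventually_half_le_sub k] with n hn h1 h2
    exact layer_bound_le (by exact_mod_cast hn) hρ (radius_pos hc hr hn) hα h2 h1.2

end Asymptotics

lemma isClosed_setOf_closedBall_subset {Ω : Set Plane} (hΩ : IsClosed Ω) (a : ℝ) :
    IsClosed {x | closedBall x a ⊆ Ω} := by
  have : {x | closedBall x a ⊆ Ω} = ⋂ v ∈ closedBall (0 : Plane) a, {x | x + v ∈ Ω} := by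
    ext x
    simp only [Set.mem_ofPred_eq, Set.mem_iInter, mem_closedBall_zero_iff]
    refine ⟨fun h v hv ↦ h (by simpa using hv), fun h z hz ↦ ?_⟩
    have := h (z - x) (by simpa [dist_eq_norm] using hz)
    simpa using this
  rw [this]
  exact isClosed_biInter fun v _ ↦ hΩ.preimage (by fun_prop)

lemma tendsto_zero_of_le_ofReal {f : ℕ → ℝ≥0∞} {b : ℕ → ℝ} (hb : Tendsto b atTop (𝓝 0))
    (h : ∀ᶠ n in atTop, f n ≤ ENNReal.ofReal (b n)) : Tendsto f atTop (𝓝 0) := by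
  have := ENNReal.tendsto_ofReal hb
  rw [ENNReal.ofReal_zero] at this
  exact tendsto_of_tendsto_of_tendsto_of_le_of_le' tendsto_const_nhds this
    (Eventually.of_forall fun _ ↦ zero_le) h

lemma restrict_real_apply {Ω S : Set Plane} (hS : MeasurableSet S) :
    (volume.restrict Ω).real S = volume.real (Ω ∩ S) := by
  rw [measureReal_restrict_apply hS, Set.inter_comm]

lemma measurableSet_notMem_emptyZone (r : ℝ) :
    MeasurableSet {q : (Plane × Plane) × Plane | q.2 ∉ emptyZone r q.1.1 q.1.2} := by
  have h1 : Measurable fun q : (Plane × Plane) × Plane ↦ dist q.2 q.1.1 :=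
    measurable_snd.dist (measurable_fst.comp measurable_fst)
  have h2 : Measurable fun q : (Plane × Plane) × Plane ↦ dist q.2 q.1.2 :=
    measurable_snd.dist (measurable_snd.comp measurable_fst)
  have h3 : Measurable fun q : (Plane × Plane) × Plane ↦ dist q.1.1 q.1.2 :=
    (measurable_fst.comp measurable_fst).dist (measurable_snd.comp measurable_fst)
  have h4 : Measurable fun q : (Plane × Plane) × Plane ↦ dist q.1.1 q.2 :=
    (measurable_fst.comp measurable_fst).dist measurable_snd
  exact (((measurableSet_le h1 measurable_const).inter (measurableSet_lt h3 h2)).union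
    ((measurableSet_le h2 measurable_const).inter (measurableSet_lt h3 h1))).compl

namespace IsBody

variable {Ω : Set Plane} {o : Plane} {ρ R : ℝ} {g : Plane → ℝ} (H : IsBody Ω o ρ R g)

include H

lemma isProbabilityMeasure : IsProbabilityMeasure (volume.restrict Ω) :=
  ⟨by rw [Measure.restrict_apply_univ, H.volume_eq]⟩

/-- With high probability there is no close pair with an empty zone. -/
lemma tendsto_measure_pairs {c : ℝ} {r : ℕ → ℝ} (hc : 0 < c)
    (hr : ∀ n : ℕ, r n = √((log n + c) / (π * n))) {K : ℝ} (hK : 1 ≤ K) :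
    Tendsto (fun n : ℕ ↦ (Measure.pi fun _ : Fin n ↦ volume.restrict Ω)
      {X | ∃ i j, i ≠ j ∧ dist (X i) (X j) ≤ K * r n ∧
        ∀ l, l ≠ i → l ≠ j → X l ∉ emptyZone (r n) (X i) (X j)}) atTop (𝓝 0) := by
  have hρ := H.pos
  have hR := hρ.trans_le H.le
  have := H.isProbabilityMeasure
  refine tendsto_zero_of_le_ofReal (tendsto_pairs_bound hc hr hρ hK
    (show 0 < π * (ρ / (8 * R)) ^ 2 by positivity) 2) ?_
  have hr0 : Tendsto (fun n ↦ 4 * K * r n) atTop (𝓝 (4 * K * 0)) :=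
    (tendsto_radius hr).const_mul (4 * K)
  rw [mul_zero] at hr0
  filter_upwards [eventually_gt_atTop 2, hr0.eventually (gt_mem_nhds hρ)] with n hn hrn
  have hrpos := radius_pos hc hr (n := n) (by omega)
  have hν : (0 : ℝ) < ((n - 2 : ℕ) : ℝ) := by
    have : 0 < n - 2 := by omega
    exact_mod_cast this
  have hT : MeasurableSet {q : Plane × Plane | dist q.1 q.2 ≤ K * r n} :=
    measurableSet_le (measurable_fst.dist measurable_snd) measurable_const
  have hA : MeasurableSet {q : (Plane × Plane) × Plane | q.2 ∉ emptyZone (r n) q.1.1 q.1.2} :=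
    measurableSet_notMem_emptyZone (r n)
  refine (measure_exists_pair_le n hT hA).trans ?_
  rw [ENNReal.ofReal_mul (by positivity), ENNReal.ofReal_pow (by positivity), ENNReal.ofReal_natCast]
  gcongr
  refine le_trans ?_ (H.lintegral_pairs_le hK hrpos hrn.le hν)
  rw [Measure.prod_restrict, Measure.restrict_restrict hT]
  have hset : {q : Plane × Plane | dist q.1 q.2 ≤ K * r n} ∩ Ω ×ˢ Ω =
      {q : Plane × Plane | q.1 ∈ Ω ∧ q.2 ∈ Ω ∧ dist q.1 q.2 ≤ K * r n} := by
    ext q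
    simp only [Set.mem_inter_iff, Set.mem_prod, Set.mem_ofPred_eq]
    tauto
  rw [hset, ← Measure.volume_eq_prod]
  refine lintegral_mono fun q ↦ ?_
  have hq := measurableSet_emptyZone (r n) q.1 q.2
  have h := measure_compl_pow_le (μ := volume.restrict Ω) hq (restrict_real_apply hq).ge (n - 2)
  exact h

/-- With high probability no point close to the boundary is isolated. -/
lemma tendsto_measure_layer {c : ℝ} {r : ℕ → ℝ} (hc : 0 < c)
    (hr : ∀ n : ℕ, r n = √((log n + c) / (π * n))) :
    Tendsto (fun n : ℕ ↦ (Measure.pi fun _ : Fin n ↦ volume.restrict Ω)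
      {X | ∃ i, ¬ closedBall (X i) (r n) ⊆ Ω ∧ ∀ j, j ≠ i → r n < dist (X i) (X j)})
      atTop (𝓝 0) := by
  have hρ := H.pos
  have hR := hρ.trans_le H.le
  have := H.isProbabilityMeasure
  refine tendsto_zero_of_le_ofReal (tendsto_layer_bound hc hr hρ
    (show 0 < π * (ρ / (2 * R)) ^ 2 by positivity) 1) ?_
  have hr0 : Tendsto (fun n ↦ 2 * r n) atTop (𝓝 (2 * 0)) := (tendsto_radius hr).const_mul 2
  rw [mul_zero] at hr0
  filter_upwards [eventually_gt_atTop 1, hr0.eventually (gt_mem_nhds hρ)] with n hn hrn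
  have hrpos := radius_pos hc hr (n := n) (by omega)
  have hν : (0 : ℝ) < ((n - 1 : ℕ) : ℝ) := by
    have : 0 < n - 1 := by omega
    exact_mod_cast this
  have hT : MeasurableSet {x : Plane | ¬ closedBall x (r n) ⊆ Ω} :=
    (isClosed_setOf_closedBall_subset H.isCompact.isClosed _).measurableSet.compl
  have hA : MeasurableSet {q : Plane × Plane | r n < dist q.1 q.2} :=
    measurableSet_lt measurable_const (measurable_fst.dist measurable_snd)
  refine (measure_exists_point_le n hT hA).trans ?_
  rw [ENNReal.ofReal_mul (by positivity), ENNReal.ofReal_natCast]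
  gcongr
  refine le_trans ?_ (H.lintegral_layer_le hrpos hrn.le hν)
  rw [Measure.restrict_restrict hT, Set.inter_comm]
  refine lintegral_mono fun x ↦ ?_
  have hset : {z | (x, z) ∈ {q : Plane × Plane | r n < dist q.1 q.2}} = (closedBall x (r n))ᶜ := by
    ext z
    simp [dist_comm x z]
  rw [hset]
  refine measure_compl_pow_le isClosed_closedBall.measurableSet ?_ (n - 1)
  rw [restrict_real_apply isClosed_closedBall.measurableSet]

end IsBody

section Clusters

variable {ι : Type*} {r : ℝ} {x : ι → Plane}

lemma volume_real_biUnion_closedBall (hr : 0 ≤ r) {S : Finset ι}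
    (hS : (S : Set ι).Pairwise fun i j ↦ 2 * r < dist (x i) (x j)) :
    volume.real (⋃ i ∈ S, closedBall (x i) r) = S.card * (π * r ^ 2) := by
  rw [measureReal_biUnion_finset (fun i hi j hj hij ↦ closedBall_disjoint_closedBall
    (by linarith [hS hi hj hij])) (fun _ _ ↦ isClosed_closedBall.measurableSet)
    (fun _ _ ↦ measure_closedBall_lt_top.ne)]
  simp [volume_real_closedBall _ hr]

/-- An `r`-separated configuration which is not `2 * r`-separated covers more area than a suitable
`2 * r`-separated subconfiguration which comes close to all its points. -/
lemma exists_separated_subset [Finite ι] (hr : 0 < r)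
    (hsep : Pairwise fun i j ↦ r < dist (x i) (x j))
    (hbad : ¬ Pairwise fun i j ↦ 2 * r < dist (x i) (x j)) :
    ∃ (S : Finset ι) (f : ι → ι), (∃ i, i ∉ S) ∧ (∀ i, f i ∈ S ∧ dist (x i) (x (f i)) ≤ 4 * r) ∧
      S.card * (π * r ^ 2) + π * r ^ 2 / 100 ≤ volume.real (⋃ i, closedBall (x i) r) := by
  classical
  have := Fintype.ofFinite ι
  let near : ι → Prop := fun i ↦ ∃ l, l ≠ i ∧ dist (x i) (x l) ≤ 2 * r
  have hne : (Finset.univ.filter near).Nonempty := by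
    simp only [Pairwise, not_forall, not_lt] at hbad
    obtain ⟨i, l, hil, h⟩ := hbad
    exact ⟨i, by simpa using ⟨l, hil.symm, h⟩⟩
  obtain ⟨j, hj, hmax⟩ := Finset.exists_max_image _ (fun i ↦ x i 0) hne
  obtain ⟨i₀, hi₀, hji₀⟩ : near j := by simpa using hj
  let F : Finset (Finset ι) := (Finset.univ.erase j).powerset.filter fun S ↦
    (S : Set ι).Pairwise fun i l ↦ 2 * r < dist (x i) (x l)
  obtain ⟨S, hSF⟩ := F.exists_maximal ⟨∅, by simp [F]⟩
  have hS := hSF.1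
  simp only [F, Finset.mem_filter, Finset.mem_powerset] at hS
  obtain ⟨hSj, hSsep⟩ := hS
  have hjS : j ∉ S := fun h ↦ by simpa using hSj h
  have hclose : ∀ i, i ≠ j → ∃ s ∈ S, dist (x i) (x s) ≤ 2 * r := fun i hi ↦ by
    by_contra! hcon
    have hiS : i ∉ S := fun h ↦ by
      have := hcon i h
      rw [dist_self] at this
      linarith
    have hins : insert i S ∈ F := by
      simp only [F, Finset.mem_filter, Finset.mem_powerset]
      refine ⟨Finset.insert_subset (by simpa using hi) hSj, ?_⟩
      rw [Finset.coe_insert]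
      refine hSsep.insert fun s hs _ ↦ ⟨hcon s hs, ?_⟩
      rw [dist_comm]
      exact hcon s hs
    exact hiS (hSF.2 hins (Finset.subset_insert i S) (Finset.mem_insert_self i S))
  have hclose' : ∀ i, ∃ s ∈ S, dist (x i) (x s) ≤ 4 * r := fun i ↦ by
    by_cases hi : i = j
    · obtain ⟨s, hs, h⟩ := hclose i₀ hi₀
      refine ⟨s, hs, (dist_triangle _ (x i₀) _).trans ?_⟩
      rw [hi]
      linarith
    · obtain ⟨s, hs, h⟩ := hclose i hi
      exact ⟨s, hs, by linarith⟩
  choose f hfS hf using hclose'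
  refine ⟨S, f, ⟨j, hjS⟩, fun i ↦ ⟨hfS i, hf i⟩, ?_⟩
  set p : Plane := x j + (r / 2) • EuclideanSpace.single 0 1 with hp
  have hpj : dist p (x j) = r / 2 := by
    rw [hp, dist_eq_norm, add_sub_cancel_left, norm_smul, PiLp.norm_single, norm_one, mul_one,
      norm_eq_abs, abs_of_pos (by positivity)]
  have hsub : closedBall p (r / 10) ⊆ closedBall (x j) r :=
    closedBall_subset_closedBall' (by rw [hpj]; linarith)
  have hdisj : Disjoint (⋃ i ∈ S, closedBall (x i) r) (closedBall p (r / 10)) := by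
    rw [Set.disjoint_iUnion₂_left]
    intro s hs
    apply closedBall_disjoint_closedBall
    have hsj : s ≠ j := fun h ↦ hjS (h ▸ hs)
    by_contra! hcon
    have h1 : dist (x s) (x j) ≤ 2 * r := by
      refine (dist_triangle _ p _).trans ?_
      rw [hpj]
      linarith
    have h2 : x s 0 ≤ x j 0 := hmax s (by
      simp only [Finset.mem_filter, Finset.mem_univ, true_and]
      exact ⟨j, hsj.symm, h1⟩)
    have h3 : r < dist (x j) (x s) := hsep hsj.symm
    rw [dist_eq_norm] at h3 hcon
    have h4 := norm_sq_eq (x j - x s)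
    have h5 := norm_sq_eq (x s - p)
    simp only [hp, PiLp.sub_apply, PiLp.add_apply, PiLp.smul_apply, PiLp.single_apply,
      smul_eq_mul] at h4 h5
    norm_num at h5
    have h6 : r ^ 2 < ‖x j - x s‖ ^ 2 := by gcongr
    have h7 : ‖x s - p‖ ^ 2 ≤ (r + r / 10) ^ 2 := by gcongr
    rw [← hp] at h5
    nlinarith
  have hfin : volume (⋃ i, closedBall (x i) r) ≠ ∞ :=
    ((isCompact_iUnion fun i ↦ isCompact_closedBall _ _).measure_lt_top).ne
  calc S.card * (π * r ^ 2) + π * r ^ 2 / 100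
      = volume.real (⋃ i ∈ S, closedBall (x i) r) + volume.real (closedBall p (r / 10)) := by
        rw [volume_real_biUnion_closedBall hr.le hSsep, volume_real_closedBall _ (by positivity)]
        ring
    _ = volume.real ((⋃ i ∈ S, closedBall (x i) r) ∪ closedBall p (r / 10)) :=
        (measureReal_union hdisj isClosed_closedBall.measurableSet
          (ne_top_of_le_ne_top hfin (measure_mono (Set.iUnion₂_subset_iUnion _ _)))
          measure_closedBall_lt_top.ne).symm
    _ ≤ _ := measureReal_mono (Set.union_subset (Set.iUnion₂_subset_iUnion _ _)
        (hsub.trans (Set.subset_iUnion (fun i ↦ closedBall (x i) r) j))) hfin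

/-- The probability that all points are close to prescribed points of a subconfiguration. -/
lemma measure_pi_close_le [Fintype ι] {μ : Measure Plane} [IsProbabilityMeasure μ]
    (hμ : μ ≤ volume) {a : ℝ} (ha : 0 ≤ a) {S : Finset ι} {f : ι → ι} (hf : ∀ i, f i ∈ S) :
    (Measure.pi fun _ : ι ↦ μ) {x | ∀ i, dist (x i) (x (f i)) ≤ a} ≤
      ENNReal.ofReal ((π * a ^ 2) ^ (Fintype.card ι - S.card)) := by
  classical
  let E : Set (({i // i ∈ S} → Plane) × ({i // i ∉ S} → Plane)) :=
    {q | ∀ i, dist (q.2 i) (q.1 ⟨f i, hf i⟩) ≤ a}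
  have hE : MeasurableSet E := by
    have : E = ⋂ i, {q | dist (q.2 i) (q.1 ⟨f i, hf i⟩) ≤ a} := by
      ext q; simp [E]
    rw [this]
    exact MeasurableSet.iInter fun i ↦ measurableSet_le
      (((measurable_pi_apply i).comp measurable_snd).dist
        ((measurable_pi_apply _).comp measurable_fst)) measurable_const
  have hmp := measurePreserving_piEquivPiSubtypeProd (fun _ : ι ↦ μ) (· ∈ S)
  have hsub : {x : ι → Plane | ∀ i, dist (x i) (x (f i)) ≤ a} ⊆
      MeasurableEquiv.piEquivPiSubtypeProd (fun _ : ι ↦ Plane) (· ∈ S) ⁻¹' E :=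
    fun x hx i ↦ hx i
  refine (measure_mono hsub).trans ?_
  rw [hmp.measure_preimage hE.nullMeasurableSet, Measure.prod_apply hE]
  have hcard : Fintype.card {i // i ∉ S} = Fintype.card ι - S.card := by
    rw [Fintype.card_subtype_compl, Fintype.card_coe]
  have hsec : ∀ y : {i // i ∈ S} → Plane,
      (Measure.pi fun _ : {i // i ∉ S} ↦ μ) (Prod.mk y ⁻¹' E) ≤
        ENNReal.ofReal ((π * a ^ 2) ^ (Fintype.card ι - S.card)) := fun y ↦ by
    have : Prod.mk y ⁻¹' E = Set.univ.pi fun i : {i // i ∉ S} ↦ closedBall (y ⟨f i, hf i⟩) a := by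
      ext q; simp [E]
    rw [this, Measure.pi_pi, ENNReal.ofReal_pow (by positivity), ← hcard, ← Finset.card_univ,
      ← Finset.prod_const]
    refine Finset.prod_le_prod' fun i _ ↦ (hμ _).trans_eq ?_
    rw [← volume_real_closedBall (y ⟨f i, hf i⟩) ha, ofReal_measureReal
      measure_closedBall_lt_top.ne]
  refine (lintegral_mono hsec).trans_eq ?_
  simp

end Clusters

/-- The `r`-separated configurations of `k` points whose `r`-balls are contained in `Ω`. -/
def separated (Ω : Set Plane) (r : ℝ) (k : ℕ) : Set (Fin k → Plane) :=
  {x | (∀ i, closedBall (x i) r ⊆ Ω) ∧ Pairwise fun i j ↦ r < dist (x i) (x j)}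

lemma measurableSet_separated {Ω : Set Plane} (hΩ : IsClosed Ω) (r : ℝ) (k : ℕ) :
    MeasurableSet (separated Ω r k) := by
  have : separated Ω r k = (⋂ i, (fun x : Fin k → Plane ↦ x i) ⁻¹' {y | closedBall y r ⊆ Ω}) ∩
      ⋂ i, ⋂ j, ⋂ (_ : i ≠ j), {x : Fin k → Plane | r < dist (x i) (x j)} := by
    ext x
    simp [separated, Pairwise]
  rw [this]
  refine (MeasurableSet.iInter fun i ↦ measurable_pi_apply i
    (isClosed_setOf_closedBall_subset hΩ r).measurableSet).inter
    (MeasurableSet.iInter fun i ↦ MeasurableSet.iInter fun j ↦ MeasurableSet.iInter fun _ ↦ ?_)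
  exact measurableSet_lt measurable_const ((measurable_pi_apply i).dist (measurable_pi_apply j))

lemma setOf_forall_lt_dist_eq {k : ℕ} (x : Fin k → Plane) (r : ℝ) :
    {z | ∀ i, r < dist (x i) z} = (⋃ i, closedBall (x i) r)ᶜ := by
  ext z
  simp [dist_comm]

lemma measurableSet_iUnion_closedBall {k : ℕ} (x : Fin k → Plane) (r : ℝ) :
    MeasurableSet (⋃ i, closedBall (x i) r) :=
  MeasurableSet.iUnion fun _ ↦ isClosed_closedBall.measurableSet

lemma restrict_real_iUnion_closedBall {Ω : Set Plane} {r : ℝ} {k : ℕ} {x : Fin k → Plane}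
    (hx : x ∈ separated Ω r k) :
    (volume.restrict Ω).real (⋃ i, closedBall (x i) r) = volume.real (⋃ i, closedBall (x i) r) := by
  rw [restrict_real_apply (measurableSet_iUnion_closedBall x r),
    Set.inter_eq_right.2 (Set.iUnion_subset hx.1)]

/-- The probability that `k` given points among `k + m` are deep and isolated. -/
noncomputable def isolatedProb (Ω : Set Plane) (r : ℝ) (k m : ℕ) : ℝ≥0∞ :=
  ∫⁻ x in separated Ω r k, volume.restrict Ω {z | ∀ i, r < dist (x i) z} ^ m
    ∂(Measure.pi fun _ : Fin k ↦ volume.restrict Ω)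

/-- The upper bound for `isolatedProb` coming from configurations that are not `2 * r`-separated. -/
noncomputable def clusterBound (r : ℝ) (k m : ℕ) : ℝ :=
  ∑ q : Finset (Fin k) × (Fin k → Fin k) with ∀ i, q.2 i ∈ q.1,
    exp (-(m * (q.1.card * (π * r ^ 2) + π * r ^ 2 / 100))) * (π * (4 * r) ^ 2) ^ (k - q.1.card)

namespace IsBody

variable {Ω : Set Plane} {o : Plane} {ρ R : ℝ} {g : Plane → ℝ} (H : IsBody Ω o ρ R g)

include H

lemma isolatedProb_le {r : ℝ} (hr : 0 < r) (k m : ℕ) :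
    isolatedProb Ω r k m ≤
      ENNReal.ofReal (exp (-(m * (π * r ^ 2))) ^ k + clusterBound r k m) := by
  classical
  have := H.isProbabilityMeasure
  set P := Measure.pi fun _ : Fin k ↦ volume.restrict Ω
  have hTm := measurableSet_separated H.isCompact.isClosed r k
  let Q : Finset (Finset (Fin k) × (Fin k → Fin k)) := {q | ∀ i, q.2 i ∈ q.1}
  let E : (Fin k → Fin k) → Set (Fin k → Plane) := fun f ↦ {x | ∀ i, dist (x i) (x (f i)) ≤ 4 * r}
  have hE : ∀ f, MeasurableSet (E f) := fun f ↦ by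
    have : E f = ⋂ i, {x | dist (x i) (x (f i)) ≤ 4 * r} := by ext x; simp [E]
    rw [this]
    exact MeasurableSet.iInter fun i ↦ measurableSet_le
      ((measurable_pi_apply i).dist (measurable_pi_apply _)) measurable_const
  let b : Finset (Fin k) → ℝ := fun S ↦ exp (-(m * (S.card * (π * r ^ 2) + π * r ^ 2 / 100)))
  have hpt : ∀ x ∈ separated Ω r k, volume.restrict Ω {z | ∀ i, r < dist (x i) z} ^ m ≤
      ENNReal.ofReal (exp (-(m * (π * r ^ 2))) ^ k) +
        ∑ q ∈ Q, (E q.2).indicator (fun _ ↦ ENNReal.ofReal (b q.1)) x := fun x hx ↦ by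
    rw [setOf_forall_lt_dist_eq]
    have hU := restrict_real_iUnion_closedBall hx
    by_cases hfar : Pairwise fun i j ↦ 2 * r < dist (x i) (x j)
    · refine le_trans ?_ le_self_add
      have h := volume_real_biUnion_closedBall (S := Finset.univ) hr.le
        (by simpa [Set.pairwise_univ] using hfar)
      simp only [Finset.mem_univ, Set.iUnion_true, Finset.card_univ, Fintype.card_fin] at h
      refine (measure_compl_pow_le (measurableSet_iUnion_closedBall x r)
        (hU.trans h).ge m).trans_eq ?_
      rw [← exp_nat_mul]
      congr 2
      ring
    · refine le_trans ?_ le_add_self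
      obtain ⟨S, f, -, hf, hS⟩ := exists_separated_subset hr hx.2 hfar
      have hmem : (S, f) ∈ Q := by simpa [Q] using fun i ↦ (hf i).1
      refine le_trans ?_ (Finset.single_le_sum (f := fun q : Finset (Fin k) × (Fin k → Fin k) ↦
        (E q.2).indicator (fun _ ↦ ENNReal.ofReal (b q.1)) x) (fun _ _ ↦ zero_le) hmem)
      simp only
      rw [Set.indicator_of_mem (show x ∈ E f from fun i ↦ (hf i).2)]
      exact measure_compl_pow_le (measurableSet_iUnion_closedBall x r) (hS.trans hU.ge) m
  refine (setLIntegral_mono' hTm hpt).trans ((setLIntegral_le_lintegral _ _).trans ?_)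
  rw [lintegral_add_left measurable_const, lintegral_const, measure_univ, mul_one, clusterBound,
    ENNReal.ofReal_add (by positivity) (Finset.sum_nonneg fun _ _ ↦ by positivity),
    lintegral_finsetSum _ fun q _ ↦ measurable_const.indicator (hE q.2),
    ENNReal.ofReal_sum_of_nonneg fun _ _ ↦ by positivity]
  gcongr with q hq
  rw [lintegral_indicator_const (hE _), ENNReal.ofReal_mul (by positivity)]
  gcongr
  have := measure_pi_close_le (μ := volume.restrict Ω) Measure.restrict_le_self
    (show 0 ≤ 4 * r by positivity) (S := q.1) (f := q.2) (by simpa [Q] using hq)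
  simpa using this

lemma measure_separated_ge {r : ℝ} (hr : 0 < r) (hrρ : r ≤ ρ) (k : ℕ) :
    1 - (k * (2 * r / ρ) + k ^ 2 * (π * r ^ 2)) ≤
      (Measure.pi fun _ : Fin k ↦ volume.restrict Ω).real (separated Ω r k) := by
  classical
  have := H.isProbabilityMeasure
  have hρ := H.pos
  set P := Measure.pi fun _ : Fin k ↦ volume.restrict Ω with hP
  have hTm := measurableSet_separated H.isCompact.isClosed r k
  have hcompl := probReal_compl_eq_one_sub (μ := P) hTm
  suffices h : P.real (separated Ω r k)ᶜ ≤ k * (2 * r / ρ) + k ^ 2 * (π * r ^ 2) by linarith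
  have hsub : (separated Ω r k)ᶜ ⊆
      (⋃ i, (fun x : Fin k → Plane ↦ x i) ⁻¹' {y | ¬ closedBall y r ⊆ Ω}) ∪
      ⋃ q : Fin k × Fin k, {x : Fin k → Plane | q.1 ≠ q.2 ∧ dist (x q.1) (x q.2) ≤ r} := by
    intro x hx
    simp only [separated, Set.mem_compl_iff, Set.mem_ofPred_eq, not_and_or, not_forall, Pairwise,
      not_lt] at hx
    rcases hx with ⟨i, hi⟩ | ⟨i, j, hij, h⟩
    · exact Or.inl (Set.mem_iUnion.2 ⟨i, hi⟩)
    · exact Or.inr (Set.mem_iUnion.2 ⟨(i, j), hij, h⟩)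
  have h1 : ∀ i, P.real ((fun x : Fin k → Plane ↦ x i) ⁻¹' {y | ¬ closedBall y r ⊆ Ω}) ≤
      2 * r / ρ := fun i ↦ by
    have hD : MeasurableSet {y | ¬ closedBall y r ⊆ Ω} :=
      (isClosed_setOf_closedBall_subset H.isCompact.isClosed r).measurableSet.compl
    rw [measureReal_def, (measurePreserving_eval (fun _ : Fin k ↦ volume.restrict Ω)
      i).measure_preimage hD.nullMeasurableSet, Measure.restrict_apply hD, Set.inter_comm]
    exact ENNReal.toReal_le_of_le_ofReal (by positivity) (H.area_layer_le hr.le hrρ)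
  have h2 : ∀ q : Fin k × Fin k, P.real {x | q.1 ≠ q.2 ∧ dist (x q.1) (x q.2) ≤ r} ≤
      π * r ^ 2 := fun q ↦ by
    by_cases hq : q.1 = q.2
    · simp only [hq, ne_eq, not_true_eq_false, false_and, Set.ofPred_false, measureReal_empty]
      positivity
    refine ENNReal.toReal_le_of_le_ofReal (by positivity) ?_
    have hf : ∀ i, Function.update id q.1 q.2 i ∈ Finset.univ.erase q.1 := fun i ↦ by
      by_cases hi : i = q.1
      · subst hi; simpa using Ne.symm hq
      · simp [hi]
    have h := measure_pi_close_le (μ := volume.restrict Ω) Measure.restrict_le_self hr.le hf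
    have hk : 0 < k := Fin.pos q.1
    have hc : k - (k - 1) = 1 := by omega
    rw [Finset.card_erase_of_mem (Finset.mem_univ _), Finset.card_univ, Fintype.card_fin, hc,
      pow_one] at h
    refine (measure_mono fun x hx i ↦ ?_).trans h
    by_cases hi : i = q.1
    · subst hi; simpa using hx.2
    · simpa [hi] using hr.le
  calc P.real (separated Ω r k)ᶜ ≤ _ := measureReal_mono hsub
    _ ≤ _ := measureReal_union_le _ _
    _ ≤ (∑ i : Fin k, 2 * r / ρ) + ∑ q : Fin k × Fin k, π * r ^ 2 :=
      add_le_add ((measureReal_iUnion_fintype_le _).trans (Finset.sum_le_sum fun i _ ↦ h1 i))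
        ((measureReal_iUnion_fintype_le _).trans (Finset.sum_le_sum fun q _ ↦ h2 q))
    _ = _ := by simp [sq]

lemma le_isolatedProb {r : ℝ} (hr : 0 < r) (hrρ : r ≤ ρ) (k m : ℕ)
    (hk : k * (π * r ^ 2) ≤ 1) :
    ENNReal.ofReal ((1 - (k * (2 * r / ρ) + k ^ 2 * (π * r ^ 2))) *
      (1 - k * (π * r ^ 2)) ^ m) ≤ isolatedProb Ω r k m := by
  have := H.isProbabilityMeasure
  have hTm := measurableSet_separated H.isCompact.isClosed r k
  have hb : 0 ≤ 1 - k * (π * r ^ 2) := by linarith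
  calc _ ≤ ENNReal.ofReal ((Measure.pi fun _ : Fin k ↦ volume.restrict Ω).real (separated Ω r k) *
        (1 - k * (π * r ^ 2)) ^ m) :=
        ENNReal.ofReal_le_ofReal (mul_le_mul_of_nonneg_right (H.measure_separated_ge hr hrρ k)
          (by positivity))
    _ = ∫⁻ _ in separated Ω r k, ENNReal.ofReal ((1 - k * (π * r ^ 2)) ^ m)
          ∂(Measure.pi fun _ : Fin k ↦ volume.restrict Ω) := by
        rw [setLIntegral_const, ENNReal.ofReal_mul measureReal_nonneg,
          ofReal_measureReal, mul_comm]
    _ ≤ _ := by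
      refine setLIntegral_mono' hTm fun x hx ↦ ?_
      rw [setOf_forall_lt_dist_eq, ENNReal.ofReal_pow hb]
      gcongr
      rw [← ofReal_measureReal, probReal_compl_eq_one_sub (measurableSet_iUnion_closedBall x r),
        restrict_real_iUnion_closedBall hx]
      refine ENNReal.ofReal_le_ofReal (sub_le_sub_left ?_ 1)
      refine (measureReal_iUnion_fintype_le _).trans_eq ?_
      simp [volume_real_closedBall _ hr.le]

end IsBody

section Asymptotics

variable {c : ℝ} {r : ℕ → ℝ}

lemma tendsto_mul_radius_pow_four (hc : 0 < c)
    (hr : ∀ n : ℕ, r n = √((log n + c) / (π * n))) :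
    Tendsto (fun n : ℕ ↦ n * (r n ^ 2) ^ 2) atTop (𝓝 0) := by
  have h1 := (isLittleO_pow_log_id_atTop (n := 2)).tendsto_div_nhds_zero
  have h2 := isLittleO_log_id_atTop.tendsto_div_nhds_zero
  have h3 : Tendsto (fun x : ℝ ↦ c ^ 2 / x) atTop (𝓝 0) := tendsto_const_nhds.div_atTop tendsto_id
  have h := ((((h1.add (h2.const_mul (2 * c))).add h3).div_const (π ^ 2)).comp
    tendsto_natCast_atTop_atTop)
  simp only [mul_zero, add_zero, zero_div] at h
  refine h.congr' ?_
  filter_upwards [eventually_gt_atTop 0] with n hn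
  have hn' : (0 : ℝ) < n := by exact_mod_cast hn
  have h4 : r n ^ 2 = (log n + c) / (π * n) := by
    rw [← radius_sq hc hr hn]
    field_simp
  rw [h4]
  simp only [Function.comp, id]
  field_simp
  ring

lemma tendsto_pow_mul_exp_sub (hc : 0 < c) (hr : ∀ n : ℕ, r n = √((log n + c) / (π * n)))
    (p k : ℕ) {δ : ℝ} (hδ : 0 < δ) :
    Tendsto (fun n : ℕ ↦ (n * r n ^ 2) ^ p * exp (-(((n - k : ℕ) : ℝ) * (δ * r n ^ 2))))
      atTop (𝓝 0) := by
  have hs := tendsto_mul_radius_sq hc hr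
  refine tendsto_of_tendsto_of_tendsto_of_le_of_le' tendsto_const_nhds
    (tendsto_pow_mul_exp_neg hs p (half_pos hδ)) (Eventually.of_forall fun n ↦ by positivity) ?_
  filter_upwards [eventually_half_le_sub k] with n hn
  gcongr _ * exp ?_
  have := mul_le_mul_of_nonneg_right hn (show 0 ≤ δ * r n ^ 2 by positivity)
  linarith

lemma tendsto_clusterBound (hc : 0 < c) (hr : ∀ n : ℕ, r n = √((log n + c) / (π * n))) (k : ℕ) :
    Tendsto (fun n : ℕ ↦ (n : ℝ) ^ k * clusterBound (r n) k (n - k)) atTop (𝓝 0) := by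
  simp only [clusterBound, Finset.mul_sum]
  rw [← Finset.sum_const_zero (ι := Finset (Fin k) × (Fin k → Fin k))]
  refine tendsto_finsetSum _ fun q _ ↦ ?_
  have hs : q.1.card ≤ k := by simpa using Finset.card_le_univ q.1
  have h1 := ((tendsto_mul_exp_radius hc hr k).pow q.1.card).mul
    ((tendsto_pow_mul_exp_sub hc hr (k - q.1.card) k (show 0 < π / 100 by positivity)).const_mul
      ((16 * π) ^ (k - q.1.card)))
  rw [mul_zero, mul_zero] at h1
  refine h1.congr fun n ↦ ?_
  have h2 : (n : ℝ) ^ k = (n : ℝ) ^ q.1.card * (n : ℝ) ^ (k - q.1.card) := by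
    rw [← pow_add, Nat.add_sub_cancel' hs]
  rw [h2, mul_pow, ← exp_nat_mul, show -(((n - k : ℕ) : ℝ) * (q.1.card * (π * r n ^ 2) +
    π * r n ^ 2 / 100)) = q.1.card * -(((n - k : ℕ) : ℝ) * (π * r n ^ 2)) +
    -(((n - k : ℕ) : ℝ) * (π / 100 * r n ^ 2)) by ring, exp_add, mul_pow (n : ℝ),
    show π * (4 * r n) ^ 2 = 16 * π * r n ^ 2 by ring, mul_pow (16 * π) (r n ^ 2)]
  ring

lemma exp_neg_div_le_one_sub {x : ℝ} (hx : x < 1) : exp (-(x / (1 - x))) ≤ 1 - x := by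
  have h1 : 0 < 1 - x := by linarith
  have h2 := add_one_le_exp (x / (1 - x))
  rw [exp_neg, inv_le_comm₀ (exp_pos _) h1]
  refine le_trans (le_of_eq ?_) h2
  field_simp
  ring

lemma IsBody.tendsto_isolatedProb {Ω : Set Plane} {o : Plane} {ρ R : ℝ} {g : Plane → ℝ}
    (H : IsBody Ω o ρ R g) (hc : 0 < c) (hr : ∀ n : ℕ, r n = √((log n + c) / (π * n))) (k : ℕ) :
    Tendsto (fun n : ℕ ↦ (n : ℝ) ^ k * (isolatedProb Ω (r n) k (n - k)).toReal) atTop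
      (𝓝 (exp (-c) ^ k)) := by
  have hρ := H.pos
  have hr0 := tendsto_radius hr
  have hx : Tendsto (fun n ↦ k * (π * r n ^ 2)) atTop (𝓝 (k * (π * 0 ^ 2))) :=
    ((hr0.pow 2).const_mul π).const_mul (k : ℝ)
  rw [zero_pow two_ne_zero, mul_zero, mul_zero] at hx
  have hx4 := (tendsto_mul_radius_pow_four hc hr).const_mul ((k * π) ^ 2)
  rw [mul_zero] at hx4
  have hupper := ((tendsto_mul_exp_radius hc hr k).pow k).add (tendsto_clusterBound hc hr k)
  have hlower : Tendsto (fun n : ℕ ↦ (1 - (k * (2 * r n / ρ) + k * (k * (π * r n ^ 2)))) *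
      (exp (-(k * c)) * exp (-(((k * π) ^ 2 * (n * (r n ^ 2) ^ 2)) / (1 - k * (π * r n ^ 2))))))
      atTop (𝓝 ((1 - (k * (2 * 0 / ρ) + k * 0)) * (exp (-(k * c)) * exp (-(0 / (1 - 0)))))) :=
    ((((((hr0.const_mul 2).div_const ρ).const_mul (k : ℝ)).add (hx.const_mul (k : ℝ))).const_sub
      1).mul (((hx4.div (hx.const_sub 1) (by norm_num)).neg.rexp).const_mul _))
  simp only [mul_zero, zero_div, add_zero, sub_zero, neg_zero, exp_zero, one_mul, mul_one] at hlower
  rw [add_zero] at hupper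
  rw [show exp (-(k * c)) = exp (-c) ^ k by rw [← exp_nat_mul]; congr 1; ring] at hlower
  refine tendsto_of_tendsto_of_tendsto_of_le_of_le' hlower hupper ?_ ?_
  · have hP : Tendsto (fun n : ℕ ↦ k * (2 * r n / ρ) + k * (k * (π * r n ^ 2))) atTop
        (𝓝 (k * (2 * 0 / ρ) + k * 0)) :=
      (((hr0.const_mul 2).div_const ρ).const_mul (k : ℝ)).add (hx.const_mul (k : ℝ))
    simp only [mul_zero, zero_div, add_zero] at hP
    filter_upwards [eventually_gt_atTop 0, hx.eventually (gt_mem_nhds one_pos),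
      hr0.eventually (gt_mem_nhds hρ), hP.eventually (gt_mem_nhds one_pos)] with n hn hxn hrn hPn
    have hrp := radius_pos hc hr hn
    have hn' : (0 : ℝ) < n := by exact_mod_cast hn
    have h := H.le_isolatedProb hrp hrn.le k (n - k) hxn.le
    have hfin : isolatedProb Ω (r n) k (n - k) ≠ ∞ :=
      ne_top_of_le_ne_top ENNReal.ofReal_ne_top (H.isolatedProb_le hrp k (n - k))
    rw [ENNReal.ofReal_le_iff_le_toReal hfin,
      show (k : ℝ) ^ 2 * (π * r n ^ 2) = k * (k * (π * r n ^ 2)) by ring] at h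
    have hsq := radius_sq hc hr hn
    set x := (k : ℝ) * (π * r n ^ 2) with hxdef
    have hx0 : 0 ≤ x := by positivity
    have hx1 : 0 < 1 - x := by linarith
    have hpow : exp (-(n * (x / (1 - x)))) ≤ (1 - x) ^ (n - k) := by
      calc exp (-(n * (x / (1 - x)))) = exp (-(x / (1 - x))) ^ n := by
            rw [← exp_nat_mul]; congr 1; ring
        _ ≤ (1 - x) ^ n := by gcongr; exact exp_neg_div_le_one_sub hxn
        _ ≤ (1 - x) ^ (n - k) := pow_le_pow_of_le_one hx1.le (by linarith) (Nat.sub_le _ _)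
    have hnx : n * x = k * (log n + c) := by rw [← hsq, hxdef]; ring
    have hid : n * (x / (1 - x)) = k * log n + k * c +
        ((k * π) ^ 2 * (n * (r n ^ 2) ^ 2)) / (1 - x) := by
      have h1 : n * (x / (1 - x)) = n * x + n * x ^ 2 / (1 - x) := by
        field_simp
        ring
      rw [h1, hnx, hxdef]
      ring
    have hnk : (n : ℝ) ^ k * exp (-(k * log n)) = 1 := by
      rw [exp_neg, exp_nat_mul, exp_log hn']
      exact mul_inv_cancel₀ (by positivity)
    have hfac : exp (-c) ^ k * exp (-(((k * π) ^ 2 * (n * (r n ^ 2) ^ 2)) / (1 - x))) ≤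
        (n : ℝ) ^ k * (1 - x) ^ (n - k) := by
      refine le_trans (le_of_eq ?_) (mul_le_mul_of_nonneg_left hpow (by positivity))
      have hek : exp (-(k * c)) = exp (-c) ^ k := by rw [← exp_nat_mul]; congr 1; ring
      rw [hid, neg_add, neg_add, exp_add, exp_add, hek, ← mul_assoc ((n : ℝ) ^ k),
        ← mul_assoc ((n : ℝ) ^ k), hnk, one_mul]
    calc _ ≤ (1 - (k * (2 * r n / ρ) + k * x)) * ((n : ℝ) ^ k * (1 - x) ^ (n - k)) := by
          gcongr
      _ = (n : ℝ) ^ k * ((1 - (k * (2 * r n / ρ) + k * x)) * (1 - x) ^ (n - k)) := by ring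
      _ ≤ _ := by gcongr
  · filter_upwards [eventually_gt_atTop 0] with n hn
    have hrp := radius_pos hc hr hn
    have h := ENNReal.toReal_mono ENNReal.ofReal_ne_top (H.isolatedProb_le hrp k (n - k))
    have hcb : 0 ≤ clusterBound (r n) k (n - k) := Finset.sum_nonneg fun _ _ ↦ by positivity
    rw [ENNReal.toReal_ofReal (add_nonneg (by positivity) hcb)] at h
    refine (mul_le_mul_of_nonneg_left h (by positivity)).trans_eq ?_
    rw [mul_add, mul_pow]

end Asymptotics

lemma abs_ite_sub_sum_choose_le (N m : ℕ) :
    |(if N = 0 then 1 else 0) - ∑ k ∈ Finset.range (m + 1), (-1 : ℝ) ^ k * (N.choose k : ℝ)| ≤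
      N.choose m := by
  cases N with
  | zero =>
    rw [Finset.sum_range_succ']
    simp
  | succ N =>
    have h := congrArg (Int.cast : ℤ → ℝ)
      (Int.alternating_sum_range_choose_eq_choose (n := N) (m := m))
    push_cast at h
    rw [h, if_neg N.succ_ne_zero, zero_sub, abs_neg, abs_mul, abs_pow, abs_neg, abs_one, one_pow,
      one_mul, Nat.abs_cast]
    exact_mod_cast Nat.choose_le_choose m N.le_succ

lemma abs_measure_real_iInter_compl_sub_le {α ι : Type*} [MeasurableSpace α] [Fintype ι]
    (μ : Measure α) [IsProbabilityMeasure μ] {E : ι → Set α} (hE : ∀ i, MeasurableSet (E i))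
    (m : ℕ) :
    |μ.real (⋂ i, (E i)ᶜ) - ∑ k ∈ Finset.range (m + 1), (-1 : ℝ) ^ k *
      ∑ S ∈ Finset.powersetCard k Finset.univ, μ.real (⋂ i ∈ S, E i)| ≤
      ∑ S ∈ Finset.powersetCard m Finset.univ, μ.real (⋂ i ∈ S, E i) := by
  classical
  have hS (S : Finset ι) : MeasurableSet (⋂ i ∈ S, E i) :=
    Finset.measurableSet_biInter _ fun i _ ↦ hE i
  have hC : MeasurableSet (⋂ i, (E i)ᶜ) := MeasurableSet.iInter fun i ↦ (hE i).compl
  let D (x : α) : Finset ι := Finset.univ.filter fun i ↦ x ∈ E i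
  have hchoose (x : α) (k : ℕ) : ((D x).card.choose k : ℝ) =
      ∑ S ∈ Finset.powersetCard k Finset.univ, (⋂ i ∈ S, E i).indicator 1 x := by
    have h (S : Finset ι) : (⋂ i ∈ S, E i).indicator (1 : α → ℝ) x = if S ⊆ D x then 1 else 0 := by
      simp [Set.indicator_apply, D, Finset.subset_iff]
    simp only [h]
    rw [Finset.sum_boole, ← Finset.card_powersetCard]
    congr 2
    ext S
    simp [Finset.mem_powersetCard, and_comm]
  have hzero (x : α) : (if (D x).card = 0 then (1 : ℝ) else 0) =
      (⋂ i, (E i)ᶜ).indicator 1 x := by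
    simp [Set.indicator_apply, D, Finset.filter_eq_empty_iff]
  have hint (S : Finset ι) : Integrable ((⋂ i ∈ S, E i).indicator (1 : α → ℝ)) μ :=
    (integrable_const 1).indicator (hS S)
  have hsum (k : ℕ) : ∑ S ∈ Finset.powersetCard k Finset.univ, μ.real (⋂ i ∈ S, E i) =
      ∫ x, ((D x).card.choose k : ℝ) ∂μ := by
    simp only [hchoose]
    rw [integral_finsetSum _ fun S _ ↦ hint S]
    simp only [integral_indicator_one (hS _)]
  have hint' (k : ℕ) : Integrable (fun x ↦ ((D x).card.choose k : ℝ)) μ := by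
    simp only [hchoose]
    exact integrable_finsetSum _ fun S _ ↦ hint S
  have hmain : μ.real (⋂ i, (E i)ᶜ) - ∑ k ∈ Finset.range (m + 1), (-1 : ℝ) ^ k *
      ∑ S ∈ Finset.powersetCard k Finset.univ, μ.real (⋂ i ∈ S, E i) =
      ∫ x, ((if (D x).card = 0 then (1 : ℝ) else 0) -
        ∑ k ∈ Finset.range (m + 1), (-1 : ℝ) ^ k * ((D x).card.choose k : ℝ)) ∂μ := by
    rw [integral_sub, integral_finsetSum]
    · simp only [integral_const_mul, ← hsum, hzero, integral_indicator_one hC]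
    · exact fun k _ ↦ (hint' k).const_mul _
    · simp only [hzero]
      exact (integrable_const 1).indicator hC
    · exact integrable_finsetSum _ fun k _ ↦ (hint' k).const_mul _
  rw [hmain, hsum, ← Real.norm_eq_abs]
  exact norm_integral_le_of_norm_le (hint' m)
    (Eventually.of_forall fun x ↦ abs_ite_sub_sum_choose_le _ _)

lemma tendsto_of_bonferroni {p : ℕ → ℝ} {b : ℕ → ℕ → ℝ} {a : ℝ}
    (h : ∀ n m, |p n - ∑ k ∈ Finset.range (m + 1), (-1) ^ k * b n k| ≤ b n m)
    (hb : ∀ k, Tendsto (fun n ↦ b n k) atTop (𝓝 (a ^ k / k.factorial))) :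
    Tendsto p atTop (𝓝 (exp (-a))) := by
  refine Metric.tendsto_atTop'.2 ?_
  intro ε hε
  have h1 := (FloorSemiring.tendsto_pow_div_factorial_atTop a)
  have h2 : Tendsto (fun m ↦ ∑ k ∈ Finset.range (m + 1), (-1) ^ k * (a ^ k / k.factorial))
      atTop (𝓝 (exp (-a))) := by
    have h3 := (NormedSpace.expSeries_div_hasSum_exp (𝔸 := ℝ) (-a)).tendsto_sum_nat
    rw [← Real.exp_eq_exp_ℝ] at h3
    refine (h3.comp (tendsto_add_atTop_nat 1)).congr fun m ↦ Finset.sum_congr rfl fun k _ ↦ ?_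
    rw [neg_pow]
    ring
  obtain ⟨m, hm1, hm2⟩ := ((h1.eventually (gt_mem_nhds (show 0 < ε / 3 by positivity))).and
    (h2.eventually (Metric.ball_mem_nhds _ (show 0 < ε / 3 by positivity)))).exists
  have h4 : Tendsto (fun n ↦ ∑ k ∈ Finset.range (m + 1), (-1) ^ k * b n k) atTop
      (𝓝 (∑ k ∈ Finset.range (m + 1), (-1) ^ k * (a ^ k / k.factorial))) :=
    tendsto_finsetSum _ fun k _ ↦ (hb k).const_mul _
  have h5 := ((hb m).eventually (gt_mem_nhds hm1)).and
    (h4.eventually (Metric.ball_mem_nhds _ (show 0 < ε / 3 by positivity)))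
  obtain ⟨n₀, hn₀⟩ := eventually_atTop.1 h5
  refine ⟨n₀, fun n hn ↦ ?_⟩
  obtain ⟨h6, h7⟩ := hn₀ n hn.le
  have h8 := h n m
  rw [Real.dist_eq, abs_lt] at h7 hm2 ⊢
  rw [abs_le] at h8
  constructor <;> linarith

/-- The event that the `i`-th point is isolated and its `r`-ball is contained in `Ω`. -/
def deepIsolated (Ω : Set Plane) (r : ℝ) {n : ℕ} (i : Fin n) : Set (Fin n → Plane) :=
  {X | closedBall (X i) r ⊆ Ω ∧ ∀ j, j ≠ i → r < dist (X i) (X j)}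

lemma measurableSet_deepIsolated {Ω : Set Plane} (hΩ : IsClosed Ω) (r : ℝ) {n : ℕ} (i : Fin n) :
    MeasurableSet (deepIsolated Ω r i) := by
  have : deepIsolated Ω r i = ((fun X : Fin n → Plane ↦ X i) ⁻¹' {y | closedBall y r ⊆ Ω}) ∩
      ⋂ j, ⋂ (_ : j ≠ i), {X : Fin n → Plane | r < dist (X i) (X j)} := by
    ext X
    simp [deepIsolated]
  rw [this]
  refine (measurable_pi_apply i (isClosed_setOf_closedBall_subset hΩ r).measurableSet).inter
    (MeasurableSet.iInter fun j ↦ MeasurableSet.iInter fun _ ↦ ?_)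
  exact measurableSet_lt measurable_const ((measurable_pi_apply i).dist (measurable_pi_apply j))

namespace IsBody

variable {Ω : Set Plane} {o : Plane} {ρ R : ℝ} {g : Plane → ℝ} (H : IsBody Ω o ρ R g)

include H

lemma measure_iInter_deepIsolated (r : ℝ) {n k : ℕ} {S : Finset (Fin n)} (hS : S.card = k) :
    (Measure.pi fun _ : Fin n ↦ volume.restrict Ω) (⋂ i ∈ S, deepIsolated Ω r i) =
      isolatedProb Ω r k (n - k) := by
  have := H.isProbabilityMeasure
  let e : Fin k ↪ Fin n := (S.orderEmbOfFin hS).toEmbedding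
  have he : Set.range e = S := Finset.range_orderEmbOfFin S hS
  have hA : MeasurableSet {q : (Fin k → Plane) × Plane | ∀ i, r < dist (q.1 i) q.2} := by
    rw [Set.ofPred_forall]
    exact MeasurableSet.iInter fun i ↦ measurableSet_lt measurable_const
      (((measurable_pi_apply i).comp measurable_fst).dist measurable_snd)
  refine Eq.trans ?_ (measure_pi_embedding_eq e
    (measurableSet_separated H.isCompact.isClosed r k) hA)
  congr 1
  ext X
  rw [Set.mem_iInter₂]
  constructor
  · intro h
    have h' (i : Fin k) := h (e i) (by rw [← Finset.mem_coe, ← he]; exact ⟨i, rfl⟩)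
    exact ⟨⟨fun i ↦ (h' i).1, fun i j hij ↦ (h' i).2 _ fun heq ↦ hij (e.injective heq).symm⟩,
      fun j hj i ↦ (h' i).2 _ fun heq ↦ hj ⟨i, heq.symm⟩⟩
  · rintro ⟨⟨h1, h2⟩, h3⟩ i hi
    rw [← Finset.mem_coe, ← he] at hi
    obtain ⟨a, rfl⟩ := hi
    refine ⟨h1 a, fun j hj ↦ ?_⟩
    by_cases hj' : j ∈ Set.range e
    · obtain ⟨b, rfl⟩ := hj'
      exact h2 fun hab ↦ hj (hab ▸ rfl)
    · exact h3 j hj' a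

lemma tendsto_measure_no_deepIsolated {c : ℝ} {r : ℕ → ℝ} (hc : 0 < c)
    (hr : ∀ n : ℕ, r n = √((log n + c) / (π * n))) :
    Tendsto (fun n : ℕ ↦ (Measure.pi fun _ : Fin n ↦ volume.restrict Ω).real
      (⋂ i, (deepIsolated Ω (r n) i)ᶜ)) atTop (𝓝 (exp (-exp (-c)))) := by
  have := H.isProbabilityMeasure
  refine tendsto_of_bonferroni (b := fun n k ↦ ∑ S ∈ Finset.powersetCard k Finset.univ,
    (Measure.pi fun _ : Fin n ↦ volume.restrict Ω).real (⋂ i ∈ S, deepIsolated Ω (r n) i))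
    (fun n m ↦ abs_measure_real_iInter_compl_sub_le _
      (fun i ↦ measurableSet_deepIsolated H.isCompact.isClosed (r n) i) m) fun k ↦ ?_
  have hsum (n : ℕ) : ∑ S ∈ Finset.powersetCard k Finset.univ,
      (Measure.pi fun _ : Fin n ↦ volume.restrict Ω).real (⋂ i ∈ S, deepIsolated Ω (r n) i) =
      n.choose k * (isolatedProb Ω (r n) k (n - k)).toReal := by
    rw [Finset.sum_congr rfl fun S hS ↦ by
      rw [measureReal_def, H.measure_iInter_deepIsolated (r n) (Finset.mem_powersetCard.1 hS).2]]
    simp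
  simp only [hsum]
  have h1 := (isEquivalent_choose k).mul (Asymptotics.IsEquivalent.refl (l := atTop)
    (u := fun n : ℕ ↦ (isolatedProb Ω (r n) k (n - k)).toReal))
  refine h1.symm.tendsto_nhds (((H.tendsto_isolatedProb hc hr k).div_const _).congr fun n ↦ ?_)
  simp only [Pi.mul_apply]
  ring

end IsBody

lemma norm_div_smul_sub_div_smul_le {E : Type*} [NormedAddCommGroup E] [NormedSpace ℝ E]
    {f g : E → ℝ} {C c : ℝ} (hc : 0 < c) (hf : ∀ v w, |f v - f w| ≤ C * ‖v - w‖)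
    (hg : ∀ v w, |g v - g w| ≤ C * ‖v - w‖) (hfn : ∀ v, |f v| ≤ C * ‖v‖)
    (hgn : ∀ v, c * ‖v‖ ≤ g v) (v w : E) :
    ‖(f v / g v) • v - (f w / g w) • w‖ ≤ (C / c + (C / c + (C / c) ^ 2)) * ‖v - w‖ := by
  wlog hvw : ‖w‖ ≤ ‖v‖ generalizing v w
  · rw [norm_sub_rev, norm_sub_rev v]
    exact this w v (le_of_not_ge hvw)
  rcases eq_or_ne v 0 with rfl | hv
  · rw [norm_zero] at hvw
    rw [norm_le_zero_iff.1 hvw]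
    simp
  have hv' : 0 < ‖v‖ := norm_pos_iff.2 hv
  have hgv : 0 < g v := (by positivity : 0 < c * ‖v‖).trans_le (hgn v)
  have hC : 0 ≤ C := by
    have := (abs_nonneg _).trans (hfn v)
    by_contra! h
    nlinarith
  have hq : |f v / g v| ≤ C / c := by
    rw [abs_div, abs_of_pos hgv, div_le_div_iff₀ hgv hc]
    calc |f v| * c ≤ C * ‖v‖ * c := by gcongr; exact hfn v
      _ = C * (c * ‖v‖) := by ring
      _ ≤ C * g v := by gcongr; exact hgn v
  have hd : |f v / g v - f w / g w| * ‖w‖ ≤ (C / c + (C / c) ^ 2) * ‖v - w‖ := by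
    rcases eq_or_ne w 0 with rfl | hw
    · simp only [norm_zero, mul_zero]
      positivity
    have hw' : 0 < ‖w‖ := norm_pos_iff.2 hw
    have hgw : 0 < g w := (by positivity : 0 < c * ‖w‖).trans_le (hgn w)
    have hid : f v / g v - f w / g w = (f v - f w) / g v - f w / g w * ((g v - g w) / g v) := by
      field_simp
      ring
    have h1 : ‖w‖ / g v ≤ 1 / c := by
      rw [div_le_div_iff₀ hgv hc]
      linarith [hgn v, mul_le_mul_of_nonneg_left hvw hc.le]
    have h2 : |f w / g w| ≤ C / c := by
      rw [abs_div, abs_of_pos hgw, div_le_div_iff₀ hgw hc]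
      calc |f w| * c ≤ C * ‖w‖ * c := by gcongr; exact hfn w
        _ = C * (c * ‖w‖) := by ring
        _ ≤ C * g w := by gcongr; exact hgn w
    have h3 {a : ℝ} (ha : |a| ≤ C * ‖v - w‖) : |a / g v| * ‖w‖ ≤ C / c * ‖v - w‖ := by
      rw [abs_div, abs_of_pos hgv]
      calc |a| / g v * ‖w‖ = |a| * (‖w‖ / g v) := by ring
        _ ≤ C * ‖v - w‖ * (1 / c) := by gcongr
        _ = C / c * ‖v - w‖ := by ring
    calc |f v / g v - f w / g w| * ‖w‖
        ≤ (|(f v - f w) / g v| + |f w / g w| * |(g v - g w) / g v|) * ‖w‖ := by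
          rw [hid, ← abs_mul]
          gcongr
          exact abs_sub _ _
      _ = |(f v - f w) / g v| * ‖w‖ + |f w / g w| * (|(g v - g w) / g v| * ‖w‖) := by ring
      _ ≤ C / c * ‖v - w‖ + C / c * (C / c * ‖v - w‖) := by
          refine add_le_add (h3 (hf v w)) ?_
          exact mul_le_mul h2 (h3 (hg v w)) (by positivity) (by positivity)
      _ = _ := by ring
  calc ‖(f v / g v) • v - (f w / g w) • w‖
      = ‖(f v / g v) • (v - w) + (f v / g v - f w / g w) • w‖ := by
        congr 1
        module
    _ ≤ |f v / g v| * ‖v - w‖ + |f v / g v - f w / g w| * ‖w‖ := by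
        refine (norm_add_le _ _).trans ?_
        rw [norm_smul, norm_smul, Real.norm_eq_abs, Real.norm_eq_abs]
    _ ≤ C / c * ‖v - w‖ + (C / c + (C / c) ^ 2) * ‖v - w‖ := by gcongr
    _ = _ := by ring

/-- The maximum norm on the plane. -/
noncomputable def maxNorm (v : Plane) : ℝ := max |v 0| |v 1|

lemma abs_apply_le_maxNorm (v : Plane) (i : Fin 2) : |v i| ≤ maxNorm v := by
  fin_cases i
  exacts [le_max_left _ _, le_max_right _ _]

lemma maxNorm_le {v : Plane} {a : ℝ} (h : ∀ i, |v i| ≤ a) : maxNorm v ≤ a := max_le (h 0) (h 1)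

lemma maxNorm_le_norm (v : Plane) : maxNorm v ≤ ‖v‖ :=
  maxNorm_le fun i ↦ by simpa using PiLp.norm_apply_le v i

lemma norm_le_two_mul_maxNorm (v : Plane) : ‖v‖ ≤ 2 * maxNorm v := by
  have h0 : 0 ≤ maxNorm v := (abs_nonneg _).trans (abs_apply_le_maxNorm v 0)
  rw [EuclideanSpace.norm_eq, Fin.sum_univ_two, Real.norm_eq_abs, Real.norm_eq_abs]
  refine Real.sqrt_le_iff.2 ⟨by positivity, ?_⟩
  have h1 := pow_le_pow_left₀ (abs_nonneg _) (abs_apply_le_maxNorm v 0) 2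
  have h2 := pow_le_pow_left₀ (abs_nonneg _) (abs_apply_le_maxNorm v 1) 2
  nlinarith

lemma maxNorm_smul (t : ℝ) (v : Plane) : maxNorm (t • v) = |t| * maxNorm v := by
  simp [maxNorm, abs_mul, mul_max_of_nonneg]

lemma abs_maxNorm_sub_le (v w : Plane) : |maxNorm v - maxNorm w| ≤ ‖v - w‖ := by
  have h (v w : Plane) : maxNorm v ≤ maxNorm w + ‖v - w‖ := maxNorm_le fun i ↦ by
    have h1 := abs_apply_le_maxNorm w i
    have h2 : |(v - w) i| ≤ ‖v - w‖ := (abs_apply_le_maxNorm _ i).trans (maxNorm_le_norm _)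
    have h3 : v i = w i + (v - w) i := by simp
    rw [h3]
    exact (abs_add_le _ _).trans (add_le_add h1 h2)
  have h1 := h v w
  have h2 := h w v
  rw [norm_sub_rev] at h2
  rw [abs_le]
  constructor <;> linarith

namespace IsBody

variable {Ω : Set Plane} {o : Plane} {ρ R : ℝ} {g : Plane → ℝ} (H : IsBody Ω o ρ R g)

include H

lemma gauge_add_smul {t : ℝ} (ht : 0 ≤ t) (v : Plane) : g (o + t • v) = t * g (o + v) := by
  have := H.homothety t (o + v) ht
  rwa [add_sub_cancel_left] at this

lemma norm_div_le_gauge (v : Plane) : ‖v‖ / R ≤ g (o + v) := by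
  have hR : 0 < R := H.pos.trans_le H.le
  have key {t : ℝ} (ht : 0 < t) (h : t * g (o + v) ≤ 1) : t * ‖v‖ ≤ R := by
    have h1 : o + t • v ∈ Ω := by rw [H.mem_iff, H.gauge_add_smul ht.le]; exact h
    have h2 := H.subset_closedBall h1
    rw [mem_closedBall, dist_eq_norm, add_sub_cancel_left, norm_smul, Real.norm_eq_abs,
      abs_of_pos ht] at h2
    exact h2
  rcases (H.nonneg (o + v)).eq_or_lt with h0 | h0
  · by_contra! h
    rw [← h0] at h
    have hv : 0 < ‖v‖ := by
      by_contra! h'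
      rw [le_antisymm h' (norm_nonneg v), zero_div] at h
      exact lt_irrefl _ h
    have := key (t := 2 * R / ‖v‖) (by positivity) (by rw [← h0]; simp)
    rw [div_mul_cancel₀ _ hv.ne'] at this
    linarith
  · have := key (inv_pos.2 h0) (inv_mul_cancel₀ h0.ne').le
    rw [inv_mul_le_iff₀ h0] at this
    rw [div_le_iff₀ hR]
    exact this

lemma abs_gauge_sub_le (v w : Plane) : |g (o + v) - g (o + w)| ≤ 1 / ρ * ‖v - w‖ := by
  have := H.abs_sub_le (o + v) (o + w)
  rw [dist_add_left, dist_eq_norm] at this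
  rwa [one_div_mul_eq_div]

/-- The body `Ω` is the image of a square under a bi-Lipschitz map. -/
lemma exists_chart : ∃ (ψ : Plane → Plane) (A B : ℝ), 0 < A ∧ 0 < B ∧
    (∀ x y, dist (ψ x) (ψ y) ≤ A * dist x y) ∧ (∀ x y, dist x y ≤ B * dist (ψ x) (ψ y)) ∧
    (∀ x ∈ Ω, ∀ i, |ψ x i| ≤ 1) ∧ ∀ p : Plane, (∀ i, |p i| ≤ 1) → ∃ x ∈ Ω, ψ x = p := by
  have hρ := H.pos
  have hR : 0 < R := hρ.trans_le H.le
  have hgo : g (o + 0) = 0 := by rw [add_zero, H.center_eq_zero]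
  have hg0 (v : Plane) (hv : v ≠ 0) : 0 < g (o + v) :=
    (div_pos (norm_pos_iff.2 hv) hR).trans_le (H.norm_div_le_gauge v)
  have hN0 (v : Plane) (hv : v ≠ 0) : 0 < maxNorm v := by
    have := norm_pos_iff.2 hv
    linarith [norm_le_two_mul_maxNorm v]
  have hNn (v : Plane) : 0 ≤ maxNorm v := (abs_nonneg _).trans (abs_apply_le_maxNorm v 0)
  let C := max 1 (1 / ρ)
  let c := min (1 / 2) (1 / R)
  have hC : 0 < C := lt_max_of_lt_left one_pos
  have hc : 0 < c := lt_min (by norm_num) (by positivity)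
  have hg1 (v w : Plane) : |g (o + v) - g (o + w)| ≤ C * ‖v - w‖ :=
    (H.abs_gauge_sub_le v w).trans (by gcongr; exact le_max_right _ _)
  have hN1 (v w : Plane) : |maxNorm v - maxNorm w| ≤ C * ‖v - w‖ :=
    (abs_maxNorm_sub_le v w).trans (le_mul_of_one_le_left (norm_nonneg _) (le_max_left _ _))
  have hg2 (v : Plane) : |g (o + v)| ≤ C * ‖v‖ := by
    have := hg1 v 0
    rwa [hgo, sub_zero, sub_zero] at this
  have hN2 (v : Plane) : |maxNorm v| ≤ C * ‖v‖ := by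
    have := hN1 v 0
    simpa [maxNorm] using this
  have hg3 (v : Plane) : c * ‖v‖ ≤ g (o + v) :=
    le_trans (by rw [← one_div_mul_eq_div]; gcongr; exact min_le_right _ _) (H.norm_div_le_gauge v)
  have hN3 (v : Plane) : c * ‖v‖ ≤ maxNorm v := by
    have h1 := norm_le_two_mul_maxNorm v
    have h2 : c * ‖v‖ ≤ 1 / 2 * ‖v‖ := by gcongr; exact min_le_left _ _
    linarith
  set D := C / c + (C / c + (C / c) ^ 2)
  have hD : 0 < D := by positivity
  let S (v : Plane) : Plane := (g (o + v) / maxNorm v) • v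
  let T (v : Plane) : Plane := (maxNorm v / g (o + v)) • v
  have hS (v w : Plane) : ‖S v - S w‖ ≤ D * ‖v - w‖ :=
    norm_div_smul_sub_div_smul_le (f := fun v ↦ g (o + v)) hc hg1 hN1 hg2 hN3 v w
  have hT (v w : Plane) : ‖T v - T w‖ ≤ D * ‖v - w‖ :=
    norm_div_smul_sub_div_smul_le (g := fun v ↦ g (o + v)) hc hN1 hg1 hN2 hg3 v w
  have hS0 : S 0 = 0 := smul_zero _
  have hT0 : T 0 = 0 := smul_zero _
  have hST (v : Plane) : S (T v) = v := by
    rcases eq_or_ne v 0 with rfl | hv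
    · rw [hT0, hS0]
    have h1 := hg0 v hv
    have h2 := hN0 v hv
    have h3 : 0 < maxNorm v / g (o + v) := div_pos h2 h1
    simp only [S, T]
    rw [H.gauge_add_smul h3.le, maxNorm_smul, abs_of_pos h3, smul_smul]
    convert one_smul ℝ v using 2
    field_simp
  have hTS (v : Plane) : T (S v) = v := by
    rcases eq_or_ne v 0 with rfl | hv
    · rw [hS0, hT0]
    have h1 := hg0 v hv
    have h2 := hN0 v hv
    have h3 : 0 < g (o + v) / maxNorm v := div_pos h1 h2
    simp only [S, T]
    rw [H.gauge_add_smul h3.le, maxNorm_smul, abs_of_pos h3, smul_smul]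
    convert one_smul ℝ v using 2
    field_simp
  have hgT (v : Plane) : g (o + T v) = maxNorm v := by
    rcases eq_or_ne v 0 with rfl | hv
    · rw [hT0, hgo]
      simp [maxNorm]
    have h1 := hg0 v hv
    have h2 := hN0 v hv
    have h3 : 0 < maxNorm v / g (o + v) := div_pos h2 h1
    simp only [T]
    rw [H.gauge_add_smul h3.le]
    field_simp
  refine ⟨fun x ↦ S (x - o), D, D, hD, hD, fun x y ↦ ?_, fun x y ↦ ?_, fun x hx i ↦ ?_,
    fun p hp ↦ ⟨o + T p, ?_, ?_⟩⟩
  · rw [dist_eq_norm, dist_eq_norm, ← sub_sub_sub_cancel_right x y o]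
    exact hS _ _
  · rw [dist_eq_norm, dist_eq_norm, ← sub_sub_sub_cancel_right x y o]
    have := hT (S (x - o)) (S (y - o))
    rwa [hTS, hTS] at this
  · refine (abs_apply_le_maxNorm _ i).trans ?_
    rw [← hgT, hTS, add_sub_cancel]
    exact (H.mem_iff x).1 hx
  · rw [H.mem_iff, hgT]
    exact maxNorm_le hp
  · simp only [add_sub_cancel_left, hST]

end IsBody

/-- A decomposition of `Ω` into `M ^ 2` cells, indexed by the map `γ`, which is adapted to the
radius `r`. -/
structure IsGrid (Ω : Set Plane) (r α : ℝ) (h M : ℕ) (γ : Plane → ℕ × ℕ) : Prop where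
  measurable : Measurable γ
  fst_lt : ∀ x ∈ Ω, (γ x).1 < M
  snd_lt : ∀ x ∈ Ω, (γ x).2 < M
  le_add : ∀ x ∈ Ω, ∀ y ∈ Ω, dist x y ≤ r → (γ x).1 ≤ (γ y).1 + h ∧ (γ x).2 ≤ (γ y).2 + h
  dist_le : ∀ x ∈ Ω, ∀ y ∈ Ω, ∀ L : ℕ, (γ x).1 ≤ (γ y).1 + L → (γ y).1 ≤ (γ x).1 + L →
    (γ x).2 ≤ (γ y).2 + L → (γ y).2 ≤ (γ x).2 + L → dist x y ≤ (L + 1) / 2 * r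
  le_area : ∀ i < M, ∀ j < M, α * r ^ 2 ≤ (volume.restrict Ω).real (γ ⁻¹' {(i, j)})

/-- The index of the cell containing the coordinate `t`, when `[-1, 1]` is divided into cells of
length `2 / m` centred at the multiples of `2 / m`. -/
noncomputable def cellIndex (m : ℕ) (t : ℝ) : ℕ := ⌊m * (t + 1) / 2 + 1 / 2⌋₊

lemma measurable_cellIndex (m : ℕ) : Measurable (cellIndex m) :=
  Nat.measurable_floor.comp (by fun_prop)

lemma cellIndex_lt {m : ℕ} {t : ℝ} (ht : |t| ≤ 1) : cellIndex m t < m + 1 := by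
  rw [abs_le] at ht
  have hm : (0 : ℝ) ≤ m := m.cast_nonneg
  rw [cellIndex, Nat.floor_lt (by nlinarith)]
  push_cast
  nlinarith

lemma cellIndex_le_add {m h : ℕ} {s t a : ℝ} (ht : |t| ≤ 1) (hst : |s - t| ≤ a)
    (ha : m * a / 2 ≤ h) : cellIndex m s ≤ cellIndex m t + h := by
  rw [abs_le] at ht hst
  have hm : (0 : ℝ) ≤ m := m.cast_nonneg
  rw [cellIndex, cellIndex, ← Nat.floor_add_natCast (by nlinarith)]
  refine Nat.floor_le_floor ?_
  nlinarith

lemma abs_sub_le_of_cellIndex {m L : ℕ} (hm : 0 < m) {s t : ℝ} (hs : |s| ≤ 1) (ht : |t| ≤ 1)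
    (h₁ : cellIndex m s ≤ cellIndex m t + L) (h₂ : cellIndex m t ≤ cellIndex m s + L) :
    |s - t| ≤ 2 * (L + 1) / m := by
  have hm' : (0 : ℝ) < m := by exact_mod_cast hm
  have key {s t : ℝ} (ht : |t| ≤ 1) (h : cellIndex m s ≤ cellIndex m t + L) :
      s - t ≤ 2 * (L + 1) / m := by
    rw [abs_le] at ht
    have h3 := Nat.lt_floor_add_one (m * (s + 1) / 2 + 1 / 2 : ℝ)
    have h4 := Nat.floor_le (show (0 : ℝ) ≤ m * (t + 1) / 2 + 1 / 2 by nlinarith)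
    have h5 : (⌊(m * (s + 1) / 2 + 1 / 2 : ℝ)⌋₊ : ℝ) ≤ ⌊(m * (t + 1) / 2 + 1 / 2 : ℝ)⌋₊ + L := by
      exact_mod_cast h
    rw [le_div_iff₀ hm']
    nlinarith
  rw [abs_sub_le_iff]
  exact ⟨key ht h₁, key hs h₂⟩

lemma cellIndex_eq {m i : ℕ} (hm : 0 < m) {t : ℝ} (h : |t - (2 * i / m - 1)| ≤ 1 / (2 * m)) :
    cellIndex m t = i := by
  have hm' : (0 : ℝ) < m := by exact_mod_cast hm
  have h1 : |m * (t - (2 * i / m - 1))| ≤ 1 / 2 := by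
    rw [abs_mul, abs_of_pos hm']
    calc (m : ℝ) * |t - (2 * i / m - 1)| ≤ m * (1 / (2 * m)) := by gcongr
      _ = 1 / 2 := by field_simp
  have h2 : m * (t - (2 * i / m - 1)) = m * (t + 1) - 2 * i := by
    field_simp
    ring
  rw [h2, abs_le] at h1
  rw [cellIndex, Nat.floor_eq_iff (by linarith [(i.cast_nonneg : (0 : ℝ) ≤ i)])]
  constructor <;> linarith

namespace IsBody

variable {Ω : Set Plane} {o : Plane} {ρ R : ℝ} {g : Plane → ℝ} (H : IsBody Ω o ρ R g)

include H

lemma exists_grid : ∃ (h : ℕ) (α b C r₀ : ℝ), 0 < h ∧ 0 < α ∧ 0 < b ∧ 0 < r₀ ∧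
    ∀ r, 0 < r → r ≤ r₀ → ∃ (M : ℕ) (γ : Plane → ℕ × ℕ),
      IsGrid Ω r α h M γ ∧ b ≤ r * M ∧ r * M ≤ C := by
  obtain ⟨ψ, A, B, hA, hB, hψ, hψ', hψ1, hsurj⟩ := H.exists_chart
  have hρ := H.pos
  have hR : 0 < R := hρ.trans_le H.le
  have hcoord (x y : Plane) (i : Fin 2) : |ψ x i - ψ y i| ≤ A * dist x y := by
    refine le_trans ?_ (hψ x y)
    rw [dist_eq_norm]
    exact (abs_apply_le_maxNorm (ψ x - ψ y) i).trans (maxNorm_le_norm _)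
  have hψc : Continuous ψ := by
    refine (LipschitzWith.of_dist_le_mul (K := A.toNNReal) fun x y ↦ ?_).continuous
    rw [Real.coe_toNNReal _ hA.le]
    exact hψ x y
  set h := ⌈A * (8 * B + 1)⌉₊ with hh
  have hh' : A * (8 * B + 1) ≤ h := Nat.le_ceil _
  set q := 1 / (2 * A * (8 * B + 1)) with hq
  have hq0 : 0 < q := by positivity
  refine ⟨h, π * (ρ / (2 * R)) ^ 2 * q ^ 2, 8 * B, 8 * B + 2, min 1 (R / q),
    Nat.ceil_pos.2 (by positivity), by positivity, by positivity,
    lt_min one_pos (by positivity), fun r hr hr0 ↦ ?_⟩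
  have hr1 : r ≤ 1 := hr0.trans (min_le_left _ _)
  have hrq : q * r ≤ R := by
    have := hr0.trans (min_le_right _ _)
    rw [le_div_iff₀ hq0] at this
    linarith
  set m := ⌈8 * B / r⌉₊
  have hm : 0 < m := Nat.ceil_pos.2 (by positivity)
  have hm' : (0 : ℝ) < m := by exact_mod_cast hm
  have hm1 : 8 * B ≤ m * r := by
    rw [← div_le_iff₀ hr]
    exact Nat.le_ceil _
  have hm2 : m * r ≤ 8 * B + r := by
    have := (Nat.ceil_lt_add_one (show 0 ≤ 8 * B / r by positivity)).le
    calc m * r ≤ (8 * B / r + 1) * r := by gcongr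
      _ = _ := by field_simp
  refine ⟨m + 1, fun x ↦ (cellIndex m (ψ x 0), cellIndex m (ψ x 1)), ⟨?_, ?_, ?_, ?_, ?_, ?_⟩, ?_,
    ?_⟩
  · have h0 (i : Fin 2) : Measurable fun x ↦ ψ x i := by
      have : Continuous fun x ↦ ψ x i := by fun_prop
      exact this.measurable
    exact ((measurable_cellIndex m).comp (h0 0)).prodMk ((measurable_cellIndex m).comp (h0 1))
  · exact fun x hx ↦ cellIndex_lt (hψ1 x hx 0)
  · exact fun x hx ↦ cellIndex_lt (hψ1 x hx 1)
  · intro x hx y hy hxy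
    have ha (i : Fin 2) : |ψ x i - ψ y i| ≤ A * r :=
      (hcoord x y i).trans (by gcongr)
    have hmh : m * (A * r) / 2 ≤ h := by
      refine le_trans ?_ hh'
      have : A * (m * r) ≤ A * (8 * B + 1) := by gcongr; linarith
      have : 0 ≤ A * (m * r) := by positivity
      linarith
    exact ⟨cellIndex_le_add (hψ1 y hy 0) (ha 0) hmh, cellIndex_le_add (hψ1 y hy 1) (ha 1) hmh⟩
  · intro x hx y hy L h1 h2 h3 h4
    have h5 : maxNorm (ψ x - ψ y) ≤ 2 * (L + 1) / m := by
      refine maxNorm_le fun i ↦ ?_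
      fin_cases i
      · exact abs_sub_le_of_cellIndex hm (hψ1 x hx 0) (hψ1 y hy 0) h1 h2
      · exact abs_sub_le_of_cellIndex hm (hψ1 x hx 1) (hψ1 y hy 1) h3 h4
    calc dist x y ≤ B * dist (ψ x) (ψ y) := hψ' x y
      _ ≤ B * (2 * (2 * (L + 1) / m)) := by
        rw [dist_eq_norm]
        gcongr
        exact (norm_le_two_mul_maxNorm _).trans (by gcongr)
      _ = (L + 1) / 2 * (8 * B) / m := by ring
      _ ≤ (L + 1) / 2 * (m * r) / m := by gcongr
      _ = (L + 1) / 2 * r := by field_simp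
  · intro i hi j hj
    have hcent (i : ℕ) (hi : i < m + 1) : |2 * (i : ℝ) / m - 1| ≤ 1 := by
      have : (i : ℝ) ≤ m := by exact_mod_cast Nat.lt_succ_iff.1 hi
      have h1 : 2 * (i : ℝ) / m ≤ 2 := by rw [div_le_iff₀ hm']; linarith
      have h2 : 0 ≤ 2 * (i : ℝ) / m := by positivity
      rw [abs_le]
      constructor <;> linarith
    obtain ⟨x, hx, hxp⟩ := hsurj !₂[2 * (i : ℝ) / m - 1, 2 * (j : ℝ) / m - 1] (by
      intro l
      fin_cases l
      · exact hcent i hi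
      · exact hcent j hj)
    have hAq : A * (q * r) ≤ 1 / (2 * m) := by
      rw [le_div_iff₀ (by positivity)]
      calc A * (q * r) * (2 * m) = m * r / (8 * B + 1) := by rw [hq]; field_simp
        _ ≤ 1 := by rw [div_le_one (by positivity)]; linarith
    have hsub : Ω ∩ closedBall x (q * r) ⊆
        (fun x ↦ (cellIndex m (ψ x 0), cellIndex m (ψ x 1))) ⁻¹' {(i, j)} ∩ Ω := by
      rintro y ⟨hyΩ, hy⟩
      have hy' (l : Fin 2) : |ψ y l - ψ x l| ≤ 1 / (2 * m) :=
        ((hcoord y x l).trans (by gcongr; exact hy)).trans hAq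
      rw [hxp] at hy'
      exact ⟨Prod.ext (cellIndex_eq hm (hy' 0)) (cellIndex_eq hm (hy' 1)), hyΩ⟩
    have harea := H.area_closedBall_inter_ge hx (by positivity : 0 ≤ q * r) hrq
    calc π * (ρ / (2 * R)) ^ 2 * q ^ 2 * r ^ 2 = π * (ρ / (2 * R)) ^ 2 * (q * r) ^ 2 := by ring
      _ ≤ volume.real (Ω ∩ closedBall x (q * r)) := harea
      _ ≤ volume.real ((fun x ↦ (cellIndex m (ψ x 0), cellIndex m (ψ x 1))) ⁻¹' {(i, j)} ∩ Ω) :=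
        measureReal_mono hsub
          (ne_top_of_le_ne_top (by rw [H.volume_eq]; simp) (measure_mono Set.inter_subset_right))
      _ = _ := by
        rw [measureReal_def, measureReal_def, Measure.restrict_apply' H.measurableSet]
  · push_cast
    linarith
  · push_cast
    linarith

end IsBody

section CellMap

variable {V : Type*} {G : SimpleGraph V} {γ : V → ℕ × ℕ} {M h L k : ℕ}

/-- An assignment `γ` of the vertices of a graph to the cells of an `M × M` grid, such that there
are fewer than `k` unoccupied cells in every `L × L` window. -/
structure IsCellMap (G : SimpleGraph V) (γ : V → ℕ × ℕ) (M h L k : ℕ) : Prop where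
  fst_lt : ∀ v, (γ v).1 < M
  snd_lt : ∀ v, (γ v).2 < M
  le_add : ∀ u v, G.Adj u v → (γ u).1 ≤ (γ v).1 + h ∧ (γ u).2 ≤ (γ v).2 + h
  reachable : ∀ u v, (γ u).1 ≤ (γ v).1 + 1 → (γ v).1 ≤ (γ u).1 + 1 →
    (γ u).2 ≤ (γ v).2 + 1 → (γ v).2 ≤ (γ u).2 + 1 → G.Reachable u v
  exists_occupied : ∀ s t, s + L ≤ M → t + L ≤ M → ∀ e : Fin k → ℕ × ℕ, e.Injective →
    (∀ i, s ≤ (e i).1 ∧ (e i).1 < s + L ∧ t ≤ (e i).2 ∧ (e i).2 < t + L) → ∃ i v, γ v = e i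
  h_pos : 0 < h
  k_pos : 0 < k
  lt_length : 2 * (k * h) < L
  length_le : L ≤ M

/-- All the cells of a rectangle are occupied. -/
def IsFull (γ : V → ℕ × ℕ) (x y w l : ℕ) : Prop :=
  ∀ i j, x ≤ i → i < x + w → y ≤ j → j < y + l → ∃ v, γ v = (i, j)

/-- The vertices in occupied columns and rows of the window at `(s, t)` can be reached from `g`. -/
def IsAnchored (G : SimpleGraph V) (γ : V → ℕ × ℕ) (h L : ℕ) (g : V) (s t : ℕ) : Prop :=
  (∀ x, s ≤ x → x + h ≤ s + L → IsFull γ x t h L → ∀ u, x ≤ (γ u).1 → (γ u).1 < x + h →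
    t ≤ (γ u).2 → (γ u).2 < t + L → G.Reachable u g) ∧
  ∀ y, t ≤ y → y + h ≤ t + L → IsFull γ s y L h → ∀ u, s ≤ (γ u).1 → (γ u).1 < s + L →
    y ≤ (γ u).2 → (γ u).2 < y + h → G.Reachable u g

lemma isFull_swap {x y w l : ℕ} : IsFull (Prod.swap ∘ γ) x y w l ↔ IsFull γ y x l w := by
  constructor
  · intro H i j h1 h2 h3 h4
    obtain ⟨v, hv⟩ := H j i h3 h4 h1 h2
    exact ⟨v, Prod.swap_injective hv⟩
  · intro H i j h1 h2 h3 h4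
    obtain ⟨v, hv⟩ := H j i h3 h4 h1 h2
    exact ⟨v, by rw [Function.comp, hv, Prod.swap_prod_mk]⟩

lemma IsAnchored.swap {g : V} {s t : ℕ} (H : IsAnchored G γ h L g s t) :
    IsAnchored G (Prod.swap ∘ γ) h L g t s :=
  ⟨fun x h1 h2 h3 u h4 h5 h6 h7 ↦ H.2 x h1 h2 (isFull_swap.1 h3) u h6 h7 h4 h5,
    fun x h1 h2 h3 u h4 h5 h6 h7 ↦ H.1 x h1 h2 (isFull_swap.1 h3) u h6 h7 h4 h5⟩

lemma isAnchored_swap {g : V} {s t : ℕ} :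
    IsAnchored G (Prod.swap ∘ γ) h L g t s ↔ IsAnchored G γ h L g s t :=
  ⟨fun H ↦ by simpa [← Function.comp_assoc] using H.swap, fun H ↦ H.swap⟩

lemma exists_window {a : ℕ} (ha : a < M) (hL : 2 * (k * h) < L) (hM : L ≤ M) :
    ∃ s, s + L ≤ M ∧ s ≤ a ∧ a < s + L ∧ (s = 0 ∨ s + k * h ≤ a) ∧
      (s + L = M ∨ a + k * h < s + L) := by
  rcases le_total a (k * h) with h1 | h1
  · exact ⟨0, by omega⟩
  · rcases le_total (a - k * h + L) M with h2 | h2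
    · exact ⟨a - k * h, by omega⟩
    · exact ⟨M - L, by omega⟩

namespace IsCellMap

variable (H : IsCellMap G γ M h L k)

include H

lemma swap : IsCellMap G (Prod.swap ∘ γ) M h L k where
  fst_lt := H.snd_lt
  snd_lt := H.fst_lt
  le_add u v huv := (H.le_add u v huv).symm
  reachable u v h1 h2 h3 h4 := H.reachable u v h3 h4 h1 h2
  exists_occupied s t hs ht e he h := by
    obtain ⟨i, v, hv⟩ := H.exists_occupied t s ht hs (Prod.swap ∘ e)
      (Prod.swap_injective.comp he) fun i ↦ ⟨(h i).2.2.1, (h i).2.2.2, (h i).1, (h i).2.1⟩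
    exact ⟨i, v, Prod.swap_injective (by simpa using hv)⟩
  h_pos := H.h_pos
  k_pos := H.k_pos
  lt_length := H.lt_length
  length_le := H.length_le

lemma exists_isFull {s t x₀ : ℕ} (hs : s + L ≤ M) (ht : t + L ≤ M) (h1 : s ≤ x₀)
    (h2 : x₀ + k * h ≤ s + L) : ∃ x, x₀ ≤ x ∧ x + h ≤ x₀ + k * h ∧ IsFull γ x t h L := by
  by_contra! hcon
  have hle (i : Fin k) : (i : ℕ) * h + h ≤ k * h := by
    rw [← Nat.succ_mul]
    exact Nat.mul_le_mul_right h i.2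
  have hex (i : Fin k) : ∃ p : ℕ × ℕ, x₀ + i * h ≤ p.1 ∧ p.1 < x₀ + i * h + h ∧ t ≤ p.2 ∧
      p.2 < t + L ∧ ∀ v, γ v ≠ p := by
    have := hcon (x₀ + i * h) (Nat.le_add_right _ _) (by have := hle i; omega)
    simp only [IsFull, not_forall, not_exists] at this
    obtain ⟨a, b, h3, h4, h5, h6, h7⟩ := this
    exact ⟨(a, b), h3, h4, h5, h6, h7⟩
  choose e he1 he2 he3 he4 he5 using hex
  obtain ⟨i, v, hv⟩ := H.exists_occupied s t hs ht e (fun i j hij ↦ by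
    have h3 := he1 i
    have h4 := he2 i
    have h5 := he1 j
    have h6 := he2 j
    rw [hij] at h3 h4
    rcases lt_trichotomy (i : ℕ) j with hlt | heq | hlt
    · have := Nat.mul_le_mul_right h hlt
      rw [Nat.succ_mul] at this
      omega
    · exact Fin.ext heq
    · have := Nat.mul_le_mul_right h hlt
      rw [Nat.succ_mul] at this
      omega) fun i ↦ by
    have := he1 i
    have := he2 i
    have := he3 i
    have := he4 i
    have := hle i
    omega
  exact he5 i v hv

lemma reachable_of_isFull {x y w l : ℕ} (hfull : IsFull γ x y w l) {u v : V}
    (hu1 : x ≤ (γ u).1) (hu2 : (γ u).1 < x + w) (hu3 : y ≤ (γ u).2) (hu4 : (γ u).2 < y + l)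
    (hv1 : x ≤ (γ v).1) (hv2 : (γ v).1 < x + w) (hv3 : y ≤ (γ v).2) (hv4 : (γ v).2 < y + l) :
    G.Reachable u v := by
  suffices ∀ n : ℕ, ∀ u, x ≤ (γ u).1 → (γ u).1 < x + w → y ≤ (γ u).2 → (γ u).2 < y + l →
      (γ u).1 ≤ (γ v).1 + n → (γ v).1 ≤ (γ u).1 + n → (γ u).2 ≤ (γ v).2 + n →
      (γ v).2 ≤ (γ u).2 + n → G.Reachable u v from
    this (x + w + y + l) u hu1 hu2 hu3 hu4 (by omega) (by omega) (by omega) (by omega)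
  intro n
  induction n with
  | zero => exact fun u _ _ _ _ h1 h2 h3 h4 ↦
      H.reachable u v (by omega) (by omega) (by omega) (by omega)
  | succ n ih =>
    intro u hu1 hu2 hu3 hu4 h1 h2 h3 h4
    have hstep (a b : ℕ) : ∃ c, a ≤ c + 1 ∧ c ≤ a + 1 ∧ (a ≤ c ∨ b ≤ c) ∧ (c ≤ a ∨ c ≤ b) ∧
        (a ≤ b + (n + 1) → c ≤ b + n) ∧ (b ≤ a + (n + 1) → b ≤ c + n) := by
      rcases lt_trichotomy a b with h | h | h
      · exact ⟨a + 1, by omega⟩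
      · exact ⟨a, by omega⟩
      · exact ⟨a - 1, by omega⟩
    obtain ⟨a, ha⟩ := hstep (γ u).1 (γ v).1
    obtain ⟨b, hb⟩ := hstep (γ u).2 (γ v).2
    obtain ⟨z, hz⟩ := hfull a b (by omega) (by omega) (by omega) (by omega)
    refine (H.reachable u z ?_ ?_ ?_ ?_).trans (ih z ?_ ?_ ?_ ?_ ?_ ?_ ?_ ?_) <;> rw [hz] <;>
      dsimp only <;> omega

lemma isAnchored_of_column {s t x : ℕ} {g : V} (hs : s + L ≤ M) (ht : t + L ≤ M) (hx : s ≤ x)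
    (hx' : x + h ≤ s + L) (hfull : IsFull γ x t h L)
    (hg : ∀ u, x ≤ (γ u).1 → (γ u).1 < x + h → t ≤ (γ u).2 → (γ u).2 < t + L →
      G.Reachable u g) : IsAnchored G γ h L g s t := by
  have hh := H.h_pos
  have hL := H.lt_length
  have hrow : ∀ y, t ≤ y → y + h ≤ t + L → IsFull γ s y L h → ∀ u, s ≤ (γ u).1 →
      (γ u).1 < s + L → y ≤ (γ u).2 → (γ u).2 < y + h → G.Reachable u g := by
    intro y h1 h2 h3 u h4 h5 h6 h7
    obtain ⟨z, hz⟩ := hfull x y le_rfl (by omega) h1 (by omega)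
    refine (H.reachable_of_isFull h3 h4 h5 h6 h7 ?_ ?_ ?_ ?_).trans (hg z ?_ ?_ ?_ ?_) <;>
      rw [hz] <;> dsimp only <;> omega
  refine ⟨fun x' h1 h2 h3 u h4 h5 h6 h7 ↦ ?_, hrow⟩
  obtain ⟨y, hy1, hy2, hy⟩ := H.swap.exists_isFull ht hs le_rfl (by omega : t + k * h ≤ t + L)
  rw [isFull_swap] at hy
  obtain ⟨z, hz⟩ := h3 x' y le_rfl (by omega) hy1 (by omega)
  refine (H.reachable_of_isFull h3 h4 h5 h6 h7 ?_ ?_ ?_ ?_).trans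
    (hrow y hy1 (by omega) hy z ?_ ?_ ?_ ?_) <;> rw [hz] <;> dsimp only <;> omega

lemma isAnchored_succ {s t : ℕ} {g : V} (hs : s + 1 + L ≤ M) (ht : t + L ≤ M)
    (hanch : IsAnchored G γ h L g s t) : IsAnchored G γ h L g (s + 1) t := by
  have hL := H.lt_length
  obtain ⟨x, hx1, hx2, hx⟩ := H.exists_isFull hs ht le_rfl
    (by omega : s + 1 + k * h ≤ s + 1 + L)
  exact H.isAnchored_of_column hs ht hx1 (by omega) hx
    (hanch.1 x (by omega) (by omega) hx)

lemma exists_isAnchored : ∃ g, ∀ s t, s + L ≤ M → t + L ≤ M → IsAnchored G γ h L g s t := by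
  have hh := H.h_pos
  have hL := H.lt_length
  have hM := H.length_le
  obtain ⟨x, -, hx2, hx⟩ := H.exists_isFull (s := 0) (t := 0) (by omega) (by omega) le_rfl
    (by omega)
  obtain ⟨g, hg⟩ := hx x 0 le_rfl (by omega) le_rfl (by omega)
  have h0 : IsAnchored G γ h L g 0 0 := by
    refine H.isAnchored_of_column (by omega) (by omega) (Nat.zero_le _) (by omega) hx
      fun u h1 h2 h3 h4 ↦ H.reachable_of_isFull hx h1 h2 h3 h4 ?_ ?_ ?_ ?_ <;>
      rw [hg] <;> dsimp only <;> omega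
  have h1 (t : ℕ) : t + L ≤ M → IsAnchored G γ h L g 0 t := by
    induction t with
    | zero => exact fun _ ↦ h0
    | succ t ih =>
      intro ht
      rw [← isAnchored_swap]
      exact H.swap.isAnchored_succ ht (by omega) (isAnchored_swap.2 (ih (by omega)))
  refine ⟨g, fun s t ↦ ?_⟩
  induction s with
  | zero => exact fun _ ↦ h1 t
  | succ s ih => exact fun hs ht ↦ H.isAnchored_succ hs ht (ih (by omega) ht)

lemma exists_barrier {s t a : ℕ} {g : V} (hanch : IsAnchored G γ h L g s t) (ht : t + L ≤ M)
    (ha : a < M) (hs : s + L ≤ M) (h1 : s = 0 ∨ s + k * h ≤ a)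
    (h2 : s + L = M ∨ a + k * h < s + L) :
    ∃ x₁ x₂, x₁ ≤ a ∧ a < x₂ ∧ (∀ x < M, x₁ ≤ x + h → x < x₂ + h → s ≤ x ∧ x < s + L) ∧
      ∀ u, t ≤ (γ u).2 → (γ u).2 < t + L → x₁ ≤ (γ u).1 + h → (γ u).1 < x₂ + h →
        (x₁ ≤ (γ u).1 ∧ (γ u).1 < x₂) ∨ G.Reachable u g := by
  have hL := H.lt_length
  have hleft : ∃ x₁, x₁ ≤ a ∧ (∀ x, x₁ ≤ x + h → s ≤ x) ∧
      ∀ u, t ≤ (γ u).2 → (γ u).2 < t + L → x₁ ≤ (γ u).1 + h → x₁ ≤ (γ u).1 ∨ G.Reachable u g := by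
    rcases h1 with rfl | h1
    · exact ⟨0, by omega, fun x _ ↦ x.zero_le, fun u _ _ _ ↦ Or.inl (Nat.zero_le _)⟩
    · obtain ⟨x, hx1, hx2, hx⟩ := H.exists_isFull hs ht le_rfl (by omega : s + k * h ≤ s + L)
      refine ⟨x + h, by omega, fun y hy ↦ by omega, fun u h3 h4 h5 ↦ ?_⟩
      by_cases h6 : x + h ≤ (γ u).1
      · exact Or.inl h6
      · exact Or.inr (hanch.1 x hx1 (by omega) hx u (by omega) (by omega) h3 h4)
  have hright : ∃ x₂, a < x₂ ∧ (∀ x < M, x < x₂ + h → x < s + L) ∧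
      ∀ u, t ≤ (γ u).2 → (γ u).2 < t + L → (γ u).1 < x₂ + h → (γ u).1 < x₂ ∨ G.Reachable u g := by
    rcases h2 with h2 | h2
    · exact ⟨M, by omega, by omega, fun u _ _ _ ↦ Or.inl (H.fst_lt u)⟩
    · obtain ⟨x, hx1, hx2, hx⟩ := H.exists_isFull hs ht (x₀ := s + L - k * h) (by omega) (by omega)
      refine ⟨x, by omega, fun y _ hy ↦ by omega, fun u h3 h4 h5 ↦ ?_⟩
      by_cases h6 : (γ u).1 < x
      · exact Or.inl h6
      · exact Or.inr (hanch.1 x (by omega) (by omega) hx u (by omega) (by omega) h3 h4)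
  obtain ⟨x₁, h3, h4, h5⟩ := hleft
  obtain ⟨x₂, h6, h7, h8⟩ := hright
  refine ⟨x₁, x₂, h3, h6, fun x hx hx1 hx2 ↦ ⟨h4 x hx1, h7 x hx hx2⟩, fun u hu1 hu2 hu3 hu4 ↦ ?_⟩
  rcases h5 u hu1 hu2 hu3 with h9 | h9
  · rcases h8 u hu1 hu2 hu4 with h10 | h10
    exacts [Or.inl ⟨h9, h10⟩, Or.inr h10]
  · exact Or.inr h9

/-- All the vertices in the large component of the graph can be reached from `g`, and the other
components are confined to windows. -/
theorem exists_forall_reachable_or : ∃ g, ∀ v, G.Reachable v g ∨ ∃ s t, ∀ u, G.Reachable v u →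
    (s ≤ (γ u).1 ∧ (γ u).1 < s + L) ∧ t ≤ (γ u).2 ∧ (γ u).2 < t + L := by
  obtain ⟨g, hg⟩ := H.exists_isAnchored
  refine ⟨g, fun v ↦ or_iff_not_imp_left.2 fun hv ↦ ?_⟩
  obtain ⟨s, hs, hs1, hs2, hs3, hs4⟩ := exists_window (H.fst_lt v) H.lt_length H.length_le
  obtain ⟨t, ht, ht1, ht2, ht3, ht4⟩ := exists_window (H.snd_lt v) H.lt_length H.length_le
  obtain ⟨x₁, x₂, hx1, hx2, hx3, hx4⟩ :=
    H.exists_barrier (hg s t hs ht) ht (H.fst_lt v) hs hs3 hs4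
  obtain ⟨y₁, y₂, hy1, hy2, hy3, hy4⟩ :=
    H.swap.exists_barrier (hg s t hs ht).swap hs (H.snd_lt v) ht ht3 ht4
  refine ⟨s, t, fun u hu ↦ ?_⟩
  suffices (x₁ ≤ (γ u).1 ∧ (γ u).1 < x₂) ∧ y₁ ≤ (γ u).2 ∧ (γ u).2 < y₂ from
    ⟨hx3 _ (H.fst_lt u) (by omega) (by omega), hy3 _ (H.snd_lt u) (by omega) (by omega)⟩
  rw [SimpleGraph.reachable_iff_reflTransGen] at hu
  induction hu with
  | refl => exact ⟨⟨hx1, hx2⟩, hy1, hy2⟩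
  | @tail b c hab hbc ih =>
    have hc : ¬ G.Reachable c g := fun h ↦
      hv (((SimpleGraph.reachable_iff_reflTransGen _ _).2 (hab.tail hbc)).trans h)
    have h1 := H.le_add b c hbc
    have h2 := H.le_add c b hbc.symm
    have h3 := hx3 _ (H.fst_lt c) (by omega) (by omega)
    have h4 := hy3 _ (H.snd_lt c) (by omega) (by omega)
    exact ⟨(hx4 c h4.1 h4.2 (by omega) (by omega)).resolve_right hc,
      (hy4 c h3.1 h3.2 (show _ ≤ (γ c).2 + h by omega)
        (show (γ c).2 < _ by omega)).resolve_right hc⟩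

end IsCellMap

end CellMap

/-- The event that some `L × L` window contains `k` cells without sample points. -/
def sparse (γ : Plane → ℕ × ℕ) (M L k n : ℕ) : Set (Fin n → Plane) :=
  {X | ∃ s t, s + L ≤ M ∧ t + L ≤ M ∧ ∃ e : Fin k → ℕ × ℕ, e.Injective ∧
    (∀ i, s ≤ (e i).1 ∧ (e i).1 < s + L ∧ t ≤ (e i).2 ∧ (e i).2 < t + L) ∧
      ∀ i j, γ (X j) ≠ e i}

namespace IsBody

variable {Ω : Set Plane} {o : Plane} {ρ R : ℝ} {g : Plane → ℝ} (H : IsBody Ω o ρ R g)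

include H

lemma measure_sparse_le {r α : ℝ} {h M L : ℕ} {γ : Plane → ℕ × ℕ} (hγ : IsGrid Ω r α h M γ)
    (hL : 0 < L) (k n : ℕ) :
    (Measure.pi fun _ : Fin n ↦ volume.restrict Ω) (sparse γ M L k n) ≤
      ENNReal.ofReal (M ^ 2 * (L ^ 2) ^ k * exp (-(n * (k * (α * r ^ 2))))) := by
  have := H.isProbabilityMeasure
  let ι := (Fin M × Fin M) × (Fin k → Fin L × Fin L)
  let cell (q : ι) (i : Fin k) : ℕ × ℕ := (q.1.1 + (q.2 i).1, q.1.2 + (q.2 i).2)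
  let U (q : ι) : Set Plane := ⋃ i, γ ⁻¹' {cell q i}
  let B (q : ι) : Set (Fin n → Plane) := {X | (cell q).Injective ∧ (∀ i, (cell q i).1 < M) ∧
    (∀ i, (cell q i).2 < M) ∧ ∀ j, X j ∈ (U q)ᶜ}
  have hsub : sparse γ M L k n ⊆ ⋃ q, B q := by
    rintro X ⟨s, t, hs, ht, e, he, hwin, hX⟩
    let q : ι := ((⟨s, by omega⟩, ⟨t, by omega⟩), fun i ↦ (⟨(e i).1 - s, by have := hwin i; omega⟩,
      ⟨(e i).2 - t, by have := hwin i; omega⟩))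
    have hq : cell q = e := by
      funext i
      have := hwin i
      exact Prod.ext (show s + ((e i).1 - s) = _ by omega) (show t + ((e i).2 - t) = _ by omega)
    refine Set.mem_iUnion.2 ⟨q, ?_⟩
    simp only [B, Set.mem_ofPred_eq, hq]
    refine ⟨he, fun i ↦ by have := hwin i; omega, fun i ↦ by have := hwin i; omega, fun j hj ↦ ?_⟩
    obtain ⟨i, hi⟩ := Set.mem_iUnion.1 hj
    rw [hq] at hi
    exact hX i j hi
  have hUm (q : ι) : MeasurableSet (U q) :=
    MeasurableSet.iUnion fun i ↦ hγ.measurable (measurableSet_singleton _)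
  have hB (q : ι) : (Measure.pi fun _ : Fin n ↦ volume.restrict Ω) (B q) ≤
      ENNReal.ofReal (exp (-(n * (k * (α * r ^ 2))))) := by
    by_cases hq : (cell q).Injective ∧ (∀ i, (cell q i).1 < M) ∧ ∀ i, (cell q i).2 < M
    · have hU : k * (α * r ^ 2) ≤ (volume.restrict Ω).real (U q) := by
        have hdisj : Pairwise (Function.onFun Disjoint fun i ↦ γ ⁻¹' {cell q i}) :=
          fun i j hij ↦ Set.disjoint_left.2 fun x hi hj ↦
            hij (hq.1 ((show γ x = _ from hi).symm.trans hj))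
        have hsum := measureReal_iUnion_fintype (μ := volume.restrict Ω) hdisj
          fun i ↦ hγ.measurable (measurableSet_singleton _)
        rw [hsum]
        calc k * (α * r ^ 2) = ∑ _i : Fin k, α * r ^ 2 := by simp
          _ ≤ _ := Finset.sum_le_sum fun i _ ↦ hγ.le_area _ (hq.2.1 i) _ (hq.2.2 i)
      refine (measure_mono (t := Set.univ.pi fun _ ↦ (U q)ᶜ) fun X hX j _ ↦ hX.2.2.2 j).trans ?_
      rw [Measure.pi_pi, Finset.prod_const, Finset.card_univ, Fintype.card_fin]
      exact measure_compl_pow_le (hUm q) hU n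
    · have : B q = ∅ := Set.eq_empty_of_forall_notMem fun X hX ↦ hq ⟨hX.1, hX.2.1, hX.2.2.1⟩
      rw [this, measure_empty]
      exact zero_le
  calc (Measure.pi fun _ : Fin n ↦ volume.restrict Ω) (sparse γ M L k n)
      ≤ ∑ q, (Measure.pi fun _ : Fin n ↦ volume.restrict Ω) (B q) :=
        (measure_mono hsub).trans (measure_iUnion_fintype_le _ _)
    _ ≤ ∑ _q : ι, ENNReal.ofReal (exp (-(n * (k * (α * r ^ 2))))) :=
        Finset.sum_le_sum fun q _ ↦ hB q
    _ = _ := by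
        rw [Finset.sum_const, Finset.card_univ, nsmul_eq_mul, ← ENNReal.ofReal_natCast,
          ← ENNReal.ofReal_mul (by positivity)]
        congr 2
        simp only [ι, Fintype.card_prod, Fintype.card_fun, Fintype.card_fin]
        push_cast
        ring

lemma exists_tendsto_measure_sparse {c : ℝ} {r : ℕ → ℝ} (hc : 0 < c)
    (hr : ∀ n : ℕ, r n = √((log n + c) / (π * n))) :
    ∃ (h k L : ℕ) (α : ℝ) (M : ℕ → ℕ) (γ : ℕ → Plane → ℕ × ℕ), 0 < h ∧ 0 < k ∧ 2 * (k * h) < L ∧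
      (∀ᶠ n in atTop, IsGrid Ω (r n) α h (M n) (γ n) ∧ L ≤ M n) ∧
      Tendsto (fun n ↦ (Measure.pi fun _ : Fin n ↦ volume.restrict Ω) (sparse (γ n) (M n) L k n))
        atTop (𝓝 0) := by
  obtain ⟨h, α, b, C, r₀, hh, hα, hb, hr₀, hgrid⟩ := H.exists_grid
  set k := ⌈2 * π / α⌉₊
  have hk : 2 * π ≤ k * α := by
    rw [← div_le_iff₀ hα]
    exact Nat.le_ceil _
  have hex (n : ℕ) : ∃ (M : ℕ) (γ : Plane → ℕ × ℕ), 0 < r n → r n ≤ r₀ →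
      IsGrid Ω (r n) α h M γ ∧ b ≤ r n * M ∧ r n * M ≤ C := by
    by_cases hrn : 0 < r n ∧ r n ≤ r₀
    · obtain ⟨M, γ, hMγ⟩ := hgrid (r n) hrn.1 hrn.2
      exact ⟨M, γ, fun _ _ ↦ hMγ⟩
    · exact ⟨0, fun _ ↦ 0, fun h1 h2 ↦ absurd ⟨h1, h2⟩ hrn⟩
  choose M γ hMγ using hex
  set L := 2 * (k * h) + 1
  have hr0 := tendsto_radius hr
  have hrL : Tendsto (fun n ↦ r n * L) atTop (𝓝 (0 * L)) := hr0.mul_const _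
  rw [zero_mul] at hrL
  refine ⟨h, k, L, α, M, γ, hh, Nat.ceil_pos.2 (by positivity), Nat.lt_succ_self _, ?_, ?_⟩
  · filter_upwards [eventually_gt_atTop 0, hr0.eventually (gt_mem_nhds hr₀),
      hrL.eventually (gt_mem_nhds hb)] with n hn hn1 hn2
    have hrp := radius_pos hc hr hn
    obtain ⟨h1, h2, -⟩ := hMγ n hrp hn1.le
    refine ⟨h1, ?_⟩
    have h3 : (L : ℝ) ≤ M n := le_of_mul_le_mul_left (hn2.le.trans h2) hrp
    exact_mod_cast h3
  · have hlim : Tendsto (fun n : ℕ ↦ C ^ 2 * (L ^ 2) ^ k * (n * (n * r n ^ 2) : ℝ)⁻¹) atTop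
        (𝓝 (C ^ 2 * (L ^ 2) ^ k * 0)) :=
      ((tendsto_natCast_atTop_atTop.atTop_mul_atTop₀
        (tendsto_mul_radius_sq hc hr)).inv_tendsto_atTop).const_mul _
    rw [mul_zero] at hlim
    refine tendsto_zero_of_le_ofReal hlim ?_
    filter_upwards [eventually_gt_atTop 0, hr0.eventually (gt_mem_nhds hr₀)] with n hn hn1
    have hrp := radius_pos hc hr hn
    have hn' : (0 : ℝ) < n := by exact_mod_cast hn
    obtain ⟨h1, -, h2⟩ := hMγ n hrp hn1.le
    refine (H.measure_sparse_le h1 (Nat.succ_pos _) k n).trans (ENNReal.ofReal_le_ofReal ?_)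
    have hexp : exp (-(n * (k * (α * r n ^ 2)))) ≤ (n ^ 2 : ℝ)⁻¹ := by
      have h3 : 2 * log n ≤ n * (k * (α * r n ^ 2)) := by
        have h4 := radius_sq hc hr hn
        have h5 : n * (2 * π * r n ^ 2) ≤ n * (k * α * r n ^ 2) := by gcongr
        nlinarith
      calc exp (-(n * (k * (α * r n ^ 2)))) ≤ exp (-(2 * log n)) := by gcongr
        _ = (n ^ 2 : ℝ)⁻¹ := by
          rw [exp_neg, mul_comm, exp_mul, exp_log hn']
          norm_cast
    have hM : (M n : ℝ) ^ 2 ≤ C ^ 2 / r n ^ 2 := by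
      rw [le_div_iff₀ (by positivity), ← mul_pow, mul_comm]
      gcongr
    calc (M n : ℝ) ^ 2 * (L ^ 2) ^ k * exp (-(n * (k * (α * r n ^ 2))))
        ≤ C ^ 2 / r n ^ 2 * (L ^ 2) ^ k * (n ^ 2 : ℝ)⁻¹ := by gcongr
      _ = _ := by field_simp

end IsBody

lemma IsGrid.isCellMap {Ω : Set Plane} {r α : ℝ} {h M k L n : ℕ} {γ : Plane → ℕ × ℕ}
    (hγ : IsGrid Ω r α h M γ) (hh : 0 < h) (hk : 0 < k) (hL : 2 * (k * h) < L) (hLM : L ≤ M)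
    {X : Fin n → Plane} (hX : ∀ i, X i ∈ Ω) (hs : X ∉ sparse γ M L k n) :
    IsCellMap (SimpleGraph.fromRel fun i j ↦ dist (X i) (X j) ≤ r) (γ ∘ X) M h L k where
  fst_lt i := hγ.fst_lt _ (hX i)
  snd_lt i := hγ.snd_lt _ (hX i)
  le_add i j hij := by
    refine hγ.le_add _ (hX i) _ (hX j) ?_
    rcases hij.2 with h | h
    · exact h
    · rwa [dist_comm]
  reachable i j h1 h2 h3 h4 := by
    by_cases hij : i = j
    · rw [hij]
    refine SimpleGraph.Adj.reachable ⟨hij, Or.inl ?_⟩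
    have := hγ.dist_le _ (hX i) _ (hX j) 1 h1 h2 h3 h4
    norm_num at this
    exact this
  exists_occupied s t hs' ht e he hwin := by
    by_contra! hcon
    exact hs ⟨s, t, hs', ht, e, he, hwin, fun i j ↦ hcon i j⟩
  h_pos := hh
  k_pos := hk
  lt_length := hL
  length_le := hLM

/-- A graph on points of `Ω` without isolated vertices is connected unless there is a pair of
nearby points with no other point in its empty zone, or a window with `k` unoccupied cells. -/
lemma IsGrid.connected {Ω : Set Plane} {r α : ℝ} {h M k L n : ℕ} {γ : Plane → ℕ × ℕ}
    (hγ : IsGrid Ω r α h M γ) (hh : 0 < h) (hk : 0 < k) (hL : 2 * (k * h) < L) (hLM : L ≤ M)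
    (hr : 0 ≤ r) {X : Fin n → Plane} (hX : ∀ i, X i ∈ Ω) (hs : X ∉ sparse γ M L k n) (hn : 0 < n)
    (hiso : ∀ i, ∃ j, j ≠ i ∧ dist (X i) (X j) ≤ r)
    (hpair : ∀ i j, i ≠ j → dist (X i) (X j) ≤ (L + 1) * r →
      ∃ l, l ≠ i ∧ l ≠ j ∧ X l ∈ emptyZone r (X i) (X j)) :
    (SimpleGraph.fromRel fun i j ↦ dist (X i) (X j) ≤ r).Connected := by
  classical
  set G := SimpleGraph.fromRel fun i j ↦ dist (X i) (X j) ≤ r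
  have hadj {i j : Fin n} (hij : i ≠ j) (hd : dist (X i) (X j) ≤ r) : G.Reachable i j :=
    SimpleGraph.Adj.reachable ⟨hij, Or.inl hd⟩
  obtain ⟨g, hg⟩ := (hγ.isCellMap hh hk hL hLM hX hs).exists_forall_reachable_or
  have : Nonempty (Fin n) := ⟨⟨0, hn⟩⟩
  suffices H : ∀ v, G.Reachable v g from ⟨fun u v ↦ (H u).trans (H v).symm⟩
  intro v
  refine (hg v).resolve_right ?_
  rintro ⟨s, t, hwin⟩
  obtain ⟨w, hwv, hdw⟩ := hiso v
  let A : Finset (Fin n × Fin n) :=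
    {p | p.1 ≠ p.2 ∧ G.Reachable v p.1 ∧ G.Reachable v p.2}
  have hA : A.Nonempty := ⟨(v, w), by simpa [A] using ⟨hwv.symm, hadj hwv.symm hdw⟩⟩
  obtain ⟨⟨i, j⟩, hij, hmax⟩ := A.exists_max_image (fun p ↦ dist (X p.1) (X p.2)) hA
  obtain ⟨hne, hi, hj⟩ : i ≠ j ∧ G.Reachable v i ∧ G.Reachable v j := by simpa [A] using hij
  have hmax' (a b : Fin n) (hab : a ≠ b) (ha : G.Reachable v a) (hb : G.Reachable v b) :
      dist (X a) (X b) ≤ dist (X i) (X j) :=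
    hmax (a, b) (by simpa [A] using ⟨hab, ha, hb⟩)
  have hdist : dist (X i) (X j) ≤ (L + 1) * r := by
    have h1 := hwin i hi
    have h2 := hwin j hj
    simp only [Function.comp_apply] at h1 h2
    refine (hγ.dist_le _ (hX i) _ (hX j) L (by omega) (by omega) (by omega) (by omega)).trans ?_
    exact mul_le_mul_of_nonneg_right (half_le_self (by positivity)) hr
  obtain ⟨l, hli, hlj, ⟨h1, h2⟩ | ⟨h1, h2⟩⟩ := hpair i j hne hdist
  · exact h2.not_ge (hmax' l j hlj (hi.trans (hadj hli h1).symm) hj)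
  · refine h2.not_ge (hmax' l i hli (hj.trans (hadj hlj h1).symm) hi)

lemma exists_dist_le_of_connected {E : Type*} [PseudoMetricSpace E] {r : ℝ} {n : ℕ} (hn : 1 < n)
    {X : Fin n → E} (hX : (SimpleGraph.fromRel fun i j ↦ dist (X i) (X j) ≤ r).Connected)
    (i : Fin n) : ∃ j, j ≠ i ∧ dist (X i) (X j) ≤ r := by
  have : Nontrivial (Fin n) := Fin.nontrivial_iff_two_le.2 hn
  obtain ⟨j, hj⟩ := hX.preconnected.exists_adj_of_nontrivial i
  refine ⟨j, hj.1.symm, ?_⟩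
  rcases hj.2 with h | h
  · exact h
  · rwa [dist_comm]

lemma measure_pi_exists_notMem {n : ℕ} {Ω : Set Plane} (hΩ : MeasurableSet Ω)
    [IsProbabilityMeasure (volume.restrict Ω)] :
    Measure.pi (fun _ : Fin n ↦ volume.restrict Ω) {X | ∃ i, X i ∉ Ω} = 0 := by
  have h : ∀ᵐ X ∂Measure.pi (fun _ : Fin n ↦ volume.restrict Ω), ∀ i, X i ∈ Ω :=
    ae_all_iff.2 fun i ↦ (measurePreserving_eval _ i).quasiMeasurePreserving.ae
      (ae_restrict_mem hΩ)
  simpa [ae_iff] using h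

lemma tendsto_measureReal_sub {α : ℕ → Type*} [∀ n, MeasurableSpace (α n)]
    {μ : ∀ n, Measure (α n)} [∀ n, IsFiniteMeasure (μ n)] {A B E : ∀ n, Set (α n)}
    (hAB : ∀ᶠ n in atTop, A n ⊆ B n) (hBE : ∀ᶠ n in atTop, B n ⊆ A n ∪ E n)
    (hE : Tendsto (fun n ↦ μ n (E n)) atTop (𝓝 0)) :
    Tendsto (fun n ↦ (μ n).real (B n) - (μ n).real (A n)) atTop (𝓝 0) := by
  have hE' : Tendsto (fun n ↦ (μ n).real (E n)) atTop (𝓝 0) :=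
    (ENNReal.tendsto_toReal ENNReal.zero_ne_top).comp hE
  refine tendsto_of_tendsto_of_tendsto_of_le_of_le' tendsto_const_nhds hE' ?_ ?_
  · filter_upwards [hAB] with n hn
    exact sub_nonneg.2 (measureReal_mono hn)
  · filter_upwards [hBE] with n hn
    rw [sub_le_iff_le_add']
    exact (measureReal_mono hn).trans (measureReal_union_le _ _)

end RandomGeometricGraph

open RandomGeometricGraph

theorem connectivity_critical_radius_2d_k0
    (Ω : Set (EuclideanSpace ℝ (Fin 2)))
    (hconv : Convex ℝ Ω) (hcomp : IsCompact Ω) (hint : (interior Ω).Nonempty)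
    (hvol : volume Ω = 1)
    (c : ℝ) (hc : 0 < c)
    (r : ℕ → ℝ)
    (hr : ∀ n : ℕ, r n = Real.sqrt ((Real.log n + c) / (π * n))) :
    Tendsto (fun n : ℕ =>
        ((Measure.pi fun _ : Fin n => volume.restrict Ω)
          {X : Fin n → EuclideanSpace ℝ (Fin 2) |
            ∀ i : Fin n, ∃ j : Fin n, j ≠ i ∧ dist (X i) (X j) ≤ r n}).toReal)
      atTop (𝓝 (Real.exp (-Real.exp (-c)))) ∧
    Tendsto (fun n : ℕ =>
        ((Measure.pi fun _ : Fin n => volume.restrict Ω)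
          {X : Fin n → EuclideanSpace ℝ (Fin 2) |
            (SimpleGraph.fromRel fun i j : Fin n =>
              dist (X i) (X j) ≤ r n).Connected}).toReal)
      atTop (𝓝 (Real.exp (-Real.exp (-c)))) := by
  obtain ⟨o, ρ, R, g, H⟩ := exists_isBody hconv hcomp hint hvol
  have := H.isProbabilityMeasure
  obtain ⟨h, k, L, α, M, γ, hh, hk, hL, hgrid, hsparse⟩ := H.exists_tendsto_measure_sparse hc hr
  have hiso := H.tendsto_measure_no_deepIsolated hc hr
  have hdiff := tendsto_measureReal_sub
    (μ := fun n ↦ Measure.pi fun _ : Fin n ↦ volume.restrict Ω)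
    (A := fun n ↦ {X | ∀ i, ∃ j, j ≠ i ∧ dist (X i) (X j) ≤ r n})
    (B := fun n ↦ ⋂ i, (deepIsolated Ω (r n) i)ᶜ)
    (.of_forall fun n X hX ↦ Set.mem_iInter.2 fun i hi ↦ by
      obtain ⟨j, hj, hij⟩ := hX i
      exact (hi.2 j hj).not_ge hij)
    (.of_forall fun n X hX ↦ by
      by_contra! hcon
      simp only [Set.mem_union, Set.mem_ofPred_eq, not_or, not_forall, not_exists, not_and, not_le]
        at hcon
      obtain ⟨⟨i, hi⟩, hdeep⟩ := hcon
      refine Set.mem_iInter.1 hX i ⟨?_, hi⟩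
      by_contra hnot
      obtain ⟨j, hj, hij⟩ := hdeep i hnot
      exact hij (hi j hj))
    (H.tendsto_measure_layer hc hr)
  have hN := hiso.sub hdiff
  simp only [sub_sub_cancel, sub_zero] at hN
  refine ⟨hN, ?_⟩
  have hbad := (hsparse.add (H.tendsto_measure_pairs hc hr (K := L + 1) (by simp))).add
    (tendsto_const_nhds (x := (0 : ℝ≥0∞)))
  simp only [add_zero] at hbad
  have hdiff' := tendsto_measureReal_sub
    (μ := fun n ↦ Measure.pi fun _ : Fin n ↦ volume.restrict Ω)
    (A := fun n ↦ {X | (SimpleGraph.fromRel fun i j ↦ dist (X i) (X j) ≤ r n).Connected})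
    (B := fun n ↦ {X | ∀ i, ∃ j, j ≠ i ∧ dist (X i) (X j) ≤ r n})
    (E := fun n ↦ (sparse (γ n) (M n) L k n ∪ {X | ∃ i j, i ≠ j ∧ dist (X i) (X j) ≤ (L + 1) * r n ∧
        ∀ l, l ≠ i → l ≠ j → X l ∉ emptyZone (r n) (X i) (X j)}) ∪ {X | ∃ i, X i ∉ Ω})
    (by
      filter_upwards [eventually_gt_atTop 1] with n hn X hX
      exact exists_dist_le_of_connected hn hX)
    (by
      filter_upwards [eventually_gt_atTop 0, hgrid] with n hn hγ X hX
      by_contra! hcon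
      simp only [Set.mem_union, Set.mem_ofPred_eq, not_or, not_exists, not_and, not_forall,
        not_not] at hcon
      obtain ⟨hnc, ⟨hs, hp⟩, hΩ⟩ := hcon
      refine hnc (hγ.1.connected hh hk hL hγ.2 (radius_pos hc hr hn).le hΩ hs hn hX
        fun i j hij hd ↦ ?_)
      obtain ⟨l, h1, h2, h3⟩ := hp i j hij hd
      exact ⟨l, h1, h2, h3⟩)
    (tendsto_of_tendsto_of_tendsto_of_le_of_le tendsto_const_nhds hbad (fun _ ↦ zero_le)
      fun n ↦ (measure_union_le _ _).trans <| by
        rw [measure_pi_exists_notMem H.measurableSet, add_zero]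
        exact measure_union_le _ _)
  have hC := hN.sub hdiff'
  simp only [sub_sub_cancel, sub_zero] at hC
  exact hC
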